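/- arXiv:1309.7404 — 4 statements merged into one kernel-verified Lean document; each statement's English description precedes it below -/
import Mathlib

section
/- Let J be a positive integer and b ∈ ℂ. Then: (1) there exist λ ∈ ℂ and a nonzero polynomial p of degree J − 1 such that y(z) = p(z)·exp(z³/3 − b·z) satisfies −y''(z) + (z⁴ − 2b·z² + 2J·z)·y(z) = λ·y(z) for all z ∈ ℂ; (2) any such y satisfies y(r·e^{iπ/3}) → 0 and y(r·e^{−iπ/3}) → 0 as r → +∞, so it is an eigenfunction of L_J(b); (3) conversely, if for some K ∈ ℂ, λ ∈ ℂ, and nonzero polynomial p the function y(z) = p(z)·exp(z³/3 − b·z) satisfies −y'' + (z⁴ − 2b·z² + 2K·z)·y = λ·y, then K = deg p + 1. -/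
open Complex Filter Polynomial

/-- The quasi-exactly solvable candidate eigenfunction `p(z) exp(z³/3 - b z)`. -/
noncomputable def qesFun (b : ℂ) (p : Polynomial ℂ) : ℂ → ℂ :=
  fun z => p.eval z * Complex.exp (z ^ 3 / 3 - b * z)

/-- `y` satisfies the quartic ODE `-y'' + (z⁴ - 2 b z² + 2 J z) y = λ y`. -/
def SatisfiesQuarticODE (J b lam : ℂ) (y : ℂ → ℂ) : Prop :=
  ∀ z : ℂ,
    -(deriv (deriv y) z) + (z ^ 4 - 2 * b * z ^ 2 + 2 * J * z) * y z = lam * y z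

/-- `y` is an eigenfunction of `L_J(b)` with eigenvalue `λ`. -/
def IsQuarticEigenfunction (J b lam : ℂ) (y : ℂ → ℂ) : Prop :=
  Differentiable ℂ y ∧ y ≠ 0 ∧ SatisfiesQuarticODE J b lam y ∧
  Tendsto (fun r : ℝ => y (r * Complex.exp (Complex.I * (Real.pi / 3))))
    atTop (nhds 0) ∧
  Tendsto (fun r : ℝ => y (r * Complex.exp (-Complex.I * (Real.pi / 3))))
    atTop (nhds 0)

noncomputable def qesOp (K b : ℂ) : Polynomial ℂ →ₗ[ℂ] Polynomial ℂ where
  toFun p := -(derivative (derivative p)) - C 2 * (X ^ 2 * derivative p) + C (2 * b) * derivative p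
    + C (2 * (K - 1)) * (X * p) - C (b ^ 2) * p
  map_add' p q := by simp only [map_add]; ring
  map_smul' c p := by
    simp only [smul_eq_C_mul, derivative_C_mul, RingHom.id_apply]; ring

lemma qesOp_apply (K b : ℂ) (p : Polynomial ℂ) : qesOp K b p =
    -(derivative (derivative p)) - C 2 * (X ^ 2 * derivative p) + C (2 * b) * derivative p
    + C (2 * (K - 1)) * (X * p) - C (b ^ 2) * p := rfl

lemma qesOp_coeff (K b : ℂ) (p : Polynomial ℂ) (m : ℕ) : (qesOp K b p).coeff (m + 1) =
    -(p.coeff (m + 3) * (m + 3) * (m + 2)) + 2 * b * (p.coeff (m + 2) * (m + 2))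
    + 2 * (K - 1 - m) * p.coeff m - b ^ 2 * p.coeff (m + 1) := by
  have h : (X ^ 2 * derivative p).coeff (m + 1) = m * p.coeff m := by
    rw [coeff_X_pow_mul']
    cases m with
    | zero => simp
    | succ n => simp [coeff_derivative]; ring
  rw [qesOp_apply]
  simp only [coeff_sub, coeff_add, coeff_neg, coeff_C_mul, h, coeff_X_mul, coeff_derivative]
  push_cast
  ring_nf

lemma qes_deriv (b : ℂ) (p : Polynomial ℂ) :
    deriv (qesFun b p) = qesFun b (derivative p + (X ^ 2 - C b) * p) := by
  funext z
  have h2 : HasDerivAt (fun z : ℂ => z ^ 3 / 3 - b * z) (z ^ 2 - b) z := by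
    have := ((hasDerivAt_pow 3 z).div_const 3).sub ((hasDerivAt_id' z).const_mul b)
    refine this.congr_deriv ?_
    push_cast
    ring
  have := (p.hasDerivAt z).mul h2.cexp
  have h3 : HasDerivAt (qesFun b p) _ z := this
  rw [h3.deriv]
  simp [qesFun]
  ring

lemma qes_differentiable (b : ℂ) (p : Polynomial ℂ) : Differentiable ℂ (qesFun b p) := by
  unfold qesFun
  have := p.differentiable
  fun_prop

lemma qes_ode_iff (K b lam : ℂ) (p : Polynomial ℂ) :
    SatisfiesQuarticODE K b lam (qesFun b p) ↔ qesOp K b p = C lam * p := by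
  have key : ∀ z, (-(deriv (deriv (qesFun b p)) z) +
      (z ^ 4 - 2 * b * z ^ 2 + 2 * K * z) * qesFun b p z) =
      (qesOp K b p).eval z * Complex.exp (z ^ 3 / 3 - b * z) := by
    intro z
    rw [qes_deriv, qes_deriv, qesOp_apply]
    simp [qesFun]
    ring
  constructor
  · intro h
    apply Polynomial.funext
    intro z
    have := h z
    rw [key, qesFun, ← mul_assoc] at this
    simpa using mul_right_cancel₀ (Complex.exp_ne_zero _) this
  · intro h z
    rw [key, h]
    simp [qesFun, mul_assoc]

lemma qes_degree (K b lam : ℂ) (p : Polynomial ℂ) (hp : p ≠ 0)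
    (h : qesOp K b p = C lam * p) : K = (p.natDegree : ℂ) + 1 := by
  have h1 := qesOp_coeff K b p p.natDegree
  have z : ∀ k, 0 < k → p.coeff (p.natDegree + k) = 0 := fun k hk =>
    coeff_eq_zero_of_natDegree_lt (by omega)
  rw [h, coeff_C_mul, z 1 (by norm_num), z 2 (by norm_num), z 3 (by norm_num)] at h1
  have h0 : p.coeff p.natDegree ≠ 0 := by simpa using hp
  have h2 : (K - 1 - p.natDegree) * p.coeff p.natDegree = 0 := by linear_combination -h1 / 2
  have h3 := (mul_eq_zero.mp h2).resolve_right h0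
  linear_combination h3

lemma qes_exists (J : ℕ) (hJ : 0 < J) (b : ℂ) :
    ∃ lam : ℂ, ∃ p : Polynomial ℂ, p ≠ 0 ∧ qesOp J b p = C lam * p := by
  have hinv : ∀ p ∈ degreeLT ℂ J, qesOp J b p ∈ degreeLT ℂ J := by
    intro p hp
    rw [mem_degreeLT, degree_lt_iff_coeff_zero] at hp ⊢
    intro j hj
    obtain ⟨m, rfl⟩ : ∃ m, j = m + 1 := ⟨j - 1, by omega⟩
    rw [qesOp_coeff, hp (m + 3) (by omega), hp (m + 2) (by omega), hp (m + 1) (by omega)]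
    rcases Nat.lt_or_ge m J with h | h
    · have : J = m + 1 := by omega
      subst this
      push_cast
      ring
    · rw [hp m h]; ring
  have hfin : FiniteDimensional ℂ (degreeLT ℂ J) :=
    Module.Finite.equiv (degreeLTEquiv ℂ J).symm
  have hnt : Nontrivial (degreeLT ℂ J) := by
    refine ⟨⟨⟨1, ?_⟩, 0, ?_⟩⟩
    · rw [mem_degreeLT, degree_one]; exact_mod_cast hJ
    · intro h
      exact one_ne_zero (congrArg Subtype.val h)
  obtain ⟨lam, hl⟩ := Module.End.exists_eigenvalue ((qesOp J b).restrict hinv)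
  obtain ⟨v, hv⟩ := hl.exists_hasEigenvector
  refine ⟨lam, v, fun h => hv.2 (Subtype.ext h), ?_⟩
  have := congrArg Subtype.val hv.apply_eq_smul
  simpa [smul_eq_C_mul] using this

lemma qes_tendsto (b w : ℂ) (hw : w ^ 3 = -1) (p : Polynomial ℂ) :
    Tendsto (fun r : ℝ => qesFun b p (r * w)) atTop (nhds 0) := by
  induction p using Polynomial.induction_on' with
  | add p q hp hq =>
    have := hp.add hq
    rw [add_zero] at this
    refine this.congr fun r => ?_
    simp [qesFun, add_mul]
  | monomial n a =>
    have h1 := (Real.tendsto_pow_mul_exp_neg_atTop_nhds_zero n).const_mul (‖a‖ * ‖w‖ ^ n)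
    rw [mul_zero] at h1
    refine squeeze_zero_norm' ?_ h1
    filter_upwards [eventually_ge_atTop 1,
      eventually_ge_atTop (3 * (1 - (b * w).re))] with r hr hr2
    have e : ((r : ℂ) * w) ^ 3 / 3 - b * (r * w) = ((-(r ^ 3) / 3 : ℝ) : ℂ) - (r : ℂ) * (b * w) := by
      push_cast
      rw [mul_pow, hw]; ring
    rw [qesFun, e, eval_monomial, norm_mul, Complex.norm_exp, Complex.sub_re, Complex.ofReal_re,
      Complex.re_ofReal_mul, norm_mul, norm_pow, norm_mul, Complex.norm_real, Real.norm_eq_abs,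
      abs_of_nonneg (by linarith)]
    have h5 : Real.exp (-(r ^ 3) / 3 - r * (b * w).re) ≤ Real.exp (-r) := by
      apply Real.exp_le_exp.mpr
      have h6 : r ≤ r ^ 2 := by nlinarith
      have h7 : 0 ≤ r * (r ^ 2 / 3 + (b * w).re - 1) := mul_nonneg (by linarith) (by linarith)
      nlinarith
    calc _ ≤ ‖a‖ * (r * ‖w‖) ^ n * Real.exp (-r) := by gcongr
      _ = _ := by ring

theorem qes_quartic_elementary_eigenfunctions (J : ℕ) (hJ : 0 < J) (b : ℂ) :
    -- (1) existence of an elementary solution with `deg p = J - 1`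
    (∃ lam : ℂ, ∃ p : Polynomial ℂ, p ≠ 0 ∧ p.natDegree = J - 1 ∧
      SatisfiesQuarticODE (J : ℂ) b lam (qesFun b p)) ∧
    -- (2) any such solution decays along the rays `arg z = ±π/3`,
    -- hence is an eigenfunction of `L_J(b)`
    (∀ lam : ℂ, ∀ p : Polynomial ℂ, p ≠ 0 →
      SatisfiesQuarticODE (J : ℂ) b lam (qesFun b p) →
      (Tendsto (fun r : ℝ => qesFun b p (r * Complex.exp (Complex.I * (Real.pi / 3))))
        atTop (nhds 0) ∧
       Tendsto (fun r : ℝ => qesFun b p (r * Complex.exp (-Complex.I * (Real.pi / 3))))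
        atTop (nhds 0) ∧
       IsQuarticEigenfunction (J : ℂ) b lam (qesFun b p))) ∧
    -- (3) conversely, the parameter is determined by the degree of `p`
    (∀ K lam : ℂ, ∀ p : Polynomial ℂ, p ≠ 0 →
      SatisfiesQuarticODE K b lam (qesFun b p) → K = (p.natDegree : ℂ) + 1) := by
  have w1 : Complex.exp (Complex.I * (Real.pi / 3)) ^ 3 = -1 := by
    rw [← Complex.exp_nat_mul, ← Complex.exp_pi_mul_I]
    congr 1; push_cast; ring
  have w2 : Complex.exp (-Complex.I * (Real.pi / 3)) ^ 3 = -1 := by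
    have h : Complex.exp (-Complex.I * (Real.pi / 3)) =
        (Complex.exp (Complex.I * (Real.pi / 3)))⁻¹ := by
      rw [← Complex.exp_neg, neg_mul]
    rw [h, inv_pow, w1]; norm_num
  refine ⟨?_, ?_, ?_⟩
  · obtain ⟨lam, p, hp, h⟩ := qes_exists J hJ b
    refine ⟨lam, p, hp, ?_, (qes_ode_iff _ _ _ _).2 h⟩
    have := qes_degree _ _ _ _ hp h
    have h2 : J = p.natDegree + 1 := by exact_mod_cast this
    omega
  · intro lam p hp h
    refine ⟨qes_tendsto b _ w1 p, qes_tendsto b _ w2 p, qes_differentiable b p, ?_, h,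
      qes_tendsto b _ w1 p, qes_tendsto b _ w2 p⟩
    intro h0
    apply hp
    apply Polynomial.funext
    intro z
    have := congrFun h0 z
    simpa [qesFun] using this
  · intro K lam p hp h
    exact qes_degree K b lam p hp ((qes_ode_iff _ _ _ _).1 h)
end

section
/- For every positive integer J, the quasi-exactly solvable spectral locus Z_J^{QES} is a nonempty, closed, connected subset of ℂ × ℂ. -/
open Complex Filter Polynomial

/-- The quasi-exactly solvable part of the spectral locus of `L_J`. -/
def qesSpectralLocus (J : ℂ) : Set (ℂ × ℂ) :=
  {q : ℂ × ℂ | ∃ p : Polynomial ℂ, p ≠ 0 ∧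
    SatisfiesQuarticODE J q.1 q.2 (qesFun q.1 p)}

open Complex Filter Polynomial Topology

namespace QES

/-- Specialization of a bivariate polynomial at a parameter value. -/
noncomputable abbrev sp (F : ℂ[X][X]) (b : ℂ) : ℂ[X] := F.map (evalRingHom b)

/-- The zero locus. -/
def locus (F : ℂ[X][X]) : Set (ℂ × ℂ) := {v | (sp F v.1).eval v.2 = 0}

lemma near_root (q : ℂ[X]) (hq : q.Monic) (x : ℂ) (δ : ℝ) (hδ : 0 < δ)
    (h : ‖q.eval x‖ < δ ^ q.natDegree) : ∃ r, q.eval r = 0 ∧ ‖x - r‖ < δ := by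
  by_contra! hcon
  have hs : q.Splits := IsAlgClosed.splits q
  rw [hs.eval_eq_prod_roots, hq.leadingCoeff, one_mul, hs.natDegree_eq_card_roots] at h
  have key : ∀ s : Multiset ℂ, (∀ r ∈ s, δ ≤ ‖x - r‖) →
      δ ^ s.card ≤ ‖(s.map (fun r => x - r)).prod‖ := by
    intro s
    induction s using Multiset.induction_on with
    | empty => simp
    | cons a s ih =>
      intro hs
      simp only [Multiset.map_cons, Multiset.prod_cons, norm_mul, Multiset.card_cons, pow_succ']
      have h1 := hs a (by simp)
      have h2 := ih (fun r hr => hs r (by simp [hr]))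
      gcongr
  have := key q.roots (fun r hr => hcon r (by simpa using (mem_roots'.1 hr).2))
  linarith

lemma contDiff_ev (F : ℂ[X][X]) :
    ContDiff ℂ 1 (fun v : ℂ × ℂ => (sp F v.1).eval v.2) := by
  have : (fun v : ℂ × ℂ => (sp F v.1).eval v.2) = fun v : ℂ × ℂ =>
      ∑ i ∈ Finset.range (F.natDegree + 1), (F.coeff i).eval v.1 * v.2 ^ i := by
    ext v
    rw [eval_eq_sum_range' (n := F.natDegree + 1)]
    · simp [sp]
    · exact Nat.lt_succ_of_le natDegree_map_le
  rw [this]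
  have hp : ∀ p : ℂ[X], ContDiff ℂ 1 (fun v : ℂ × ℂ => p.eval v.1) := by
    intro p
    have h := p.contDiff_aeval (𝕜 := ℂ) 1
    simp only [coe_aeval_eq_eval] at h
    exact h.comp contDiff_fst
  refine ContDiff.sum fun i _ => (hp _).mul (contDiff_snd.pow i)

lemma isClosed_locus (F : ℂ[X][X]) : IsClosed (locus F) :=
  isClosed_eq (contDiff_ev F).continuous continuous_const

lemma root_bound (F : ℂ[X][X]) (hF : F.Monic) (c : ℂ) :
    ∃ C : ℝ, ∀ b ∈ Metric.closedBall c 1, ∀ x, (b, x) ∈ locus F → ‖x‖ ≤ C := by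
  have h1 : ∀ i, ∃ C : ℝ, ∀ b ∈ Metric.closedBall c 1, ‖(F.coeff i).eval b‖ ≤ C := fun i =>
    (isCompact_closedBall c 1).exists_bound_of_continuousOn (F.coeff i).continuous.continuousOn
  choose C hC using h1
  refine ⟨∑ i ∈ Finset.range F.natDegree, |C i| + 1, fun b hb x hx => ?_⟩
  have hm : (sp F b).Monic := hF.map _
  have h2 := IsRoot.norm_lt_cauchyBound hm.ne_zero (a := x) hx
  have h3 : ((cauchyBound (sp F b) : NNReal) : ℝ) ≤ ∑ i ∈ Finset.range F.natDegree, |C i| + 1 := by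
    unfold cauchyBound
    rw [hm.leadingCoeff, hF.natDegree_map]
    simp only [nnnorm_one, div_one, NNReal.coe_add, NNReal.coe_one, add_le_add_iff_right]
    have : (∑ i ∈ Finset.range F.natDegree, |C i|) =
      ((∑ i ∈ Finset.range F.natDegree, Real.nnabs (C i) : NNReal) : ℝ) := by simp
    rw [this, NNReal.coe_le_coe]
    refine Finset.sup_le fun i hi => ?_
    refine le_trans ?_ (Finset.single_le_sum (f := fun i => Real.nnabs (C i))
      (fun _ _ => zero_le) hi)
    rw [← NNReal.coe_le_coe]
    simp only [coe_nnnorm, Real.coe_nnabs, sp, coeff_map, coe_evalRingHom]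
    exact (hC i b hb).trans (le_abs_self _)
  have h4 : ‖x‖ < ((cauchyBound (sp F b) : NNReal) : ℝ) := by exact_mod_cast h2
  linarith

lemma local_branch (F : ℂ[X][X]) (b x : ℂ) (h : (b, x) ∈ locus F)
    (hd : (derivative (sp F b)).eval x ≠ 0) :
    ∃ φ : ℂ → ℂ, φ b = x ∧ DifferentiableAt ℂ φ b ∧ ∀ᶠ b' in 𝓝 b, (b', φ b') ∈ locus F := by
  set f := (fun v : ℂ × ℂ => (sp F v.1).eval v.2) with hf
  have cdf : ContDiffAt ℂ 1 f (b, x) := (contDiff_ev F).contDiffAt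
  have hder : HasFDerivAt f (fderiv ℂ f (b, x)) (b, x) :=
    (cdf.differentiableAt (by simp)).hasFDerivAt
  have hcomp : HasFDerivAt (fun y => f (b, y))
      (fderiv ℂ f (b, x) ∘L .inr ℂ ℂ ℂ) x := by
    exact hder.comp x (hasFDerivAt_prodMk_right b x)
  have hval : (fderiv ℂ f (b, x) ∘L .inr ℂ ℂ ℂ) 1 = (derivative (sp F b)).eval x := by
    have h1 := hcomp.hasDerivAt
    exact h1.unique ((sp F b).hasDerivAt x)
  have inv : (fderiv ℂ f (b, x) ∘L .inr ℂ ℂ ℂ).IsInvertible := by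
    refine ⟨ContinuousLinearEquiv.unitsEquivAut ℂ (Units.mk0 _ hd), ?_⟩
    ext
    rw [hval]
    simp
  refine ⟨cdf.implicitFunction one_ne_zero inv, cdf.implicitFunction_apply_self _ _,
    (cdf.hasStrictFDerivAt_implicitFunction one_ne_zero inv).hasFDerivAt.differentiableAt, ?_⟩
  filter_upwards [cdf.eventually_apply_implicitFunction one_ne_zero inv] with b' hb'
  show f _ = 0
  rw [hb']
  exact h

lemma disc (F : ℂ[X][X]) (hF : F.Monic) (b₁ : ℂ)
    (h₁ : (sp F b₁).Separable) :
    ∃ D : Set ℂ, D.Finite ∧ ∀ b ∉ D, (sp F b).Separable := by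
  have hdeg : ∀ b, (derivative (sp F b)).natDegree = F.natDegree - 1 := by
    intro b
    have : (sp F b).natDegree = F.natDegree := hF.natDegree_map _
    rw [natDegree_derivative, this]
  set ρ := resultant F (derivative F) F.natDegree (F.natDegree - 1) with hρ
  have hev : ∀ b, ρ.eval b = resultant (sp F b) (derivative (sp F b)) := by
    intro b
    rw [hdeg, hF.natDegree_map, derivative_map, resultant_map_map]
    rfl
  have hiff : ∀ b, ρ.eval b = 0 ↔ ¬ (sp F b).Separable := by
    intro b
    have hm : (sp F b).Monic := hF.map _
    rw [hev, resultant_eq_zero_iff]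
    simp [hm.ne_zero, Separable]
  have hρ0 : ρ ≠ 0 := by
    intro h0
    exact (hiff b₁).1 (by simp [h0]) h₁
  refine ⟨{b | ρ.eval b = 0}, ?_, fun b hb => ?_⟩
  · refine ρ.roots.toFinset.finite_toSet.subset fun b hb => ?_
    simpa [hρ0] using hb
  · by_contra hh
    exact hb ((hiff b).2 hh)

lemma proj_full (F : ℂ[X][X]) (hF : F.Monic) (u v : Set (ℂ × ℂ)) (hu : IsClosed u)
    (hv : IsClosed v) (huv : Disjoint u v) (hs : locus F ⊆ u ∪ v)
    (hne : (locus F ∩ u).Nonempty) (b : ℂ) : ∃ x, (b, x) ∈ locus F ∩ u := by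
  set A : Set ℂ := {b | ∃ x, (b, x) ∈ locus F ∩ u} with hA
  have hcl : IsClosed A := by
    refine isClosed_of_closure_subset fun c hc => ?_
    obtain ⟨C, hC⟩ := root_bound F hF c
    have hK : IsCompact (locus F ∩ u ∩ (Metric.closedBall c 1 ×ˢ Metric.closedBall (0:ℂ) C)) :=
      ((isCompact_closedBall c 1).prod (isCompact_closedBall (0:ℂ) C)).inter_left
        ((isClosed_locus F).inter hu)
    have hK2 := (hK.image continuous_fst).isClosed
    have hsub : A ∩ Metric.ball c 1 ⊆ Prod.fst ''
        (locus F ∩ u ∩ (Metric.closedBall c 1 ×ˢ Metric.closedBall (0:ℂ) C)) := by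
      rintro b ⟨⟨x, hx⟩, hb⟩
      have hb' := Metric.ball_subset_closedBall hb
      exact ⟨(b, x), ⟨hx, hb', by simpa using hC b hb' x hx.1⟩, rfl⟩
    have hc2 : c ∈ closure (A ∩ Metric.ball c 1) := by
      rw [mem_closure_iff_nhds] at hc ⊢
      intro t ht
      obtain ⟨y, hy⟩ := hc (t ∩ Metric.ball c 1) (inter_mem ht (Metric.ball_mem_nhds c one_pos))
      exact ⟨y, hy.1.1, hy.2, hy.1.2⟩
    obtain ⟨⟨c', x⟩, hx, rfl⟩ := hK2.closure_subset_iff.2 hsub hc2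
    exact ⟨x, hx.1⟩
  have hop : IsOpen A := by
    rw [isOpen_iff_mem_nhds]
    rintro c ⟨x, hx⟩
    have hnv : vᶜ ∈ 𝓝 (c, x) := hv.isOpen_compl.mem_nhds (Set.disjoint_left.1 huv hx.2)
    obtain ⟨δ, hδ, hball⟩ := Metric.mem_nhds_iff.1 hnv
    have hcont : Tendsto (fun b => ‖(sp F b).eval x‖) (𝓝 c) (𝓝 0) := by
      have h1 : Continuous (fun b : ℂ => ‖(sp F b).eval x‖) :=
        ((contDiff_ev F).continuous.comp (Continuous.prodMk_left x)).norm
      have h2 := h1.tendsto c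
      have h3 : (sp F c).eval x = 0 := hx.1
      simpa [h3] using h2
    filter_upwards [hcont.eventually_lt_const (show 0 < δ ^ F.natDegree by positivity),
      Metric.ball_mem_nhds c hδ] with b h1 h2
    obtain ⟨r, hr, hxr⟩ := near_root (sp F b) (hF.map _) x δ hδ (by rwa [hF.natDegree_map])
    have hm : (b, r) ∈ locus F := hr
    refine ⟨r, hm, (hs hm).resolve_right fun h => hball (a := (b, r)) ?_ h⟩
    rw [Metric.mem_ball, Prod.dist_eq, max_lt_iff]
    exact ⟨h2, by rwa [dist_comm, dist_eq_norm]⟩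
  have : A = Set.univ := IsClopen.eq_univ ⟨hcl, hop⟩ (by
    obtain ⟨⟨b, x⟩, h⟩ := hne; exact ⟨b, x, h⟩)
  have hb : b ∈ A := this ▸ Set.mem_univ b
  exact hb

lemma separation (F : ℂ[X][X]) (hF : F.Monic) (u v : Set (ℂ × ℂ)) (hu : IsClosed u)
    (hv : IsClosed v) (huv : Disjoint u v) (c : ℂ) :
    ∃ δ > 0, ∀ b ∈ Metric.closedBall c 1, ∀ x y, (b, x) ∈ locus F ∩ u →
      (b, y) ∈ locus F ∩ v → δ ≤ ‖x - y‖ := by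
  obtain ⟨C, hC⟩ := root_bound F hF c
  have hK : IsCompact (locus F ∩ u ∩ (Metric.closedBall c 1 ×ˢ Metric.closedBall (0:ℂ) C)) :=
    ((isCompact_closedBall c 1).prod (isCompact_closedBall (0:ℂ) C)).inter_left
      ((isClosed_locus F).inter hu)
  have hdis : Disjoint (locus F ∩ u ∩ (Metric.closedBall c 1 ×ˢ Metric.closedBall (0:ℂ) C)) v :=
    huv.mono_left (fun z hz => hz.1.2)
  obtain ⟨δ, hδ, hd⟩ := hdis.exists_thickenings hK hv
  refine ⟨δ, hδ, fun b hb x y hx hy => ?_⟩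
  by_contra! hlt
  have hd2 := Set.disjoint_left.1 hd
  refine hd2 (a := (b, y)) ?_ (Metric.self_subset_thickening hδ _ hy.2)
  rw [Metric.mem_thickening_iff]
  refine ⟨(b, x), ⟨hx, hb, by simpa using hC b hb x hx.1⟩, ?_⟩
  rw [Prod.dist_eq, max_lt_iff]
  refine ⟨by simpa using hδ, ?_⟩
  rwa [dist_comm, dist_eq_norm]

open Classical in
/-- factor -/
noncomputable def fac (u v : Set (ℂ × ℂ)) (b x y : ℂ) : ℂ :=
  if (b, x) ∈ u ∧ (b, y) ∈ v then (x - y)⁻¹ else 1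

open Classical in
/-- product over pairs -/
noncomputable def pp (F : ℂ[X][X]) (u v : Set (ℂ × ℂ)) (b : ℂ) : ℂ :=
  ∏ z ∈ (sp F b).roots.toFinset ×ˢ (sp F b).roots.toFinset, fac u v b z.1 z.2

lemma mem_rts (F : ℂ[X][X]) (hF : F.Monic) (b x : ℂ) :
    x ∈ (sp F b).roots.toFinset ↔ (b, x) ∈ locus F := by
  have hm : (sp F b).Monic := hF.map _
  simp [hm.ne_zero, locus]

lemma fac_ne (u v : Set (ℂ × ℂ)) (huv : Disjoint u v) (b x y : ℂ) : fac u v b x y ≠ 0 := by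
  unfold fac
  split_ifs with h
  · refine inv_ne_zero (sub_ne_zero.2 ?_)
    rintro rfl
    exact Set.disjoint_left.1 huv h.1 h.2
  · exact one_ne_zero

lemma pp_diff (F : ℂ[X][X]) (hF : F.Monic) (u v : Set (ℂ × ℂ)) (hu : IsClosed u)
    (hv : IsClosed v) (huv : Disjoint u v) (hs : locus F ⊆ u ∪ v) (b : ℂ)
    (hsep : (sp F b).Separable) : DifferentiableAt ℂ (pp F u v) b := by
  classical
  set T := (sp F b).roots.toFinset with hT
  have hm : (sp F b).Monic := hF.map _
  have hcard : T.card = F.natDegree := by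
    rw [hT, Multiset.toFinset_card_of_nodup (nodup_roots hsep),
      ← (IsAlgClosed.splits (sp F b)).natDegree_eq_card_roots, hF.natDegree_map]
  have hbr : ∀ x : ℂ, ∃ φ : ℂ → ℂ, x ∈ T → (φ b = x ∧ DifferentiableAt ℂ φ b ∧
      ∀ᶠ b' in 𝓝 b, (b', φ b') ∈ locus F) := by
    intro x
    by_cases hx : x ∈ T
    · have hx' := (mem_rts F hF b x).1 hx
      have hd : (derivative (sp F b)).eval x ≠ 0 := by
        have h := hsep.eval₂_derivative_ne_zero (RingHom.id ℂ) (x := x) (by simpa using! hx')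
        simpa using! h
      obtain ⟨φ, h⟩ := local_branch F b x hx' hd
      exact ⟨φ, fun _ => h⟩
    · exact ⟨0, fun h => absurd h hx⟩
  choose φ hφ using hbr
  -- eventually all good
  have e1 : ∀ᶠ b' in 𝓝 b, ∀ x ∈ T, (b', φ x b') ∈ locus F :=
    (Finset.eventually_all T).2 fun x hx => (hφ x hx).2.2
  have hc : ∀ x ∈ T, ContinuousAt (φ x) b := fun x hx => (hφ x hx).2.1.continuousAt
  have e2 : ∀ᶠ b' in 𝓝 b, ∀ x ∈ T, ∀ y ∈ T, x ≠ y → φ x b' ≠ φ y b' := by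
    refine (Finset.eventually_all T).2 fun x hx => (Finset.eventually_all T).2 fun y hy => ?_
    by_cases hxy : x = y
    · simp [hxy]
    · have : φ x b ≠ φ y b := by rwa [(hφ x hx).1, (hφ y hy).1]
      filter_upwards [((hc x hx).sub (hc y hy)).tendsto.eventually_ne (sub_ne_zero.2 this)] with b' h _
      exact sub_ne_zero.1 h
  have e3 : ∀ w : Set (ℂ × ℂ), IsClosed w → ∀ᶠ b' in 𝓝 b, ∀ x ∈ T, (b, x) ∉ w →
      (b', φ x b') ∉ w := by
    intro w hw
    refine (Finset.eventually_all T).2 fun x hx => ?_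
    by_cases hxw : (b, x) ∈ w
    · simp [hxw]
    · have hcx : ContinuousAt (fun b' => (b', φ x b')) b := continuousAt_id.prodMk (hc x hx)
      have : wᶜ ∈ 𝓝 (b, φ x b) := hw.isOpen_compl.mem_nhds (by rw [(hφ x hx).1]; exact hxw)
      filter_upwards [hcx this] with b' h _ using h
  have hloc : ∀ x ∈ T, (b, x) ∈ locus F := fun x hx => (mem_rts F hF b x).1 hx
  have hev : pp F u v =ᶠ[𝓝 b] fun b' => ∏ z ∈ T ×ˢ T,
      if (b, z.1) ∈ u ∧ (b, z.2) ∈ v then (φ z.1 b' - φ z.2 b')⁻¹ else 1 := by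
    filter_upwards [e1, e2, e3 u hu, e3 v hv] with b' h1 h2 h3 h4
    have hinj : Set.InjOn (fun x => φ x b') T := by
      intro x hx y hy hxy
      by_contra hne
      exact h2 x hx y hy hne hxy
    have himg : (sp F b').roots.toFinset = T.image (fun x => φ x b') := by
      symm
      apply Finset.eq_of_subset_of_card_le
      · intro y hy
        obtain ⟨x, hx, rfl⟩ := Finset.mem_image.1 hy
        exact (mem_rts F hF _ _).2 (h1 x hx)
      · rw [Finset.card_image_of_injOn hinj, hcard]
        refine (Multiset.toFinset_card_le _).trans ((card_roots' _).trans ?_)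
        rw [hF.natDegree_map]
    have hmemu : ∀ x ∈ T, ((b', φ x b') ∈ u ↔ (b, x) ∈ u) := by
      intro x hx
      refine ⟨fun h => by_contra fun hn => h3 x hx hn h, fun h => ?_⟩
      exact (hs (h1 x hx)).resolve_right (h4 x hx (Set.disjoint_left.1 huv h))
    have hmemv : ∀ x ∈ T, ((b', φ x b') ∈ v ↔ (b, x) ∈ v) := by
      intro x hx
      refine ⟨fun h => by_contra fun hn => h4 x hx hn h, fun h => ?_⟩
      exact (hs (h1 x hx)).resolve_left (h3 x hx (Set.disjoint_right.1 huv h))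
    unfold pp
    rw [himg, Finset.prod_product, Finset.prod_image hinj, Finset.prod_product]
    refine Finset.prod_congr rfl fun x hx => ?_
    rw [Finset.prod_image hinj]
    refine Finset.prod_congr rfl fun y hy => ?_
    unfold fac
    simp only [hmemu x hx, hmemv y hy]
  refine DifferentiableAt.congr_of_eventuallyEq ?_ hev
  refine DifferentiableAt.fun_finsetProd fun z hz => ?_
  have hz1 := (Finset.mem_product.1 hz).1
  have hz2 := (Finset.mem_product.1 hz).2
  split_ifs with h
  · refine ((hφ _ hz1).2.1.sub (hφ _ hz2).2.1).inv ?_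
    simp only [Pi.sub_apply]
    rw [(hφ _ hz1).1, (hφ _ hz2).1, sub_ne_zero]
    intro heq
    exact Set.disjoint_left.1 huv h.1 (heq ▸ h.2)
  · exact differentiableAt_const _

lemma pp_bdd (F : ℂ[X][X]) (hF : F.Monic) (u v : Set (ℂ × ℂ)) (hu : IsClosed u)
    (hv : IsClosed v) (huv : Disjoint u v) (c : ℂ) :
    ∃ C : ℝ, ∀ b ∈ Metric.closedBall c 1, ‖pp F u v b‖ ≤ C := by
  classical
  obtain ⟨δ, hδ, h⟩ := separation F hF u v hu hv huv c
  refine ⟨(max 1 δ⁻¹) ^ (F.natDegree * F.natDegree), fun b hb => ?_⟩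
  have hcard : (sp F b).roots.toFinset.card ≤ F.natDegree := by
    refine (Multiset.toFinset_card_le _).trans ((card_roots' _).trans ?_)
    rw [hF.natDegree_map]
  unfold pp
  rw [norm_prod]
  calc _ ≤ ∏ z ∈ (sp F b).roots.toFinset ×ˢ (sp F b).roots.toFinset, max 1 δ⁻¹ := by
        refine Finset.prod_le_prod (fun _ _ => norm_nonneg _) fun z hz => ?_
        have hz1 := (mem_rts F hF _ _).1 (Finset.mem_product.1 hz).1
        have hz2 := (mem_rts F hF _ _).1 (Finset.mem_product.1 hz).2
        unfold fac
        split_ifs with hh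
        · refine le_max_of_le_right ?_
          rw [norm_inv]
          exact inv_anti₀ hδ (h b hb _ _ ⟨hz1, hh.1⟩ ⟨hz2, hh.2⟩)
        · simp
    _ ≤ _ := by
        rw [Finset.prod_const, Finset.card_product]
        exact pow_le_pow_right₀ (le_max_left _ _) (Nat.mul_le_mul hcard hcard)

theorem abstract_preconnected (F : ℂ[X][X]) (hF : F.Monic) (R : ℝ)
    (hR : ∀ b : ℂ, R < ‖b‖ → (sp F b).Separable ∧ ∀ x y, (b, x) ∈ locus F → (b, y) ∈ locus F →
      x ≠ y → √‖b‖ ≤ ‖x - y‖) : IsPreconnected (locus F) := by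
  classical
  rw [isPreconnected_iff_subset_of_fully_disjoint_closed (isClosed_locus F)]
  intro u v hu hv hs huv
  by_contra! hcon
  have hneu : (locus F ∩ u).Nonempty := by
    obtain ⟨z, hz, hzv⟩ := Set.not_subset.1 hcon.2
    exact ⟨z, hz, (hs hz).resolve_right hzv⟩
  have hnev : (locus F ∩ v).Nonempty := by
    obtain ⟨z, hz, hzv⟩ := Set.not_subset.1 hcon.1
    exact ⟨z, hz, (hs hz).resolve_left hzv⟩
  have hfu := proj_full F hF u v hu hv huv hs hneu
  have hfv := proj_full F hF v u hv hu huv.symm (by rwa [Set.union_comm]) hnev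
  obtain ⟨D, hDf, hD⟩ := disc F hF (((|R| + 1 : ℝ)) : ℂ) (hR _ (by
    rw [Complex.norm_real, Real.norm_of_nonneg (by positivity)]
    linarith [le_abs_self R])).1
  set P := pp F u v with hP
  have hPd : ∀ b ∉ D, DifferentiableAt ℂ P b := fun b hb =>
    pp_diff F hF u v hu hv huv hs b (hD b hb)
  have hP0 : ∀ b, P b ≠ 0 := fun b => Finset.prod_ne_zero_iff.2 fun z _ => fac_ne u v huv _ _ _
  set g : ℂ → ℂ := fun b => limUnder (𝓝[≠] b) P with hg
  have hgP : ∀ b ∉ D, g b = P b := by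
    intro b hb
    exact ((hPd b hb).continuousAt.tendsto.mono_left nhdsWithin_le_nhds).limUnder_eq
  have hgd : Differentiable ℂ g := by
    intro c
    obtain ⟨C, hC⟩ := pp_bdd F hF u v hu hv huv c
    have hs1 : (D \ {c})ᶜ ∩ Metric.closedBall c 1 ∈ 𝓝 c :=
      inter_mem ((hDf.subset Set.sdiff_subset).isClosed.isOpen_compl.mem_nhds (by simp))
        (Metric.closedBall_mem_nhds c one_pos)
    have hnot : ∀ b ∈ ((D \ {c})ᶜ ∩ Metric.closedBall c 1) \ {c}, b ∉ D := by
      rintro b ⟨⟨h1, _⟩, h2⟩ h3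
      exact h1 ⟨h3, h2⟩
    have hup := differentiableOn_update_limUnder_of_bddAbove (f := P) hs1
      (fun b hb => (hPd b (hnot b hb)).differentiableWithinAt)
      ⟨C, by
        rintro _ ⟨b, hb, rfl⟩
        exact hC b hb.1.2⟩
    refine (hup.differentiableAt hs1).congr_of_eventuallyEq ?_
    filter_upwards [hs1] with b hb
    by_cases hbc : b = c
    · subst hbc; simp [hg]
    · rw [Function.update_of_ne hbc]
      exact hgP b (hnot b ⟨hb, hbc⟩)
  obtain ⟨R₀, hR₀⟩ := hDf.isBounded.exists_norm_le
  have hest : ∀ b : ℂ, max (max R R₀) 1 < ‖b‖ → ‖g b‖ ≤ (√‖b‖)⁻¹ := by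
    intro b hb
    simp only [max_lt_iff] at hb
    have hbD : b ∉ D := fun h => by linarith [hR₀ b h]
    rw [hgP b hbD]
    have hsq : 1 ≤ √‖b‖ := Real.one_le_sqrt.2 hb.2.le
    obtain ⟨x, hx⟩ := hfu b
    obtain ⟨y, hy⟩ := hfv b
    have hfac : ∀ x y, (b, x) ∈ locus F → (b, y) ∈ locus F → (b, x) ∈ u → (b, y) ∈ v →
        ‖fac u v b x y‖ ≤ (√‖b‖)⁻¹ := by
      intro x y hx hy hxu hyv
      have hne : x ≠ y := by
        rintro rfl
        exact Set.disjoint_left.1 huv hxu hyv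
      unfold fac
      rw [if_pos ⟨hxu, hyv⟩, norm_inv]
      exact inv_anti₀ (by linarith) ((hR b hb.1.1).2 x y hx hy hne)
    have hmem : (x, y) ∈ (sp F b).roots.toFinset ×ˢ (sp F b).roots.toFinset :=
      Finset.mem_product.2 ⟨(mem_rts F hF _ _).2 hx.1, (mem_rts F hF _ _).2 hy.1⟩
    rw [hP]
    unfold pp
    rw [norm_prod, ← Finset.mul_prod_erase _ _ hmem]
    refine (mul_le_of_le_one_right (norm_nonneg _) ?_).trans
      (hfac x y hx.1 hy.1 hx.2 hy.2)
    refine Finset.prod_le_one (fun _ _ => norm_nonneg _) fun z hz => ?_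
    have hz := Finset.mem_of_mem_erase hz
    have hz1 := (mem_rts F hF _ _).1 (Finset.mem_product.1 hz).1
    have hz2 := (mem_rts F hF _ _).1 (Finset.mem_product.1 hz).2
    by_cases hh : (b, z.1) ∈ u ∧ (b, z.2) ∈ v
    · exact (hfac _ _ hz1 hz2 hh.1 hh.2).trans (inv_le_one_of_one_le₀ hsq)
    · simp [fac, hh]
  have hlim : Tendsto g (cocompact ℂ) (𝓝 0) := by
    have hn : Tendsto (fun b : ℂ => ‖b‖) (cocompact ℂ) atTop := tendsto_norm_cocompact_atTop
    refine squeeze_zero_norm' ?_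
      (tendsto_inv_atTop_zero.comp (Real.tendsto_sqrt_atTop.comp hn))
    filter_upwards [hn.eventually_gt_atTop (max (max R R₀) 1)] with b hb
    exact hest b hb
  obtain ⟨b, hb⟩ := hDf.infinite_compl.nonempty
  have := hgd.apply_eq_of_tendsto_cocompact b hlim
  rw [hgP b hb] at this
  exact hP0 b this

/-- The conjugated operator on polynomials. -/
noncomputable def L (n : ℕ) (α β : ℂ) : ℂ[X] →ₗ[ℂ] ℂ[X] where
  toFun p := -(C α * derivative (derivative p) + 2 * (X ^ 2 - C β) * derivative p
    - 2 * (n : ℂ[X]) * X * p)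
  map_add' p q := by simp only [derivative_add]; ring
  map_smul' c p := by
    simp only [smul_eq_C_mul, RingHom.id_apply, derivative_C_mul]; ring

lemma L_apply (n : ℕ) (α β : ℂ) (p : ℂ[X]) :
    L n α β p = -(C α * derivative (derivative p) + 2 * (X ^ 2 - C β) * derivative p
    - 2 * (n : ℂ[X]) * X * p) := rfl

lemma coeff_X_mul_derivative (p : ℂ[X]) (k : ℕ) : (X * derivative p).coeff k = k * p.coeff k := by
  cases k with
  | zero => simp
  | succ k => rw [coeff_X_mul, coeff_derivative]; push_cast; ring

lemma coeff_L (n : ℕ) (α β : ℂ) (p : ℂ[X]) (k : ℕ) :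
    (L n α β p).coeff (k + 1) = -(α * ((k + 2) * (k + 3) * p.coeff (k + 3))
      + 2 * (k - n) * p.coeff k - 2 * β * ((k + 2) * p.coeff (k + 2))) := by
  have : L n α β p = -(C α * derivative (derivative p) + C 2 * (X * (X * derivative p))
     - C (2 * β) * derivative p - C (2 * (n : ℂ)) * (X * p)) := by
    rw [L_apply]; simp only [map_mul, map_ofNat, map_natCast]; ring
  rw [this]
  simp only [coeff_neg, coeff_sub, coeff_add, coeff_C_mul, coeff_X_mul, coeff_X_mul_derivative,
    coeff_derivative]
  push_cast
  ring

lemma L_degree (n : ℕ) (α β : ℂ) (p : ℂ[X]) (hp : p.natDegree ≤ n) (k : ℕ) (hk : n < k) :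
    (L n α β p).coeff k = 0 := by
  obtain ⟨k, rfl⟩ : ∃ m, k = m + 1 := ⟨k - 1, by omega⟩
  rw [coeff_L, coeff_eq_zero_of_natDegree_lt (n := k + 3) (by omega),
    coeff_eq_zero_of_natDegree_lt (n := k + 2) (by omega)]
  rcases eq_or_lt_of_le (show n ≤ k by omega) with rfl | h
  · simp
  · rw [coeff_eq_zero_of_natDegree_lt (n := k) (by omega)]; simp

/-- Matrix of `L` on polynomials of degree at most `n`. -/
noncomputable def M (n : ℕ) (α β : ℂ) : Matrix (Fin (n + 1)) (Fin (n + 1)) ℂ :=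
  Matrix.of fun i j => (L n α β (X ^ (j : ℕ))).coeff i

/-- polynomial from coefficients -/
noncomputable def ofVec {n : ℕ} (v : Fin (n + 1) → ℂ) : ℂ[X] :=
  ∑ j, v j • X ^ (j : ℕ)

lemma ofVec_coeff {n : ℕ} (v : Fin (n + 1) → ℂ) (i : Fin (n + 1)) : (ofVec v).coeff i = v i := by
  simp only [ofVec, finsetSum_coeff, coeff_smul, coeff_X_pow, smul_eq_mul, mul_ite, mul_one,
    mul_zero]
  simp [Fin.val_inj]

lemma ofVec_natDegree {n : ℕ} (v : Fin (n + 1) → ℂ) : (ofVec v).natDegree ≤ n := by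
  refine natDegree_sum_le_of_forall_le _ _ fun j _ => ?_
  refine (natDegree_smul_le _ _).trans ?_
  rw [natDegree_X_pow]
  omega

lemma ext_le {n : ℕ} {p q : ℂ[X]} (hp : ∀ k, n < k → p.coeff k = 0)
    (hq : ∀ k, n < k → q.coeff k = 0) (h : ∀ i : Fin (n + 1), p.coeff i = q.coeff i) : p = q := by
  ext k
  by_cases hk : k < n + 1
  · exact h ⟨k, hk⟩
  · rw [hp k (by omega), hq k (by omega)]

lemma M_mulVec (n : ℕ) (α β : ℂ) (v : Fin (n + 1) → ℂ) (i : Fin (n + 1)) :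
    (M n α β).mulVec v i = (L n α β (ofVec v)).coeff i := by
  simp only [Matrix.mulVec, dotProduct, M, Matrix.of_apply, ofVec, map_sum, map_smul,
    finsetSum_coeff, coeff_smul, smul_eq_mul]
  exact Finset.sum_congr rfl fun _ _ => mul_comm _ _

/-- Eigenvalue predicate. -/
def Eig (n : ℕ) (α β E : ℂ) : Prop := ∃ p : ℂ[X], p ≠ 0 ∧ L n α β p = C E * p

lemma eig_iff (n : ℕ) (α β E : ℂ) : Eig n α β E ↔ (M n α β).charpoly.eval E = 0 := by
  rw [Matrix.eval_charpoly, ← Matrix.exists_mulVec_eq_zero_iff]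
  constructor
  · rintro ⟨p, hp, h⟩
    have hd : p.natDegree = n := by
      have h1 := congrArg (fun q => q.coeff (p.natDegree + 1)) h
      simp only [coeff_L, coeff_C_mul] at h1
      rw [coeff_eq_zero_of_natDegree_lt (n := p.natDegree + 3) (by omega),
        coeff_eq_zero_of_natDegree_lt (n := p.natDegree + 2) (by omega),
        coeff_eq_zero_of_natDegree_lt (n := p.natDegree + 1) (by omega)] at h1
      have hl : p.coeff p.natDegree ≠ 0 := by simpa using hp
      have h2 : ((p.natDegree : ℂ) - n) * p.coeff p.natDegree = 0 := by
        linear_combination (-1/2) * h1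
      have h3 := (mul_eq_zero.1 h2).resolve_right hl
      exact_mod_cast sub_eq_zero.1 h3
    have hv : ofVec (fun i : Fin (n + 1) => p.coeff i) = p := by
      refine ext_le (n := n) (fun k hk => coeff_eq_zero_of_natDegree_lt
        ((ofVec_natDegree _).trans_lt hk)) (fun k hk => coeff_eq_zero_of_natDegree_lt
        (by omega)) fun i => ofVec_coeff _ i
    refine ⟨fun i => p.coeff i, ?_, ?_⟩
    · intro h0
      apply hp
      rw [← hv, h0]
      simp [ofVec]
    · ext i
      rw [Matrix.sub_mulVec, Pi.sub_apply, M_mulVec, hv, h]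
      simp [Matrix.scalar_apply, Matrix.mulVec_diagonal]
  · rintro ⟨v, hv, h⟩
    refine ⟨ofVec v, ?_, ?_⟩
    · intro h0
      apply hv
      ext i
      rw [← ofVec_coeff v i, h0]; simp
    · refine ext_le (n := n) (L_degree n α β _ (ofVec_natDegree v)) (fun k hk => ?_) fun i => ?_
      · rw [coeff_C_mul, coeff_eq_zero_of_natDegree_lt ((ofVec_natDegree _).trans_lt hk), mul_zero]
      · have h1 := congrFun h i
        rw [Matrix.sub_mulVec, Pi.sub_apply, M_mulVec] at h1
        rw [coeff_C_mul, ofVec_coeff]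
        simp only [Matrix.scalar_apply, Matrix.mulVec_diagonal, Pi.zero_apply] at h1
        linear_combination -h1

lemma eig_scale (n : ℕ) (α β E s : ℂ) (hs : s ≠ 0) (h : Eig n α β E) :
    Eig n (α * s⁻¹ ^ 3) (β * s⁻¹ ^ 2) (E * s⁻¹) := by
  obtain ⟨p, hp, h⟩ := h
  refine ⟨p.comp (C s * X), ?_, ?_⟩
  · intro h0
    rw [comp_C_mul_X_eq_zero_iff (mem_nonZeroDivisors_of_ne_zero hs)] at h0
    exact hp h0
  · apply Polynomial.funext
    intro w
    have h1 := congrArg (fun q => q.eval (s * w)) h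
    simp only [L_apply, eval_neg, eval_sub, eval_add, eval_mul, eval_C, eval_pow, eval_X,
      eval_ofNat, eval_natCast] at h1
    simp only [L_apply, derivative_comp, derivative_mul, derivative_C, derivative_X, zero_mul,
      zero_add, mul_one, derivative_comp, eval_neg, eval_sub, eval_add, eval_mul, eval_C, eval_pow,
      eval_X, eval_ofNat, eval_natCast, eval_comp]
    field_simp
    linear_combination h1

lemma eig_zero (n a : ℕ) (ha : a ≤ n) : Eig n 0 1 (2 * n - 4 * a) := by
  obtain ⟨c, rfl⟩ := Nat.exists_eq_add_of_le ha
  refine ⟨(X - C 1) ^ a * (X + C 1) ^ c, ?_, ?_⟩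
  · exact mul_ne_zero (pow_ne_zero _ (X_sub_C_ne_zero 1)) (pow_ne_zero _ (X_add_C_ne_zero 1))
  · have h1 : ∀ k : ℕ, ∀ q : ℂ[X], derivative q = 1 → q * derivative (q ^ k) = k * q ^ k := by
      intro k q hq
      cases k with
      | zero => simp
      | succ k => rw [derivative_pow, hq]; simp; ring
    have h2 := h1 a (X - C 1) (by simp)
    have h3 := h1 c (X + C 1) (by simp)
    rw [L_apply, derivative_mul]
    simp only [C_0, C_1, zero_mul, map_sub, map_mul, map_ofNat, map_natCast, Nat.cast_add, map_add] at h2 h3 ⊢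
    linear_combination (-2 * (X + 1) * (X + 1) ^ c) * h2 - (2 * (X - 1) * (X - 1) ^ a) * h3

lemma M_affine (n : ℕ) (α β : ℂ) (i j) : M n α β i j =
    (L n 0 0 (X ^ (j : ℕ))).coeff i - α * (derivative (derivative (X ^ (j : ℕ)))).coeff i
     + β * (2 * derivative (X ^ (j : ℕ) : ℂ[X])).coeff i := by
  simp only [M, Matrix.of_apply]
  rw [← coeff_C_mul, ← coeff_C_mul, ← coeff_sub, ← coeff_add]
  congr 1
  simp only [L_apply, C_0]
  ring

/-- polynomial matrix -/
noncomputable def MP (n : ℕ) : Matrix (Fin (n + 1)) (Fin (n + 1)) ℂ[X] :=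
  Matrix.of fun i j => C ((L n 0 0 (X ^ (j : ℕ))).coeff i
    - (derivative (derivative (X ^ (j : ℕ) : ℂ[X]))).coeff i)
     + X * C ((2 * derivative (X ^ (j : ℕ) : ℂ[X])).coeff i)

lemma sp_MP (n : ℕ) (b : ℂ) : sp (MP n).charpoly b = (M n 1 b).charpoly := by
  rw [sp, ← Matrix.charpoly_map]
  congr 1
  ext i j
  rw [M_affine]
  simp only [MP, Matrix.map_apply, Matrix.of_apply, coe_evalRingHom, eval_add, eval_mul, eval_C,
    eval_X, one_mul]

lemma mem_locus (n : ℕ) (b E : ℂ) : (b, E) ∈ locus (MP n).charpoly ↔ Eig n 1 b E := by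
  rw [eig_iff, ← sp_MP]; rfl

lemma cont_char (n : ℕ) (E : ℂ) : Continuous fun ε => (M n ε 1).charpoly.eval E := by
  simp only [Matrix.eval_charpoly]
  refine Continuous.matrix_det (continuous_const.sub (continuous_matrix fun i j => ?_))
  simp only [M_affine]
  fun_prop

lemma near_eig (n : ℕ) : ∀ᶠ ε in 𝓝 (0 : ℂ), ∀ a : Fin (n + 1),
    ∃ r, Eig n ε 1 r ∧ ‖(2 * n - 4 * (a : ℕ) : ℂ) - r‖ < 1 := by
  rw [eventually_all]
  intro a
  have h0 := (eig_iff _ _ _ _).1 (eig_zero n a (by omega))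
  have h1 := ((cont_char n (2 * n - 4 * (a : ℕ))).norm).tendsto 0
  simp only [h0, norm_zero] at h1
  filter_upwards [h1.eventually_lt_const one_pos] with ε hε
  obtain ⟨r, hr, hr2⟩ := near_root (M n ε 1).charpoly (Matrix.charpoly_monic _) _ 1 one_pos
    (by simpa using hε)
  exact ⟨r, (eig_iff _ _ _ _).2 hr, hr2⟩

lemma large_b (n : ℕ) : ∃ R : ℝ, ∀ b : ℂ, R < ‖b‖ → (sp (MP n).charpoly b).Separable ∧
    ∀ x y, (b, x) ∈ locus (MP n).charpoly → (b, y) ∈ locus (MP n).charpoly →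
      x ≠ y → √‖b‖ ≤ ‖x - y‖ := by
  classical
  obtain ⟨δ, hδ, hball⟩ := Metric.eventually_nhds_iff.1 (near_eig n)
  refine ⟨max 1 (δ⁻¹ ^ 2), fun b hb => ?_⟩
  obtain ⟨hb1, hb2⟩ := max_lt_iff.1 hb
  obtain ⟨s, hs⟩ := IsAlgClosed.exists_pow_nat_eq b (n := 2) two_pos
  have hsn : ‖s‖ ^ 2 = ‖b‖ := by rw [← norm_pow, hs]
  have hsq : √‖b‖ = ‖s‖ := by rw [← hsn, Real.sqrt_sq (norm_nonneg _)]
  have hs1 : 1 < ‖s‖ := by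
    by_contra! hh
    have := pow_le_one₀ (n := 2) (norm_nonneg s) hh
    linarith
  have hs0 : s ≠ 0 := by rintro rfl; simp at hs1; linarith
  have hs2 : δ⁻¹ < ‖s‖ := by
    rw [← hsn] at hb2
    exact lt_of_pow_lt_pow_left₀ 2 (norm_nonneg _) hb2
  have hε : dist (s⁻¹ ^ 3) 0 < δ := by
    rw [dist_zero_right, norm_pow, norm_inv]
    have h1 : ‖s‖⁻¹ < δ := inv_lt_of_inv_lt₀ hδ hs2
    have h2 : ‖s‖⁻¹ ^ 3 ≤ ‖s‖⁻¹ :=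
      pow_le_of_le_one (by positivity) (inv_le_one_of_one_le₀ hs1.le) (by norm_num)
    linarith
  choose r hr hr2 using hball hε
  have hsepr : ∀ a a', a ≠ a' → 1 ≤ ‖r a - r a'‖ := by
    intro a a' hne
    have h1 : (4 : ℝ) ≤ ‖(2 * n - 4 * (a : ℕ) : ℂ) - (2 * n - 4 * (a' : ℕ) : ℂ)‖ := by
      have : (2 * n - 4 * (a : ℕ) : ℂ) - (2 * n - 4 * (a' : ℕ) : ℂ) =
          ((4 * ((a' : ℕ) - (a : ℕ)) : ℤ) : ℂ) := by push_cast; ring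
      rw [this, Complex.norm_intCast]
      have h4 : (4 : ℤ) ≤ |4 * ((a' : ℕ) - (a : ℕ) : ℤ)| := by
        have : (a : ℕ) ≠ a' := fun h => hne (Fin.ext h)
        rw [le_abs]; omega
      exact_mod_cast h4
    have h2 := hr2 a
    have h3 := hr2 a'
    set p := (2 * n - 4 * (a : ℕ) : ℂ)
    set q := (2 * n - 4 * (a' : ℕ) : ℂ)
    have h5 : p - q = (p - r a) + (r a - r a') - (q - r a') := by ring
    have h6 := norm_sub_le ((p - r a) + (r a - r a')) (q - r a')
    have h7 := norm_add_le (p - r a) (r a - r a')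
    rw [← h5] at h6
    linarith
  have hrin : Function.Injective r := by
    intro a a' h
    by_contra hne
    have := hsepr a a' hne
    rw [h] at this
    simp at this
    linarith
  have hmem : ∀ a, (b, r a * s) ∈ locus (MP n).charpoly := by
    intro a
    rw [mem_locus]
    have := eig_scale n _ _ _ s⁻¹ (inv_ne_zero hs0) (hr a)
    rw [inv_inv, one_mul, hs] at this
    convert this using 1
    field_simp
  have hmon : (MP n).charpoly.Monic := Matrix.charpoly_monic _
  set q := sp (MP n).charpoly b with hq
  have hqm : q.Monic := hmon.map _
  have hdeg : q.natDegree = n + 1 := by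
    rw [hq, hmon.natDegree_map, Matrix.charpoly_natDegree_eq_dim, Fintype.card_fin]
  have hinj : Function.Injective (fun a => r a * s) := fun a a' h =>
    hrin (mul_right_cancel₀ hs0 h)
  have himsub : Finset.univ.image (fun a => r a * s) ⊆ q.roots.toFinset := by
    intro x hx
    obtain ⟨a, -, rfl⟩ := Finset.mem_image.1 hx
    exact (mem_rts _ hmon _ _).2 (hmem a)
  have hci : (Finset.univ.image (fun a => r a * s)).card = n + 1 := by
    rw [Finset.card_image_of_injective _ hinj, Finset.card_univ, Fintype.card_fin]
  have hcr : Multiset.card q.roots = n + 1 := by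
    rw [← (IsAlgClosed.splits q).natDegree_eq_card_roots, hdeg]
  have hle := Multiset.toFinset_card_le q.roots
  have hle2 := Finset.card_le_card himsub
  have heq : Finset.univ.image (fun a => r a * s) = q.roots.toFinset :=
    Finset.eq_of_subset_of_card_le himsub (by omega)
  refine ⟨?_, ?_⟩
  · rw [← nodup_roots_iff_of_splits hqm.ne_zero (IsAlgClosed.splits q),
      ← Multiset.toFinset_card_eq_card_iff_nodup]
    omega
  · intro x y hx hy hxy
    have hx' := (mem_rts _ hmon _ _).2 hx
    have hy' := (mem_rts _ hmon _ _).2 hy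
    rw [← hq, ← heq] at hx' hy'
    obtain ⟨a, -, rfl⟩ := Finset.mem_image.1 hx'
    obtain ⟨a', -, rfl⟩ := Finset.mem_image.1 hy'
    have hne : a ≠ a' := by rintro rfl; exact hxy rfl
    rw [hsq, ← sub_mul, norm_mul]
    exact le_mul_of_one_le_left (norm_nonneg _) (hsepr a a' hne)

lemma ode_iff (n : ℕ) (b lam : ℂ) (p : ℂ[X]) :
    SatisfiesQuarticODE ((n + 1 : ℕ) : ℂ) b lam (qesFun b p) ↔
      L n 1 b p = C (lam + b ^ 2) * p := by
  have hd : ∀ p : ℂ[X], deriv (qesFun b p) = qesFun b (derivative p + (X ^ 2 - C b) * p) := by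
    intro p
    ext z
    have h1 : HasDerivAt (fun z : ℂ => z ^ 3 / 3 - b * z) (z ^ 2 - b) z := by
      have h := ((hasDerivAt_pow 3 z).div_const 3).sub ((hasDerivAt_id z).const_mul b)
      have he : z ^ 2 - b = ((3 : ℕ) * z ^ (3 - 1) / 3 - b * 1 : ℂ) := by norm_num
      rw [he]
      exact h
    have h2 := (p.hasDerivAt z).mul h1.cexp
    unfold qesFun
    refine h2.deriv.trans ?_
    simp only [eval_add, eval_mul, eval_sub, eval_pow, eval_X, eval_C]
    ring
  unfold SatisfiesQuarticODE
  rw [hd, hd]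
  constructor
  · intro h
    apply Polynomial.funext
    intro z
    have h1 := h z
    simp only [qesFun] at h1
    have h2 := Complex.exp_ne_zero (z ^ 3 / 3 - b * z)
    apply mul_right_cancel₀ h2
    simp only [L_apply, derivative_add, derivative_mul, derivative_sub, derivative_C,
      derivative_X_pow, eval_neg, eval_sub, eval_add, eval_mul, eval_C, eval_pow,
      eval_X, eval_ofNat, eval_natCast, map_one, eval_one, eval_zero] at h1 ⊢
    push_cast at h1 ⊢
    linear_combination h1
  · intro h z
    have h1 := congrArg (fun q => q.eval z) h
    simp only [qesFun]
    simp only [L_apply, derivative_add, derivative_mul, derivative_sub, derivative_C,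
      derivative_X_pow, eval_neg, eval_sub, eval_add, eval_mul, eval_C, eval_pow,
      eval_X, eval_ofNat, eval_natCast, map_one, eval_one, eval_zero] at h1 ⊢
    push_cast at h1 ⊢
    linear_combination (Complex.exp (z ^ 3 / 3 - b * z)) * h1

lemma mem_qes (n : ℕ) (b lam : ℂ) : (b, lam) ∈ qesSpectralLocus ((n + 1 : ℕ) : ℂ) ↔
    (b, lam + b ^ 2) ∈ locus (MP n).charpoly := by
  rw [mem_locus]
  simp only [qesSpectralLocus, Set.mem_ofPred_eq, ode_iff]
  rfl

end QES

theorem qes_spectral_locus_nonempty_closed_connected (J : ℕ) (hJ : 0 < J) :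
    (qesSpectralLocus (J : ℂ)).Nonempty ∧
    IsClosed (qesSpectralLocus (J : ℂ)) ∧
    IsConnected (qesSpectralLocus (J : ℂ)) := by
  obtain ⟨n, rfl⟩ : ∃ n, J = n + 1 := ⟨J - 1, by omega⟩
  have hmon : (QES.MP n).charpoly.Monic := Matrix.charpoly_monic _
  have himg : qesSpectralLocus ((n + 1 : ℕ) : ℂ) =
      (fun v : ℂ × ℂ => (v.1, v.2 - v.1 ^ 2)) '' QES.locus (QES.MP n).charpoly := by
    ext ⟨b, lam⟩
    rw [QES.mem_qes]
    constructor
    · intro h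
      exact ⟨_, h, by simp⟩
    · rintro ⟨⟨b', x⟩, h, h2⟩
      simp only [Prod.mk.injEq] at h2
      obtain ⟨rfl, rfl⟩ := h2
      simpa using h
  have hne : (QES.locus (QES.MP n).charpoly).Nonempty := by
    obtain ⟨x, hx⟩ := IsAlgClosed.exists_root (QES.sp (QES.MP n).charpoly 0) (by
      rw [degree_eq_natDegree (hmon.map _).ne_zero, hmon.natDegree_map,
        Matrix.charpoly_natDegree_eq_dim, Fintype.card_fin]
      exact_mod_cast Nat.succ_ne_zero n)
    exact ⟨(0, x), hx⟩
  have hne' : (qesSpectralLocus ((n + 1 : ℕ) : ℂ)).Nonempty := by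
    rw [himg]; exact hne.image _
  refine ⟨hne', ?_, hne', ?_⟩
  · have : qesSpectralLocus ((n + 1 : ℕ) : ℂ) =
        (fun v : ℂ × ℂ => (v.1, v.2 + v.1 ^ 2)) ⁻¹' QES.locus (QES.MP n).charpoly := by
      ext ⟨b, lam⟩
      exact QES.mem_qes n b lam
    rw [this]
    exact (QES.isClosed_locus _).preimage (by fun_prop)
  · rw [himg]
    obtain ⟨R, hR⟩ := QES.large_b n
    exact (QES.abstract_preconnected _ hmon R hR).image _ (by fun_prop)
end

section
/- For every integer n ≥ 0 and every real a ≥ 0, if (a,λ) ∈ Γ_n and (a,μ) ∈ Γ_{n+1}, then μ > λ. -/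
open Complex Filter

/-- `y` is an eigenfunction of the PT-symmetric cubic oscillator with
parameter `a` and eigenvalue `λ`. -/
def IsCubicEigenfunction (a lam : ℂ) (y : ℂ → ℂ) : Prop :=
  Differentiable ℂ y ∧ y ≠ 0 ∧
  (∀ z : ℂ, -(deriv (deriv y) z) + (z ^ 3 - a * z) * y z = -lam * y z) ∧
  Tendsto (fun t : ℝ => y (Complex.I * t)) atTop (nhds 0) ∧
  Tendsto (fun t : ℝ => y (Complex.I * t)) atBot (nhds 0)

/-- The real spectral locus of the PT-symmetric cubic oscillator. -/
def cubicRealLocus : Set (ℝ × ℝ) :=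
  {q : ℝ × ℝ | ∃ y : ℂ → ℂ, IsCubicEigenfunction (q.1 : ℂ) (q.2 : ℂ) y}

/-- The set of nonreal zeros of `y`. -/
def nonrealZeros (y : ℂ → ℂ) : Set ℂ := {z : ℂ | y z = 0 ∧ z.im ≠ 0}

/-- `Γ_n`: the points of the real spectral locus admitting an eigenfunction
with exactly `2n` nonreal zeros. -/
def cubicGamma (n : ℕ) : Set (ℝ × ℝ) :=
  {q : ℝ × ℝ | ∃ y : ℂ → ℂ, IsCubicEigenfunction (q.1 : ℂ) (q.2 : ℂ) y ∧
    (nonrealZeros y).Finite ∧ (nonrealZeros y).ncard = 2 * n}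


/-- Nontrivial entire solutions of the cubic equation with real parameters. -/
structure CubSol (a l : ℝ) (y : ℂ → ℂ) : Prop where
  diff : Differentiable ℂ y
  ode : ∀ z : ℂ, deriv (deriv y) z = (z ^ 3 - a * z + l) * y z

namespace CubSol
variable {a l : ℝ} {y : ℂ → ℂ}

theorem diff' (h : CubSol a l y) : Differentiable ℂ (deriv y) := h.diff.deriv

theorem hd (h : CubSol a l y) (z : ℂ) : HasDerivAt y (deriv y z) z := (h.diff z).hasDerivAt

theorem hd' (h : CubSol a l y) (z : ℂ) :
    HasDerivAt (deriv y) ((z ^ 3 - a * z + l) * y z) z := by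
  have := (h.diff' z).hasDerivAt
  rwa [h.ode] at this

/-- Uniqueness: zero Cauchy data give the zero solution. -/
theorem eq_zero (h : CubSol a l y) {z₀ : ℂ} (h0 : y z₀ = 0) (h1 : deriv y z₀ = 0) : y = 0 := by
  funext z
  set d := z - z₀ with hd
  let c : ℝ → ℂ := fun t => z₀ + t * d
  have hc : ∀ t, HasDerivAt c d t := by
    intro t
    have : HasDerivAt (fun t : ℝ => (t : ℂ)) 1 t := Complex.ofRealCLM.hasDerivAt
    have h2 := (this.mul_const d).const_add z₀
    rw [one_mul] at h2
    exact h2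
  have hcc : Continuous c := by fun_prop
  let q : ℝ → ℂ := fun t => (c t) ^ 3 - a * c t + l
  have hq : Continuous q := by fun_prop
  obtain ⟨C, hC⟩ := (isCompact_Icc (a := (0:ℝ)) (b := 1)).exists_bound_of_continuousOn hq.continuousOn
  let f : ℝ → ℂ × ℂ := fun t => (y (c t), deriv y (c t))
  have hf : ∀ t, HasDerivAt f (deriv y (c t) * d, q t * y (c t) * d) t := by
    intro t
    exact ((h.hd (c t)).comp t (hc t)).prodMk ((h.hd' (c t)).comp t (hc t))
  have key := eq_zero_of_abs_deriv_le_mul_abs_self_of_eq_zero_right (f := f)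
    (f' := fun t => (deriv y (c t) * d, q t * y (c t) * d)) (K := (1 + C) * ‖d‖) (a := 0) (b := 1)
    (fun t _ => (hf t).continuousAt.continuousWithinAt)
    (fun t _ => (hf t).hasDerivWithinAt) (by simp [f, c, h0, h1])
    (by
      intro t ht
      have hCt := hC t ⟨ht.1, ht.2.le⟩
      have hC0 : 0 ≤ C := le_trans (norm_nonneg _) hCt
      have e1 : ‖y (c t)‖ ≤ ‖f t‖ := norm_fst_le (f t)
      have e2 : ‖deriv y (c t)‖ ≤ ‖f t‖ := norm_snd_le (f t)
      have hn := norm_nonneg (f t)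
      have hdn := norm_nonneg d
      apply norm_prod_le_iff.mpr
      constructor
      · simp only [norm_mul]
        calc ‖deriv y (c t)‖ * ‖d‖ ≤ ‖f t‖ * ‖d‖ := by gcongr
          _ ≤ (1 + C) * ‖d‖ * ‖f t‖ := by nlinarith [mul_nonneg hn hdn, mul_nonneg hC0 (mul_nonneg hn hdn)]
      · simp only [norm_mul]
        calc ‖q t‖ * ‖y (c t)‖ * ‖d‖ ≤ C * ‖f t‖ * ‖d‖ := by gcongr
          _ ≤ (1 + C) * ‖d‖ * ‖f t‖ := by nlinarith [mul_nonneg hn hdn, mul_nonneg hC0 (mul_nonneg hn hdn)])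
    1 (by simp)
  have : y (c 1) = 0 := congrArg Prod.fst key
  simpa [c, hd] using this

theorem simple (h : CubSol a l y) (hy : y ≠ 0) {z : ℂ} (h0 : y z = 0) : deriv y z ≠ 0 :=
  fun h1 => hy (h.eq_zero h0 h1)

theorem smul (h : CubSol a l y) (c : ℂ) : CubSol a l (fun z => c * y z) := by
  have e : deriv (fun z => c * y z) = fun z => c * deriv y z := by
    funext z; exact deriv_const_mul _ (h.diff z)
  refine ⟨h.diff.const_mul c, fun z => ?_⟩
  rw [e, deriv_const_mul _ (h.diff' z), h.ode]; ring

theorem sub {y' : ℂ → ℂ} (h : CubSol a l y) (h' : CubSol a l y') :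
    CubSol a l (fun z => y z - y' z) := by
  have e : deriv (fun z => y z - y' z) = fun z => deriv y z - deriv y' z := by
    funext z; exact deriv_fun_sub (h.diff z) (h'.diff z)
  refine ⟨h.diff.sub h'.diff, fun z => ?_⟩
  rw [e, deriv_fun_sub (h.diff' z) (h'.diff' z), h.ode, h'.ode]; ring

/-- Zero Wronskian at one point implies proportionality. -/
theorem proportional {y' : ℂ → ℂ} (h : CubSol a l y) (h' : CubSol a l y') (hy : y ≠ 0)
    {z₀ : ℂ} (hW : y z₀ * deriv y' z₀ - deriv y z₀ * y' z₀ = 0) : ∃ c : ℂ, ∀ z, y' z = c * y z := by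
  have main : ∀ c, y' z₀ = c * y z₀ → deriv y' z₀ = c * deriv y z₀ → ∀ z, y' z = c * y z := by
    intro c e1 e2 z
    have hs := h'.sub (h.smul c)
    have := hs.eq_zero (z₀ := z₀) (by simp [e1]) (by
      rw [deriv_fun_sub (h'.diff _) ((h.smul c).diff _), deriv_const_mul _ (h.diff _), e2]; ring)
    have := congrFun this z
    simpa [sub_eq_zero] using this
  by_cases h0 : y z₀ = 0
  · have h1 := h.simple hy h0
    refine ⟨deriv y' z₀ / deriv y z₀, main _ ?_ ?_⟩
    · rw [h0] at hW ⊢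
      have : deriv y z₀ * y' z₀ = 0 := by linear_combination -hW
      simpa [h1] using this
    · field_simp
  · refine ⟨y' z₀ / y z₀, main _ ?_ ?_⟩
    · field_simp
    · field_simp; linear_combination hW

/-- The Wronskian of two solutions is constant. -/
theorem wronskian_const {y' : ℂ → ℂ} (h : CubSol a l y) (h' : CubSol a l y') (z z' : ℂ) :
    y z * deriv y' z - deriv y z * y' z = y z' * deriv y' z' - deriv y z' * y' z' := by
  have hdiff : ∀ z, HasDerivAt (fun z => y z * deriv y' z - deriv y z * y' z) 0 z := by
    intro z
    exact (((h.hd z).fun_mul (h'.hd' z)).fun_sub ((h.hd' z).fun_mul (h'.hd z))).congr_deriv (by ring)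
  exact is_const_of_deriv_eq_zero (fun z => (hdiff z).differentiableAt) (fun z => (hdiff z).deriv) z z'

theorem conj (h : CubSol a l y) : CubSol a l (fun z => (starRingEnd ℂ) (y ((starRingEnd ℂ) z))) := by
  have e : ∀ f : ℂ → ℂ, deriv (fun z => (starRingEnd ℂ) (f ((starRingEnd ℂ) z))) =
      fun z => (starRingEnd ℂ) (deriv f ((starRingEnd ℂ) z)) := fun f => deriv_conj_conj (f := f)
  refine ⟨fun z => ?_, fun z => ?_⟩
  · exact differentiableAt_conj_conj_iff.mpr (h.diff _)
  · rw [e, e]; simp only [h.ode]; simp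

end CubSol


/-- The square root on the closed upper half-plane, analytic off the negative imaginary axis. -/
noncomputable def csq (z : ℂ) : ℂ := exp (I * (Real.pi / 4 : ℝ)) * exp (log (-I * z) / 2)

theorem csq_sq {z : ℂ} (hz : z ≠ 0) : csq z ^ 2 = z := by
  unfold csq
  rw [mul_pow, ← exp_nat_mul, ← exp_nat_mul]
  have e1 : ((2 : ℕ) : ℂ) * (I * ((Real.pi / 4 : ℝ) : ℂ)) = Real.pi / 2 * I := by push_cast; ring
  have e2 : ((2 : ℕ) : ℂ) * (log (-I * z) / 2) = log (-I * z) := by push_cast; ring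
  rw [e1, e2, exp_pi_div_two_mul_I, exp_log (by simp [hz])]
  linear_combination (-z) * I_mul_I

theorem csq_ne {z : ℂ} : csq z ≠ 0 := mul_ne_zero (exp_ne_zero _) (exp_ne_zero _)

theorem csq_slit {z : ℂ} (him : 0 ≤ z.im) (hz : z ≠ 0) : -I * z ∈ slitPlane := by
  rw [mem_slitPlane_iff]
  simp only [neg_mul, neg_re, mul_re, I_re, zero_mul, I_im, one_mul, zero_sub, neg_neg, neg_im,
    mul_im, zero_add]
  by_cases h : z.re = 0
  · left
    refine lt_of_le_of_ne him (fun h' => hz (Complex.ext h h'.symm))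
  · right; simpa using h

theorem csq_hasDerivAt {z : ℂ} (him : 0 ≤ z.im) (hz : z ≠ 0) :
    HasDerivAt csq (1 / (2 * csq z)) z := by
  have h1 : HasDerivAt (fun z : ℂ => -I * z) (-I) z := by
    simpa using (hasDerivAt_id z).const_mul (-I)
  have h2 := (((h1.clog (csq_slit him hz)).div_const 2).cexp).const_mul (exp (I * (Real.pi / 4 : ℝ)))
  refine h2.congr_deriv ?_
  have : csq z * csq z = z := by rw [← sq]; exact csq_sq hz
  have h3 := csq_ne (z := z)
  have e : exp (I * (Real.pi / 4 : ℝ)) * (exp (log (-I * z) / 2) * (-I / (-I * z) / 2))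
    = csq z * (1 / z / 2) := by
    unfold csq; field_simp
  rw [e]
  field_simp
  rw [sq, this]

theorem csq_norm {z : ℂ} (hz : z ≠ 0) : ‖csq z‖ ^ 2 = ‖z‖ := by
  rw [← norm_pow, csq_sq hz]

theorem csq_polar (z : ℂ) :
    ∃ ρ : ℝ, 0 < ρ ∧ csq z = ρ * exp (((Real.pi / 4 + (arg (-I * z)) / 2 : ℝ) : ℂ) * I) := by
  refine ⟨Real.exp (Real.log ‖-I * z‖ / 2), Real.exp_pos _, ?_⟩
  unfold csq
  rw [Complex.ofReal_exp, ← exp_add, ← exp_add]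
  congr 1
  conv_lhs => rw [Complex.log]
  push_cast
  ring

theorem csq_re_im {z : ℂ} (him : 0 ≤ z.im) (hz : z ≠ 0) : 0 ≤ (csq z).re ∧ 0 ≤ (csq z).im := by
  obtain ⟨ρ, hρ, h⟩ := csq_polar z
  have harg : |arg (-I * z)| ≤ Real.pi / 2 := by
    rw [abs_arg_le_pi_div_two_iff]
    simpa using him
  rw [abs_le] at harg
  rw [h]
  constructor
  · have := Real.cos_nonneg_of_neg_pi_div_two_le_of_le
      (x := Real.pi / 4 + (arg (-I * z)) / 2) (by linarith [Real.pi_pos]) (by linarith)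
    simp only [mul_re, ofReal_re, ofReal_im, zero_mul, sub_zero, exp_ofReal_mul_I_re]
    exact mul_nonneg hρ.le this
  · have := Real.sin_nonneg_of_nonneg_of_le_pi
      (x := Real.pi / 4 + (arg (-I * z)) / 2) (by linarith) (by linarith [Real.pi_pos])
    simp only [mul_im, ofReal_re, ofReal_im, zero_mul, add_zero, exp_ofReal_mul_I_im]
    exact mul_nonneg hρ.le this

/-- WKB leading term. -/
noncomputable def cB (a : ℝ) (z : ℂ) : ℂ := csq z ^ 3 - a / (2 * csq z)

/-- WKB correction. -/
noncomputable def cr (z : ℂ) : ℂ := 3 / (4 * z)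

noncomputable def cY (y : ℂ → ℂ) (z : ℂ) : ℂ := deriv y z + cr z * y z

noncomputable def cZ (a : ℝ) (y : ℂ → ℂ) (z : ℂ) : ℂ := cB a z * y z

noncomputable def cE (a : ℝ) (y : ℂ → ℂ) (z : ℂ) : ℝ := (cZ a y z * (starRingEnd ℂ) (cY y z)).re

noncomputable def cS (a : ℝ) (y : ℂ → ℂ) (z : ℂ) : ℝ := ‖cY y z‖ ^ 2 + ‖cZ a y z‖ ^ 2

noncomputable def cB' (a : ℝ) (z : ℂ) : ℂ := 3 / 2 * csq z + a / (4 * csq z ^ 3)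

theorem cB_hasDerivAt (a : ℝ) {z : ℂ} (him : 0 ≤ z.im) (hz : z ≠ 0) :
    HasDerivAt (cB a) (cB' a z) z := by
  have h := csq_hasDerivAt him hz
  have hne := csq_ne (z := z)
  have h1 := (h.fun_pow 3).fun_sub (((h.const_mul 2).fun_inv (by simp [hne])).const_mul (a : ℂ))
  have e : cB a = fun z => csq z ^ 3 - a * (2 * csq z)⁻¹ := by
    funext z; simp [cB, div_eq_mul_inv]
  rw [e]
  refine h1.congr_deriv ?_
  unfold cB'
  push_cast
  field_simp
  ring

theorem cr_hasDerivAt {z : ℂ} (hz : z ≠ 0) : HasDerivAt cr (-3 / (4 * z ^ 2)) z := by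
  have h1 := ((hasDerivAt_inv hz).const_mul (3 / 4 : ℂ))
  have e : cr = fun z => (3 / 4 : ℂ) * z⁻¹ := by
    funext z
    unfold cr
    rw [div_mul_eq_div_div, div_eq_mul_inv (3 / 4 : ℂ)]
  rw [e]
  refine h1.congr_deriv ?_
  field_simp

theorem cB_norm_lower {a : ℝ} {z : ℂ} (hz : 1 + |a| ≤ ‖csq z‖) :
    ‖csq z‖ ^ 3 / 2 ≤ ‖cB a z‖ ∧ ‖csq z‖ / 2 ≤ ‖cB a z‖ := by
  set w := csq z
  have ha := abs_nonneg a
  have hw1 : 1 ≤ ‖w‖ := by linarith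
  have h1 : ‖(a : ℂ) / (2 * w)‖ ≤ |a| / 2 := by
    rw [norm_div, norm_mul, Complex.norm_real, Real.norm_eq_abs]
    simp only [Complex.norm_ofNat]
    apply div_le_div_of_nonneg_left ha (by norm_num) (by linarith)
  have h2 : ‖w‖ ^ 3 - |a| / 2 ≤ ‖cB a z‖ := by
    unfold cB
    have := norm_sub_norm_le (w ^ 3) ((a : ℂ) / (2 * w))
    rw [norm_pow] at this
    linarith
  have h3 : ‖w‖ ≤ ‖w‖ ^ 3 := by nlinarith [sq_nonneg (‖w‖ - 1)]
  constructor <;> linarith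


noncomputable def cC (a l : ℝ) : ℝ := |a| + 5 + 2 * (|l| + a ^ 2 + 2)

theorem cC_pos (a l : ℝ) : 1 ≤ cC a l := by
  unfold cC
  nlinarith [abs_nonneg a, abs_nonneg l, sq_nonneg a]

theorem cub_alg (a l z w y y1 : ℂ) (hw : w ≠ 0) (hz : w ^ 2 = z) (hB : w ^ 3 - a / (2 * w) ≠ 0) :
    ((3 / 2 * w + a / (4 * w ^ 3)) * y + (w ^ 3 - a / (2 * w)) * y1
      = (w ^ 3 - a / (2 * w)) * (y1 + 3 / (4 * z) * y)
        + ((3 / 4 * w + 5 * a / (8 * w ^ 3)) / (w ^ 3 - a / (2 * w))) * ((w ^ 3 - a / (2 * w)) * y)) ∧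
    ((z ^ 3 - a * z + l) * y + ((-3 / (4 * z ^ 2)) * y + 3 / (4 * z) * y1)
      = (w ^ 3 - a / (2 * w)) * ((w ^ 3 - a / (2 * w)) * y)
        + ((l - a ^ 2 / (4 * z) - 21 / (16 * z ^ 2)) / (w ^ 3 - a / (2 * w))) * ((w ^ 3 - a / (2 * w)) * y)
        + 3 / (4 * z) * (y1 + 3 / (4 * z) * y)) := by
  subst hz
  constructor
  · rw [← mul_assoc, div_mul_cancel₀ _ hB]
    field_simp
    ring
  · rw [← mul_assoc ((l - a ^ 2 / (4 * w ^ 2) - 21 / (16 * (w ^ 2) ^ 2)) / _), div_mul_cancel₀ _ hB]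
    field_simp
    ring

theorem cub_re_bound (e A s β γ r Y Z : ℂ) (c1 c2 c3 c4 : ℝ) (hs : ‖s‖ ≤ c1)
    (hβ : ‖β‖ ≤ c2) (hr : ‖r‖ ≤ c3) (hγ : ‖γ‖ ≤ c4) :
    |((((A - s) * Y + β * Z) * e) * (starRingEnd ℂ) Y
      + Z * (starRingEnd ℂ) (((A - s) * Z + γ * Z + r * Y) * e)).re
      - (e * A).re * (‖Y‖ ^ 2 + ‖Z‖ ^ 2)| ≤ (c1 + c2 + c3 + c4) * ‖e‖ * (‖Y‖ ^ 2 + ‖Z‖ ^ 2) := by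
  have hYY : Y * (starRingEnd ℂ) Y = ((‖Y‖ ^ 2 : ℝ) : ℂ) := by
    rw [mul_conj, normSq_eq_norm_sq]
  have hZZ : Z * (starRingEnd ℂ) Z = ((‖Z‖ ^ 2 : ℝ) : ℂ) := by
    rw [mul_conj, normSq_eq_norm_sq]
  have hid : ((((A - s) * Y + β * Z) * e) * (starRingEnd ℂ) Y
      + Z * (starRingEnd ℂ) (((A - s) * Z + γ * Z + r * Y) * e)).re
      - (e * A).re * (‖Y‖ ^ 2 + ‖Z‖ ^ 2)
      = (-(e * s * ((‖Y‖ ^ 2 : ℝ) : ℂ)) + β * Z * e * (starRingEnd ℂ) Y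
        + (starRingEnd ℂ) ((γ - s) * e) * ((‖Z‖ ^ 2 : ℝ) : ℂ)
        + Z * (starRingEnd ℂ) (r * Y * e)).re := by
    have h1 : (e * A).re * (‖Y‖ ^ 2 + ‖Z‖ ^ 2) =
        (e * A * ((‖Y‖ ^ 2 : ℝ) : ℂ) + (starRingEnd ℂ) (e * A) * ((‖Z‖ ^ 2 : ℝ) : ℂ)).re := by
      rw [add_re, re_mul_ofReal, re_mul_ofReal, conj_re]; ring
    rw [h1, ← sub_re, ← hYY, ← hZZ]
    congr 1
    simp only [map_add, map_mul, map_sub]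
    ring
  rw [hid]
  refine (abs_re_le_norm _).trans ?_
  have n1 : ‖-(e * s * ((‖Y‖ ^ 2 : ℝ) : ℂ))‖ ≤ ‖e‖ * c1 * ‖Y‖ ^ 2 := by
    rw [norm_neg, norm_mul, norm_mul, Complex.norm_real, Real.norm_of_nonneg (by positivity)]
    gcongr
  have n2 : ‖β * Z * e * (starRingEnd ℂ) Y‖ ≤ ‖e‖ * c2 * (‖Y‖ ^ 2 + ‖Z‖ ^ 2) := by
    rw [norm_mul, norm_mul, norm_mul, norm_conj]
    have h0 : ‖Z‖ * ‖Y‖ ≤ ‖Y‖ ^ 2 + ‖Z‖ ^ 2 := by nlinarith [sq_nonneg (‖Y‖ - ‖Z‖), sq_nonneg (‖Y‖ + ‖Z‖)]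
    calc ‖β‖ * ‖Z‖ * ‖e‖ * ‖Y‖ = ‖e‖ * ‖β‖ * (‖Z‖ * ‖Y‖) := by ring
      _ ≤ ‖e‖ * c2 * (‖Y‖ ^ 2 + ‖Z‖ ^ 2) := by
        have : 0 ≤ c2 := (norm_nonneg _).trans hβ
        gcongr
  have n3 : ‖(starRingEnd ℂ) ((γ - s) * e) * ((‖Z‖ ^ 2 : ℝ) : ℂ)‖ ≤ ‖e‖ * (c4 + c1) * ‖Z‖ ^ 2 := by
    rw [norm_mul, norm_conj, norm_mul, Complex.norm_real, Real.norm_of_nonneg (by positivity)]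
    have : ‖γ - s‖ ≤ c4 + c1 := (norm_sub_le _ _).trans (add_le_add hγ hs)
    rw [mul_comm ‖γ - s‖]
    gcongr
  have n4 : ‖Z * (starRingEnd ℂ) (r * Y * e)‖ ≤ ‖e‖ * c3 * (‖Y‖ ^ 2 + ‖Z‖ ^ 2) := by
    rw [norm_mul, norm_conj, norm_mul, norm_mul]
    have h0 : ‖Z‖ * ‖Y‖ ≤ ‖Y‖ ^ 2 + ‖Z‖ ^ 2 := by nlinarith [sq_nonneg (‖Y‖ - ‖Z‖), sq_nonneg (‖Y‖ + ‖Z‖)]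
    calc ‖Z‖ * (‖r‖ * ‖Y‖ * ‖e‖) = ‖e‖ * ‖r‖ * (‖Z‖ * ‖Y‖) := by ring
      _ ≤ ‖e‖ * c3 * (‖Y‖ ^ 2 + ‖Z‖ ^ 2) := by
        have : 0 ≤ c3 := (norm_nonneg _).trans hr
        gcongr
  have hc4 : 0 ≤ c4 := (norm_nonneg _).trans hγ
  have hx : 0 ≤ ‖e‖ * c4 * ‖Y‖ ^ 2 := by positivity
  calc _ ≤ _ := norm_add₄_le
    _ ≤ ‖e‖ * c1 * ‖Y‖ ^ 2 + ‖e‖ * c2 * (‖Y‖ ^ 2 + ‖Z‖ ^ 2) + ‖e‖ * (c4 + c1) * ‖Z‖ ^ 2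
        + ‖e‖ * c3 * (‖Y‖ ^ 2 + ‖Z‖ ^ 2) := by gcongr
    _ ≤ _ := by linarith [hx]

theorem norm_div_le_of {x y : ℂ} {c d : ℝ} (hd : 0 < d) (hx : ‖x‖ ≤ c) (hy : d ≤ ‖y‖) :
    ‖x / y‖ ≤ c / d := by
  rw [norm_div]
  exact div_le_div₀ ((norm_nonneg _).trans hx) hx hd hy

/-- Basic size facts for `‖w‖ ≥ 1 + |a|`. -/
theorem cE_hasDerivAt {a l : ℝ} {y : ℂ → ℂ} (h : CubSol a l y) {z : ℝ → ℂ} {e : ℂ} {s : ℝ}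
    (hz : HasDerivAt z e s) (him : 0 ≤ (z s).im) (hbig : 1 + |a| ≤ ‖csq (z s)‖) (h0 : z s ≠ 0) :
    ∃ D, HasDerivAt (fun s => cE a y (z s)) D s ∧
      |D - (e * csq (z s) ^ 3).re * cS a y (z s)| ≤ cC a l * ‖e‖ * cS a y (z s) := by
  set w := csq (z s) with hw
  have hw0 : w ≠ 0 := csq_ne
  have hww : w ^ 2 = z s := csq_sq h0
  have ha := abs_nonneg a
  have hw1 : 1 ≤ ‖w‖ := by linarith
  obtain ⟨hB3, hB1⟩ := cB_norm_lower (a := a) (z := z s) hbig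
  rw [← hw] at hB3 hB1
  have hBne : cB a (z s) ≠ 0 := by
    rw [← norm_pos_iff]; linarith
  have hB12 : 1 / 2 ≤ ‖cB a (z s)‖ := by linarith
  have hz1 : 1 ≤ ‖z s‖ := by rw [← hww, norm_pow]; nlinarith
  obtain ⟨alg1, alg2⟩ := cub_alg a l (z s) w (y (z s)) (deriv y (z s)) hw0 hww hBne
  have hBd := (cB_hasDerivAt a him h0)
  have hZd : HasDerivAt (fun s => cZ a y (z s))
      ((cB' a (z s) * y (z s) + cB a (z s) * deriv y (z s)) * e) s :=
    (hBd.fun_mul (h.hd (z s))).comp s hz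
  have hYd : HasDerivAt (fun s => cY y (z s))
      ((((z s) ^ 3 - a * z s + l) * y (z s) +
        ((-3 / (4 * (z s) ^ 2)) * y (z s) + cr (z s) * deriv y (z s))) * e) s :=
    ((h.hd' (z s)).fun_add ((cr_hasDerivAt h0).fun_mul (h.hd (z s)))).comp s hz
  have hYc : HasDerivAt (fun s => (starRingEnd ℂ) (cY y (z s))) _ s := hYd.star
  have hE := (reCLM.hasFDerivAt (x := cZ a y (z s) * (starRingEnd ℂ) (cY y (z s)))).comp_hasDerivAt s
    (hZd.fun_mul hYc)
  refine ⟨_, hE, ?_⟩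
  have hr : ‖cr (z s)‖ ≤ 1 := by
    unfold cr
    have := norm_div_le_of (x := 3) (y := 4 * z s) (c := 3) (d := 4) (by norm_num) (by simp)
      (by rw [norm_mul]; simp; linarith)
    linarith
  have hs : ‖(a : ℂ) / (2 * w)‖ ≤ |a| := by
    have := norm_div_le_of (x := a) (y := 2 * w) (c := |a|) (d := 1) (by norm_num) (by simp)
      (by rw [norm_mul]; simp; linarith)
    simpa using this
  have hβ : ‖(3 / 4 * w + 5 * a / (8 * w ^ 3)) / cB a (z s)‖ ≤ 4 := by
    have h5 : ‖5 * (a : ℂ) / (8 * w ^ 3)‖ ≤ |a| := by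
      have := norm_div_le_of (x := 5 * a) (y := 8 * w ^ 3) (c := 5 * |a|) (d := 8) (by norm_num)
        (by simp) (by rw [norm_mul, norm_pow]; simp; nlinarith [one_le_pow₀ (n := 3) hw1])
      linarith
    have h6 : ‖3 / 4 * w + 5 * a / (8 * w ^ 3)‖ ≤ 2 * ‖w‖ := by
      refine (norm_add_le _ _).trans ?_
      rw [norm_mul]
      have : ‖(3 / 4 : ℂ)‖ = 3 / 4 := by simp
      rw [this]; linarith
    have := norm_div_le_of (d := ‖w‖ / 2) (by linarith) h6 hB1
    have e4 : 2 * ‖w‖ / (‖w‖ / 2) = 4 := by field_simp; norm_num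
    linarith
  have hγ : ‖((l : ℂ) - a ^ 2 / (4 * z s) - 21 / (16 * (z s) ^ 2)) / cB a (z s)‖ ≤ 2 * (|l| + a ^ 2 + 2) := by
    have h5 : ‖(a : ℂ) ^ 2 / (4 * z s)‖ ≤ a ^ 2 := by
      have := norm_div_le_of (x := (a : ℂ) ^ 2) (y := 4 * z s) (c := a ^ 2) (d := 1) (by norm_num)
        (by simp) (by rw [norm_mul]; simp; linarith)
      simpa using this
    have h6 : ‖21 / (16 * (z s) ^ 2)‖ ≤ 2 := by
      have := norm_div_le_of (x := 21) (y := 16 * (z s) ^ 2) (c := 21) (d := 16) (by norm_num)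
        (by simp) (by rw [norm_mul, norm_pow]; simp; nlinarith)
      linarith
    have h7 : ‖(l : ℂ) - a ^ 2 / (4 * z s) - 21 / (16 * (z s) ^ 2)‖ ≤ |l| + a ^ 2 + 2 := by
      refine (norm_sub_le _ _).trans (add_le_add ((norm_sub_le _ _).trans (add_le_add ?_ h5)) h6)
      simp
    have := norm_div_le_of (d := 1 / 2) (by norm_num) h7 hB12
    linarith
  have key := cub_re_bound e (w ^ 3) _ _ _ _ (cY y (z s)) (cZ a y (z s)) _ _ _ _ hs hβ hr hγ
  have hC : cC a l = |a| + 4 + 1 + 2 * (|l| + a ^ 2 + 2) := by unfold cC; ring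
  rw [hC]
  unfold cS
  convert key using 3
  simp only [reCLM_apply]
  congr 3
  · congr 1
  · rw [starRingEnd_apply]
    congr 2


theorem mvt_le {f : ℝ → ℝ} {p q c : ℝ} (hpq : p ≤ q)
    (h : ∀ t ∈ Set.Icc p q, ∃ D, HasDerivAt f D t ∧ D ≤ c) : f q - f p ≤ c * (q - p) := by
  have hc : ContinuousOn f (Set.Icc p q) := fun t ht => by
    obtain ⟨D, hD, _⟩ := h t ht
    exact hD.continuousAt.continuousWithinAt
  refine (convex_Icc p q).image_sub_le_mul_sub_of_deriv_le hc ?_ ?_ p (Set.left_mem_Icc.2 hpq) q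
    (Set.right_mem_Icc.2 hpq) hpq
  · intro t ht
    obtain ⟨D, hD, _⟩ := h t (interior_subset ht)
    exact hD.differentiableAt.differentiableWithinAt
  · intro t ht
    obtain ⟨D, hD, h'⟩ := h t (interior_subset ht)
    rw [hD.deriv]; exact h'

theorem mvt_lt {f : ℝ → ℝ} {p q : ℝ} (hpq : p < q)
    (h : ∀ t ∈ Set.Icc p q, ∃ D, HasDerivAt f D t ∧ 0 < D) : f p < f q := by
  have hc : ContinuousOn f (Set.Icc p q) := fun t ht => by
    obtain ⟨D, hD, _⟩ := h t ht
    exact hD.continuousAt.continuousWithinAt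
  refine strictMonoOn_of_deriv_pos (convex_Icc p q) hc ?_ (Set.left_mem_Icc.2 hpq.le)
    (Set.right_mem_Icc.2 hpq.le) hpq
  intro t ht
  obtain ⟨D, hD, h'⟩ := h t (interior_subset ht)
  rw [hD.deriv]; exact h'

theorem cE_abs_le (a : ℝ) (y : ℂ → ℂ) (z : ℂ) : 2 * |cE a y z| ≤ cS a y z := by
  have : |cE a y z| ≤ ‖cZ a y z‖ * ‖cY y z‖ := by
    refine (abs_re_le_norm _).trans ?_
    rw [norm_mul, norm_conj]
  unfold cS
  nlinarith [sq_nonneg (‖cY y z‖ - ‖cZ a y z‖)]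

theorem cS_pos {a l : ℝ} {y : ℂ → ℂ} (h : CubSol a l y) (hy : y ≠ 0) {z : ℂ}
    (hbig : 1 + |a| ≤ ‖csq z‖) : 0 < cS a y z := by
  have ha := abs_nonneg a
  have hB : cB a z ≠ 0 := by
    rw [← norm_pos_iff]; linarith [(cB_norm_lower hbig).2]
  unfold cS
  by_cases h0 : y z = 0
  · have := h.simple hy h0
    have : 0 < ‖cY y z‖ := by simpa [cY, h0] using this
    positivity
  · have : 0 < ‖cZ a y z‖ := by simp [cZ, h0, hB]
    positivity

noncomputable def cT (a l : ℝ) : ℝ := 2 * (cC a l + 1) ^ 2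

theorem cC_abs (a l : ℝ) : 1 + |a| ≤ cC a l := by
  unfold cC
  nlinarith [abs_nonneg l, sq_nonneg a]

theorem csq_big {a l : ℝ} {z : ℂ} (hz : z ≠ 0) (h : cT a l ≤ ‖z‖) : cC a l + 1 ≤ ‖csq z‖ := by
  have h1 := csq_norm hz
  have := cC_pos a l
  unfold cT at h
  nlinarith [norm_nonneg (csq z)]

theorem cT_ge (a l : ℝ) : 8 ≤ cT a l := by
  have := cC_pos a l
  unfold cT; nlinarith

theorem imag_w {a l t : ℝ} (ht : cT a l ≤ t) :
    (I * csq (I * t) ^ 3).re ≤ - (cC a l + 1) := by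
  have h8 := cT_ge a l
  have hne : I * (t : ℂ) ≠ 0 := by simp; linarith
  have h1 := csq_sq hne
  obtain ⟨hx, hy⟩ := csq_re_im (z := I * t) (by simp; linarith) hne
  set w := csq (I * t)
  have e1 := congrArg re h1
  have e2 := congrArg im h1
  simp [sq] at e1 e2
  have e3 : w.re = w.im := by nlinarith
  have e4 : w.im ^ 2 = t / 2 := by rw [e3] at e2; linarith
  have hc := cC_pos a l
  have e5 : cC a l + 1 ≤ w.im := by unfold cT at ht; nlinarith
  have e6 : (I * w ^ 3).re = - (2 * w.im ^ 3) := by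
    simp [pow_succ, e3]; ring
  rw [e6]
  nlinarith [pow_le_pow_left₀ (by linarith) e5 2]

theorem imag_deriv {a l : ℝ} {y : ℂ → ℂ} (h : CubSol a l y) {t : ℝ} (ht : cT a l ≤ t) :
    ∃ D, HasDerivAt (fun t : ℝ => cE a y (I * t)) D t ∧ D ≤ - cS a y (I * t) := by
  have h8 := cT_ge a l
  have hne : I * (t : ℂ) ≠ 0 := by simp; linarith
  have hz : HasDerivAt (fun t : ℝ => I * (t : ℂ)) I t := by
    simpa using (Complex.ofRealCLM.hasDerivAt (x := t)).const_mul I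
  have hn : ‖I * (t : ℂ)‖ = t := by simp; linarith
  have hb := csq_big (a := a) (l := l) hne (by rw [hn]; exact ht)
  have := cC_abs a l
  obtain ⟨D, hD, hD'⟩ := cE_hasDerivAt h hz (by simp; linarith) (by linarith) hne
  refine ⟨D, hD, ?_⟩
  have hS : 0 ≤ cS a y (I * t) := by unfold cS; positivity
  have h1 := (abs_le.1 hD').2
  have h2 := imag_w ht
  rw [norm_I] at h1
  nlinarith [mul_le_mul_of_nonneg_right h2 hS]

theorem cQ_bound {a l s : ℝ} (hs : 1 ≤ s) :
    ‖(I * (s : ℂ)) ^ 3 - a * (I * s) + l‖ ≤ (1 + |a| + |l|) * s ^ 3 := by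
  have h1 : ‖(I * (s : ℂ)) ^ 3 - a * (I * s) + l‖ ≤ s ^ 3 + |a| * s + |l| := by
    refine (norm_add_le _ _).trans (add_le_add ((norm_sub_le _ _).trans (add_le_add ?_ ?_)) ?_)
    · simp [abs_of_nonneg (by linarith : 0 ≤ s)]
    · simp [abs_of_nonneg (by linarith : 0 ≤ s)]
    · simp
  have h3 : 1 ≤ s ^ 3 := one_le_pow₀ hs
  have h4 : s ≤ s ^ 3 := by nlinarith [one_le_pow₀ (n := 2) hs]
  nlinarith [mul_le_mul_of_nonneg_left h4 (abs_nonneg a), mul_le_mul_of_nonneg_left h3 (abs_nonneg l)]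

/-- Polynomial bound on the derivative of a bounded solution on the imaginary axis. -/
theorem deriv_poly {a l M t : ℝ} {y : ℂ → ℂ} (h : CubSol a l y) (ht : 1 ≤ t)
    (hM : ∀ s, t ≤ s → ‖y (I * s)‖ ≤ M) :
    ‖deriv y (I * t)‖ ≤ 2 * M + (1 + |a| + |l|) * (t + 1) ^ 3 * M := by
  have hM0 : 0 ≤ M := (norm_nonneg _).trans (hM t le_rfl)
  set K := (1 + |a| + |l|) * (t + 1) ^ 3 * M with hK
  have hK0 : 0 ≤ K := by positivity
  have hz : ∀ t : ℝ, HasDerivAt (fun t : ℝ => I * (t : ℂ)) I t := fun t => by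
    simpa using (Complex.ofRealCLM.hasDerivAt (x := t)).const_mul I
  have hg : ∀ s : ℝ, HasDerivAt (fun t : ℝ => y (I * t)) (deriv y (I * s) * I) s :=
    fun s => (h.hd (I * s)).comp s (hz s)
  have hg' : ∀ s : ℝ, HasDerivAt (fun t : ℝ => deriv y (I * t))
      (((I * s) ^ 3 - a * (I * s) + l) * y (I * s) * I) s :=
    fun s => (HasDerivAt.comp (h₂ := deriv y) s (h.hd' (I * s)) (hz s) :)
  have step1 : ∀ s ∈ Set.Icc t (t + 1), ‖deriv y (I * s) - deriv y (I * t)‖ ≤ K := by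
    intro s hs
    have := norm_image_sub_le_of_norm_deriv_le_segment' (f := fun t : ℝ => deriv y (I * t))
      (C := K) (a := t) (b := t + 1) (fun x _ => (hg' x).hasDerivWithinAt) (fun x hx => by
        rw [norm_mul, norm_mul, norm_I, mul_one]
        have h1 := cQ_bound (a := a) (l := l) (s := x) (by linarith [hx.1])
        have h2 := hM x hx.1
        have h3 : x ^ 3 ≤ (t + 1) ^ 3 := pow_le_pow_left₀ (by linarith [hx.1]) hx.2.le 3
        have hx0 : 0 ≤ x := by linarith [hx.1]
        calc _ ≤ ((1 + |a| + |l|) * x ^ 3) * M := by gcongr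
          _ ≤ K := by rw [hK]; gcongr) s hs
    refine this.trans ?_
    nlinarith [hs.1, hs.2]
  have hφ : ∀ s : ℝ, HasDerivAt (fun s : ℝ => y (I * s) - (s : ℂ) * (deriv y (I * t) * I))
      (deriv y (I * s) * I - 1 * (deriv y (I * t) * I)) s := fun s =>
    (hg s).fun_sub ((Complex.ofRealCLM.hasDerivAt (x := s)).mul_const _)
  have step2 := norm_image_sub_le_of_norm_deriv_le_segment'
      (f := fun s : ℝ => y (I * s) - (s : ℂ) * (deriv y (I * t) * I))
      (C := K) (a := t) (b := t + 1) (fun x _ => (hφ x).hasDerivWithinAt) (fun x hx => by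
        rw [one_mul, ← sub_mul, norm_mul, norm_I, mul_one]
        exact step1 x ⟨hx.1, hx.2.le⟩) (t + 1) (by constructor <;> linarith)
  have e : deriv y (I * t) * I = y (I * ((t + 1 : ℝ) : ℂ)) - y (I * t) -
     ((y (I * ((t + 1 : ℝ) : ℂ)) - ((t + 1 : ℝ) : ℂ) * (deriv y (I * t) * I)) -
      (y (I * t) - (t : ℂ) * (deriv y (I * t) * I))) := by push_cast; ring
  have e' : ‖deriv y (I * t)‖ = ‖deriv y (I * t) * I‖ := by simp
  rw [e', e]
  have m1 := hM (t + 1) (by linarith)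
  have m2 := hM t le_rfl
  refine (norm_sub_le _ _).trans ?_
  have := norm_sub_le (y (I * ((t + 1 : ℝ) : ℂ))) (y (I * t))
  linarith

theorem imag_E_nonneg {a l : ℝ} {y : ℂ → ℂ} (h : CubSol a l y)
    (hlim : Tendsto (fun t : ℝ => y (I * t)) atTop (nhds 0)) :
    ∃ T, cT a l ≤ T ∧ ∀ t, T ≤ t → 0 ≤ cE a y (I * t) := by
  have hb : ∀ᶠ t : ℝ in atTop, ‖y (I * t)‖ ≤ 1 := by
    have := hlim.norm
    rw [norm_zero] at this
    filter_upwards [this.eventually (gt_mem_nhds one_pos)] with t ht using le_of_lt ht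
  obtain ⟨T0, hT0⟩ := eventually_atTop.1 hb
  refine ⟨max T0 (cT a l), le_max_right _ _, fun t0 ht0 => ?_⟩
  have ht0' : T0 ≤ t0 := (le_max_left _ _).trans ht0
  have ht0'' : cT a l ≤ t0 := (le_max_right _ _).trans ht0
  have h8 := cT_ge a l
  by_contra! hneg
  set K := (1 + |a| + |l|) with hK
  have hK1 : 1 ≤ K := by have := abs_nonneg a; have := abs_nonneg l; linarith
  -- polynomial bound
  have poly : ∀ t, t0 ≤ t → |cE a y (I * t)| ≤ (1 + |a|) * (4 * K) * (t + 1) ^ 5 := by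
    intro t ht
    have ht1 : 1 ≤ t := by linarith
    have hne : I * (t : ℂ) ≠ 0 := by simp; linarith
    have hn : ‖I * (t : ℂ)‖ = t := by simp; linarith
    have hw2 := csq_norm hne
    rw [hn] at hw2
    have hw1 : 1 ≤ ‖csq (I * t)‖ := by nlinarith [norm_nonneg (csq (I * t))]
    have hB : ‖cB a (I * t)‖ ≤ (1 + |a|) * t ^ 2 := by
      unfold cB
      have h1 : ‖(a : ℂ) / (2 * csq (I * t))‖ ≤ |a| := by
        have := norm_div_le_of (x := a) (y := 2 * csq (I * t)) (c := |a|) (d := 1) (by norm_num)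
          (by simp) (by rw [norm_mul]; simp; linarith)
        simpa using this
      refine (norm_sub_le (csq (I * t) ^ 3) ((a : ℂ) / (2 * csq (I * t)))).trans ?_
      rw [norm_pow]
      have h2 : ‖csq (I * t)‖ ^ 3 ≤ t ^ 2 := by
        have : t ^ 2 = ‖csq (I * t)‖ ^ 4 := by nth_rewrite 1 [← hw2]; ring
        rw [this]; exact pow_le_pow_right₀ hw1 (by norm_num)
      have h3 : 1 ≤ t ^ 2 := one_le_pow₀ ht1
      nlinarith [abs_nonneg a]
    have hd := deriv_poly h ht1 (M := 1) (fun s hs => hT0 s (by linarith))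
    have hr : ‖cr (I * t)‖ ≤ 1 := by
      unfold cr
      have := norm_div_le_of (x := 3) (y := 4 * (I * (t : ℂ))) (c := 3) (d := 4) (by norm_num) (by simp)
        (by rw [norm_mul, hn]; simp; linarith)
      linarith
    have hy1 := hT0 t (by linarith)
    have hY : ‖cY y (I * t)‖ ≤ 4 * K * (t + 1) ^ 3 := by
      unfold cY
      refine (norm_add_le _ _).trans ?_
      rw [norm_mul]
      have : ‖cr (I * t)‖ * ‖y (I * t)‖ ≤ 1 := mul_le_one₀ hr (norm_nonneg _) hy1
      have h3 : 1 ≤ (t + 1) ^ 3 := one_le_pow₀ (by linarith)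
      nlinarith
    have hE : |cE a y (I * t)| ≤ ‖cB a (I * t)‖ * ‖y (I * t)‖ * ‖cY y (I * t)‖ := by
      refine (abs_re_le_norm _).trans ?_
      rw [norm_mul, norm_conj, cZ, norm_mul]
    calc _ ≤ _ := hE
      _ ≤ ((1 + |a|) * t ^ 2) * 1 * (4 * K * (t + 1) ^ 3) := by gcongr
      _ ≤ ((1 + |a|) * (t + 1) ^ 2) * 1 * (4 * K * (t + 1) ^ 3) := by
        have := abs_nonneg a
        gcongr; linarith
      _ = _ := by ring
  -- exponential growth
  have growth : ∀ t, t0 ≤ t → cE a y (I * t) * Real.exp (-2 * t) ≤ cE a y (I * t0) * Real.exp (-2 * t0) := by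
    intro t ht
    have := mvt_le (f := fun t : ℝ => cE a y (I * t) * Real.exp (-2 * t)) (c := 0) ht (fun s hs => by
      obtain ⟨D, hD, hD'⟩ := imag_deriv h (ht0''.trans hs.1)
      have he : HasDerivAt (fun t : ℝ => Real.exp (-2 * t)) (Real.exp (-2 * s) * (-2)) s := by
        have := ((hasDerivAt_id s).const_mul (-2)).exp
        simpa using this
      refine ⟨_, hD.fun_mul he, ?_⟩
      have h1 := cE_abs_le a y (I * s)
      have h2 := neg_abs_le (cE a y (I * s))
      have h3 := Real.exp_pos (-2 * s)
      have : D - 2 * cE a y (I * s) ≤ 0 := by linarith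
      nlinarith)
    simpa using this
  -- contradiction
  have lim : Tendsto (fun t : ℝ => (1 + |a|) * (4 * K) * ((t + 1) ^ 5 * Real.exp (-(t + 1))) * Real.exp 1) atTop (nhds 0) := by
    have h1 := (Real.tendsto_pow_mul_exp_neg_atTop_nhds_zero 5).comp (tendsto_atTop_add_const_right atTop (1:ℝ) tendsto_id)
    have := (h1.const_mul ((1 + |a|) * (4 * K))).mul_const (Real.exp 1)
    simpa using this
  have hpos : 0 < - (cE a y (I * t0) * Real.exp (-2 * t0)) := by
    have := Real.exp_pos (-2 * t0)
    nlinarith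
  obtain ⟨t, ht1, ht2⟩ := ((lim.eventually (gt_mem_nhds hpos)).and (eventually_ge_atTop t0)).exists
  have g := growth t ht2
  have p := poly t ht2
  have n := neg_abs_le (cE a y (I * t))
  have ex : Real.exp (-2 * t) ≤ Real.exp (-(t + 1)) * Real.exp 1 := by
    rw [← Real.exp_add]; apply Real.exp_le_exp.2; linarith
  have ep := Real.exp_pos (-2 * t)
  have hh : |cE a y (I * t)| * Real.exp (-2 * t) ≤
      ((1 + |a|) * (4 * K) * (t + 1) ^ 5) * (Real.exp (-(t + 1)) * Real.exp 1) := by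
    have : 0 ≤ t + 1 := by linarith
    gcongr
  nlinarith

theorem imag_unique {a l : ℝ} {y1 y2 : ℂ → ℂ} (h1 : CubSol a l y1) (h2 : CubSol a l y2) (hy : y1 ≠ 0)
    (hlim1 : Tendsto (fun t : ℝ => y1 (I * t)) atTop (nhds 0))
    (hlim2 : Tendsto (fun t : ℝ => y2 (I * t)) atTop (nhds 0)) : ∃ c : ℂ, ∀ z, y2 z = c * y1 z := by
  obtain ⟨T1, hT1, p1⟩ := imag_E_nonneg h1 hlim1
  obtain ⟨T2, hT2, p2⟩ := imag_E_nonneg h2 hlim2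
  refine h1.proportional h2 hy (z₀ := 0) ?_
  set W := y1 0 * deriv y2 0 - deriv y1 0 * y2 0 with hW
  have hWc : ∀ z, y1 z * deriv y2 z - deriv y1 z * y2 z = W := fun z => h1.wronskian_const h2 z 0
  by_contra hne
  have hpos : 0 < ‖W‖ := norm_pos_iff.2 hne
  set T := max T1 T2
  set F : ℝ → ℝ := fun t => cE a y1 (I * t) + cE a y2 (I * t) with hF
  have hdec : ∀ t, T ≤ t → F t - F T ≤ (-‖W‖) * (t - T) := by
    intro t ht
    refine mvt_le ht fun s hs => ?_
    have hs' : cT a l ≤ s := hT1.trans ((le_max_left _ _).trans hs.1)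
    obtain ⟨D1, hD1, hD1'⟩ := imag_deriv h1 hs'
    obtain ⟨D2, hD2, hD2'⟩ := imag_deriv h2 hs'
    refine ⟨_, hD1.fun_add hD2, ?_⟩
    have h8 := cT_ge a l
    have hzne : I * (s : ℂ) ≠ 0 := by simp; linarith
    have hn : ‖I * (s : ℂ)‖ = s := by simp; linarith
    have hb := csq_big (a := a) (l := l) hzne (by rw [hn]; exact hs')
    have hcc := cC_abs a l
    have hcp := cC_pos a l
    have hB := (cB_norm_lower (a := a) (z := I * s) (by linarith)).2
    have e : cB a (I * s) * W = cZ a y1 (I * s) * cY y2 (I * s) - cY y1 (I * s) * cZ a y2 (I * s) := by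
      rw [← hWc (I * s)]; unfold cZ cY; ring
    have e2 : ‖cB a (I * s)‖ * ‖W‖ ≤ ‖cZ a y1 (I * s)‖ * ‖cY y2 (I * s)‖ + ‖cY y1 (I * s)‖ * ‖cZ a y2 (I * s)‖ := by
      rw [← norm_mul, e, ← norm_mul, ← norm_mul]; exact norm_sub_le _ _
    have e3 : ‖W‖ ≤ ‖cB a (I * s)‖ * ‖W‖ := by
      have : 1 ≤ ‖cB a (I * s)‖ := by linarith
      nlinarith
    unfold cS at hD1' hD2'
    nlinarith [sq_nonneg (‖cZ a y1 (I * s)‖ - ‖cY y2 (I * s)‖), sq_nonneg (‖cY y1 (I * s)‖ - ‖cZ a y2 (I * s)‖)]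
  have hFp : ∀ t, T ≤ t → 0 ≤ F t := fun t ht =>
    add_nonneg (p1 t ((le_max_left _ _).trans ht)) (p2 t ((le_max_right _ _).trans ht))
  have hFT := hFp T le_rfl
  have ht : T ≤ T + (F T + 1) / ‖W‖ := by
    have : 0 ≤ (F T + 1) / ‖W‖ := by positivity
    linarith
  have d := hdec _ ht
  have p := hFp _ ht
  have : (-‖W‖) * (T + (F T + 1) / ‖W‖ - T) = -(F T + 1) := by field_simp; ring
  linarith


structure RealSol (a l : ℝ) (y : ℂ → ℂ) : Prop where
  sol : CubSol a l y
  ne : y ≠ 0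
  real : ∀ z, (starRingEnd ℂ) (y ((starRingEnd ℂ) z)) = y z
  lim : Tendsto (fun t : ℝ => y (I * t)) atTop (nhds 0)

theorem exists_realSol {a l : ℝ} {y : ℂ → ℂ} (h : IsCubicEigenfunction a l y) :
    ∃ y', RealSol a l y' ∧ nonrealZeros y' = nonrealZeros y := by
  obtain ⟨hd, hne, hode, hlim1, hlim2⟩ := h
  have hs : CubSol a l y := ⟨hd, fun z => by linear_combination -(hode z)⟩
  have hlim3 : Tendsto (fun t : ℝ => (starRingEnd ℂ) (y ((starRingEnd ℂ) (I * t)))) atTop (nhds 0) := by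
    have h1 := (continuous_conj.tendsto (0 : ℂ)).comp (hlim2.comp tendsto_neg_atTop_atBot)
    rw [map_zero] at h1
    refine h1.congr fun t => ?_
    simp
  obtain ⟨c, hc⟩ := imag_unique hs hs.conj hne hlim1 hlim3
  have key : ∀ d : ℂ, d ≠ 0 → (starRingEnd ℂ) d * c = d →
      ∃ y', RealSol a l y' ∧ nonrealZeros y' = nonrealZeros y := by
    intro d hd0 hdc
    refine ⟨fun z => d * y z, ⟨hs.smul d, ?_, ?_, ?_⟩, ?_⟩
    · intro h0
      apply hne
      funext z
      have := congrFun h0 z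
      simpa [hd0] using this
    · intro z
      rw [map_mul, hc z, ← mul_assoc, hdc]
    · simpa using hlim1.const_mul d
    · ext z; simp [nonrealZeros, hd0]
  obtain ⟨z0, hz0⟩ : ∃ z, y z ≠ 0 := by
    by_contra! hh
    exact hne (funext hh)
  have hcc : (starRingEnd ℂ) c * c = 1 := by
    have h1 := hc z0
    have h2 := hc ((starRingEnd ℂ) z0)
    rw [conj_conj] at h2
    have h3 : y z0 = (starRingEnd ℂ) c * (c * y z0) := by
      rw [← h1, ← map_mul, ← h2, conj_conj]
    have h4 : ((starRingEnd ℂ) c * c - 1) * y z0 = 0 := by linear_combination -h3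
    have := (mul_eq_zero.1 h4).resolve_right hz0
    linear_combination this
  by_cases hc1 : c = -1
  · exact key I I_ne_zero (by rw [hc1]; simp)
  · refine key (1 + c) (fun h => hc1 (by linear_combination h)) ?_
    rw [map_add, map_one]; linear_combination hcc

theorem RealSol.unique_zeros {a l : ℝ} {y1 y2 : ℂ → ℂ} (h1 : RealSol a l y1) (h2 : RealSol a l y2) :
    nonrealZeros y2 = nonrealZeros y1 := by
  obtain ⟨c, hc⟩ := imag_unique h1.sol h2.sol h1.ne h1.lim h2.lim
  have hc0 : c ≠ 0 := by
    rintro rfl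
    exact h2.ne (funext fun z => by simp [hc])
  ext z; simp [nonrealZeros, hc, hc0]


theorem RealSol.im_zero {a l : ℝ} {y : ℂ → ℂ} (h : RealSol a l y) (x : ℝ) : (y x).im = 0 := by
  have := h.real x
  rw [conj_ofReal] at this
  exact conj_eq_iff_im.1 this

theorem RealSol.real' {a l : ℝ} {y : ℂ → ℂ} (h : RealSol a l y) (z : ℂ) :
    (starRingEnd ℂ) (deriv y ((starRingEnd ℂ) z)) = deriv y z := by
  have e : deriv (fun z => (starRingEnd ℂ) (y ((starRingEnd ℂ) z))) =
      fun z => (starRingEnd ℂ) (deriv y ((starRingEnd ℂ) z)) := deriv_conj_conj (f := y)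
  have e2 : (fun z => (starRingEnd ℂ) (y ((starRingEnd ℂ) z))) = y := funext h.real
  rw [e2] at e
  exact (congrFun e z).symm

theorem RealSol.im_zero' {a l : ℝ} {y : ℂ → ℂ} (h : RealSol a l y) (x : ℝ) : (deriv y x).im = 0 := by
  have := h.real' x
  rw [conj_ofReal] at this
  exact conj_eq_iff_im.1 this

theorem RealSol.cY_im {a l : ℝ} {y : ℂ → ℂ} (h : RealSol a l y) (x : ℝ) : (cY y x).im = 0 := by
  have h1 := h.im_zero x
  have h2 := h.im_zero' x
  have h3 : cr x = ((3 / (4 * x) : ℝ) : ℂ) := by unfold cr; push_cast; rfl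
  unfold cY
  rw [h3, add_im, im_ofReal_mul, h1, h2]; simp

theorem csq_neg {x : ℝ} (hx : x < 0) : (csq x).re = 0 ∧ 0 < (csq x).im := by
  have hne : (x : ℂ) ≠ 0 := by simp; linarith
  have h1 := csq_sq hne
  obtain ⟨hr, hi⟩ := csq_re_im (z := (x : ℂ)) (by simp) hne
  have e1 := congrArg re h1
  have e2 := congrArg im h1
  simp [sq] at e1 e2
  have hne : (csq x).im ≠ 0 := fun h0 => by rw [h0] at e1; nlinarith [sq_nonneg (csq x).re]
  have : (csq x).re * (csq x).im = 0 := by linarith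
  exact ⟨(mul_eq_zero.1 this).resolve_right hne, lt_of_le_of_ne hi (Ne.symm hne)⟩

theorem csq_pos {x : ℝ} (hx : 0 < x) : (csq x).im = 0 ∧ 0 < (csq x).re := by
  have hne : (x : ℂ) ≠ 0 := by simp; linarith
  have h1 := csq_sq hne
  obtain ⟨hr, hi⟩ := csq_re_im (z := (x : ℂ)) (by simp) hne
  have e1 := congrArg re h1
  have e2 := congrArg im h1
  simp [sq] at e1 e2
  have hne : (csq x).re ≠ 0 := fun h0 => by rw [h0] at e1; nlinarith [sq_nonneg (csq x).im]
  have : (csq x).im * (csq x).re = 0 := by linarith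
  exact ⟨(mul_eq_zero.1 this).resolve_right hne, lt_of_le_of_ne hr (Ne.symm hne)⟩

theorem cB_neg {a x : ℝ} (hx : x < 0) : (cB a x).re = 0 := by
  obtain ⟨h1, h2⟩ := csq_neg hx
  unfold cB
  have : csq x = (csq x).im * I := by apply Complex.ext <;> simp [h1]
  rw [this]
  simp [pow_succ, div_eq_mul_inv]

theorem cB_pos {a x : ℝ} (hx : 0 < x) : (cB a x).im = 0 := by
  obtain ⟨h1, h2⟩ := csq_pos hx
  unfold cB
  have : csq x = ((csq x).re : ℂ) := by apply Complex.ext <;> simp [h1]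
  rw [this]
  have : (((csq x).re : ℂ) ^ 3 - a / (2 * (csq x).re)) = (((csq x).re ^ 3 - a / (2 * (csq x).re) : ℝ) : ℂ) := by
    push_cast; rfl
  rw [this, ofReal_im]

theorem RealSol.cE_neg {a l : ℝ} {y : ℂ → ℂ} (h : RealSol a l y) {x : ℝ} (hx : x < 0) : cE a y x = 0 := by
  have h1 := h.im_zero x
  have h2 := h.cY_im x
  have h3 := cB_neg (a := a) hx
  simp [cE, cZ, h1, h2, h3]

theorem path_lt {a l : ℝ} {y : ℂ → ℂ} (h : CubSol a l y) (hy : y ≠ 0) {z0 e : ℂ} {L : ℝ} (hL : 0 < L)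
    (H : ∀ s, 0 ≤ s → s ≤ L → 0 ≤ (z0 + s * e).im ∧ z0 + s * e ≠ 0 ∧
      1 + |a| ≤ ‖csq (z0 + s * e)‖ ∧ cC a l * ‖e‖ < (e * csq (z0 + s * e) ^ 3).re) :
    cE a y z0 < cE a y (z0 + L * e) := by
  have := mvt_lt (f := fun s : ℝ => cE a y (z0 + s * e)) hL (fun s hs => by
    obtain ⟨h1, h2, h3, h4⟩ := H s hs.1 hs.2
    have hz : HasDerivAt (fun s : ℝ => z0 + s * e) e s := by
      simpa using ((Complex.ofRealCLM.hasDerivAt (x := s)).mul_const e).const_add z0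
    obtain ⟨D, hD, hD'⟩ := cE_hasDerivAt h hz h1 h3 h2
    refine ⟨D, hD, ?_⟩
    have hS := cS_pos h hy h3
    have := (abs_le.1 hD').1
    nlinarith [mul_pos (sub_pos.2 h4) hS])
  simpa using this

theorem RealSol.imag_pos {a l : ℝ} {y : ℂ → ℂ} (h : RealSol a l y) :
    ∃ T, cT a l ≤ T ∧ ∀ t : ℝ, T ≤ t → 0 < cE a y (I * t) := by
  obtain ⟨T, hT, hp⟩ := imag_E_nonneg h.sol h.lim
  refine ⟨T, hT, fun t ht => ?_⟩
  have h1 := hp (t + 1) (by linarith)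
  have := mvt_lt (f := fun t : ℝ => - cE a y (I * t)) (show t < t + 1 by linarith) (fun s hs => by
    obtain ⟨D, hD, hD'⟩ := imag_deriv h.sol (t := s) (by linarith [hs.1])
    refine ⟨_, hD.fun_neg, ?_⟩
    have h8 := cT_ge a l
    have hs8 : 8 ≤ s := by linarith [hs.1]
    have hzne : I * (s : ℂ) ≠ 0 := by simp; linarith
    have hn : ‖I * (s : ℂ)‖ = s := by simp; linarith
    have hb := csq_big (a := a) (l := l) hzne (by rw [hn]; linarith [hs.1])
    have := cS_pos h.sol h.ne (z := I * s) (by linarith [cC_abs a l])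
    linarith)
  linarith

/-- real and imaginary part facts of the square root -/
theorem csq_parts {z : ℂ} (him : 0 ≤ z.im) (hz : z ≠ 0) : 0 ≤ (csq z).re ∧ 0 ≤ (csq z).im ∧
    (csq z).re ^ 2 - (csq z).im ^ 2 = z.re ∧ 2 * ((csq z).re * (csq z).im) = z.im ∧
    (csq z).re ^ 2 + (csq z).im ^ 2 = ‖z‖ := by
  obtain ⟨hr, hi⟩ := csq_re_im him hz
  have h1 := csq_sq hz
  have e1 := congrArg re h1
  have e2 := congrArg im h1
  simp only [sq, mul_re, mul_im] at e1 e2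
  refine ⟨hr, hi, by linarith, by linarith, ?_⟩
  rw [← csq_norm hz, Complex.sq_norm, normSq_apply]; ring

set_option maxHeartbeats 2000000 in
theorem RealSol.region {a l : ℝ} {y : ℂ → ℂ} (h : RealSol a l y) :
    ∃ R, cT a l ≤ R ∧ ∀ z : ℂ, R ≤ ‖z‖ → 0 ≤ z.im → (0 < z.im ∨ 0 < z.re) → 0 < cE a y z := by
  obtain ⟨T, hT, hp⟩ := h.imag_pos
  set C := cC a l with hC
  have hC1 : 1 ≤ C := cC_pos a l
  have hCa : 1 + |a| ≤ C := cC_abs a l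
  have h8 := cT_ge a l
  refine ⟨2 * T + 54 * C ^ 2, by nlinarith, fun z hz him hor => ?_⟩
  have hzT : 2 * T ≤ ‖z‖ := by nlinarith
  have hzC : 54 * C ^ 2 ≤ ‖z‖ := by linarith
  have hnle := norm_le_abs_re_add_abs_im z
  rw [abs_of_nonneg him] at hnle
  have cube : ∀ x : ℝ, 9 * C ^ 2 ≤ x ^ 2 → 0 ≤ x → 3 * C ≤ x ∧ 27 * C ≤ x ^ 3 := by
    intro x hx hx0
    have h1 : 3 * C ≤ x := by nlinarith
    refine ⟨h1, ?_⟩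
    have h2 : 9 ≤ x ^ 2 := by nlinarith
    nlinarith
  rcases lt_trichotomy z.re 0 with hre | hre | hre
  · rw [abs_of_neg hre] at hnle
    have him0 : 0 < z.im := hor.resolve_right (by linarith)
    by_cases hcase : -z.re ≤ z.im
    · have hst : 0 < cE a y (I * z.im) := hp _ (by linarith)
      have key := path_lt h.sol h.ne (z0 := I * z.im) (e := -1) (L := -z.re) (by linarith) (fun s hs0 hsL => by
        set p : ℂ := I * z.im + s * (-1) with hpdef
        have pre : p.re = -s := by simp [hpdef]
        have pim : p.im = z.im := by simp [hpdef]
        have pne : p ≠ 0 := fun h0 => by rw [h0] at pim; simp at pim; linarith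
        obtain ⟨w1, w2, w3, w4, w5⟩ := csq_parts (z := p) (by linarith) pne
        have hpn : z.im ≤ ‖p‖ := by rw [← pim]; exact (le_abs_self _).trans (abs_im_le_norm p)
        set x := (csq p).re
        set v := (csq p).im
        have hv2 : 9 * C ^ 2 ≤ v ^ 2 := by nlinarith
        obtain ⟨hv3, hv4⟩ := cube v hv2 w2
        have hx3 : v / 3 ≤ x := by
          by_contra! hlt
          nlinarith
        have hxv : x ^ 2 ≤ v ^ 2 := by linarith
        refine ⟨by linarith, pne, ?_, ?_⟩
        · have := (le_abs_self _).trans (abs_im_le_norm (csq p))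
          linarith
        · have e : (-1 * csq p ^ 3).re = x * (3 * v ^ 2 - x ^ 2) := by
            simp [pow_succ, x, v]; ring
          rw [e, norm_neg, norm_one]
          have : v / 3 * (2 * v ^ 2) ≤ x * (3 * v ^ 2 - x ^ 2) := by
            apply mul_le_mul hx3 (by linarith) (by positivity) w1
          nlinarith)
      have e : I * z.im + ((-z.re : ℝ) : ℂ) * (-1) = z := by
        apply Complex.ext <;> simp
      rw [e] at key
      linarith
    · push Not at hcase
      have hst : cE a y (z.re : ℂ) = 0 := h.cE_neg hre
      have key := path_lt h.sol h.ne (z0 := (z.re : ℂ)) (e := I) (L := z.im) him0 (fun s hs0 hsL => by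
        set p : ℂ := z.re + s * I with hpdef
        have pre : p.re = z.re := by simp [hpdef]
        have pim : p.im = s := by simp [hpdef]
        have pne : p ≠ 0 := fun h0 => by rw [h0] at pre; simp at pre; linarith
        obtain ⟨w1, w2, w3, w4, w5⟩ := csq_parts (z := p) (by linarith) pne
        have hpn : -z.re ≤ ‖p‖ := by rw [← pre]; exact (neg_le_abs _).trans (abs_re_le_norm p)
        set x := (csq p).re
        set v := (csq p).im
        have hv2 : 9 * C ^ 2 ≤ v ^ 2 := by nlinarith
        obtain ⟨hv3, hv4⟩ := cube v hv2 w2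
        have hx3 : x ≤ v / 2 := by
          by_contra! hlt
          have hv0 : 0 < v := by linarith
          have := mul_lt_mul_of_pos_right hlt hv0
          have : 2 * (x * v) ≤ v ^ 2 - x ^ 2 := by linarith
          nlinarith [sq_nonneg x]
        refine ⟨by linarith, pne, ?_, ?_⟩
        · have := (le_abs_self _).trans (abs_im_le_norm (csq p))
          linarith
        · have e : (I * csq p ^ 3).re = v * (v ^ 2 - 3 * x ^ 2) := by
            simp [pow_succ, x, v]; ring
          rw [e, norm_I]
          have hx2 : x ^ 2 ≤ v ^ 2 / 4 := by nlinarith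
          have : v * (v ^ 2 / 4) ≤ v * (v ^ 2 - 3 * x ^ 2) := by
            apply mul_le_mul_of_nonneg_left (by linarith) w2
          nlinarith)
      have e : (z.re : ℂ) + (z.im : ℂ) * I = z := re_add_im z
      rw [e] at key
      linarith
  · have e : z = I * z.im := by apply Complex.ext <;> simp [hre]
    rw [hre, abs_zero] at hnle
    rw [e]
    exact hp _ (by linarith)
  · rw [abs_of_pos hre] at hnle
    have hst : 0 < cE a y (I * ((z.im + 2 * z.re : ℝ) : ℂ)) := hp _ (by linarith)
    have key := path_lt h.sol h.ne (z0 := I * ((z.im + 2 * z.re : ℝ) : ℂ)) (e := 1 - 2 * I) (L := z.re) hre (fun s hs0 hsL => by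
        set p : ℂ := I * ((z.im + 2 * z.re : ℝ) : ℂ) + s * (1 - 2 * I) with hpdef
        have pre : p.re = s := by simp [hpdef]
        have pim : p.im = z.im + 2 * z.re - 2 * s := by simp [hpdef]; ring
        have hpr : p.re ≤ ‖p‖ := (le_abs_self _).trans (abs_re_le_norm p)
        have hpi : p.im ≤ ‖p‖ := (le_abs_self _).trans (abs_im_le_norm p)
        have hpn : ‖z‖ ≤ 3 * ‖p‖ := by linarith
        have pne : p ≠ 0 := fun h0 => by rw [h0, norm_zero] at hpn; linarith
        obtain ⟨w1, w2, w3, w4, w5⟩ := csq_parts (z := p) (by linarith) pne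
        set x := (csq p).re
        set v := (csq p).im
        have hv2 : 9 * C ^ 2 ≤ x ^ 2 := by nlinarith
        obtain ⟨hv3, hv4⟩ := cube x hv2 w1
        have hxv : v ≤ x := by
          by_contra! hlt
          nlinarith
        refine ⟨by linarith, pne, ?_, ?_⟩
        · have := (le_abs_self _).trans (abs_re_le_norm (csq p))
          linarith
        · have e : ((1 - 2 * I) * csq p ^ 3).re = x ^ 3 + v * (6 * x ^ 2 - 3 * (x * v) - 2 * v ^ 2) := by
            simp [pow_succ, x, v]; ring
          have hn : ‖(1 - 2 * I : ℂ)‖ ≤ 3 := by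
            refine (norm_sub_le _ _).trans ?_
            simp; norm_num
          rw [e]
          have : 0 ≤ v * (6 * x ^ 2 - 3 * (x * v) - 2 * v ^ 2) := by
            apply mul_nonneg w2
            nlinarith [mul_le_mul_of_nonneg_left hxv w1, mul_le_mul hxv hxv w2 w1]
          nlinarith)
    have e : I * ((z.im + 2 * z.re : ℝ) : ℂ) + (z.re : ℂ) * (1 - 2 * I) = z := by
      apply Complex.ext <;> simp
      ring
    rw [e] at key
    linarith


/-- Zero counting for entire functions with simple zeros. -/
theorem count_zeros {R : ℝ} (hR : 0 < R) (s : Finset ℂ) : ∀ f : ℂ → ℂ, Differentiable ℂ f →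
    (∀ z ∈ Metric.closedBall (0 : ℂ) R, f z = 0 ↔ z ∈ s) →
    (∀ z ∈ s, z ∈ Metric.ball (0 : ℂ) R ∧ deriv f z ≠ 0) →
    (∮ z in C(0, R), deriv f z / f z) = 2 * Real.pi * I * s.card := by
  classical
  induction s using Finset.induction_on with
  | empty =>
    intro f hf h0 _
    simp only [Finset.card_empty, Nat.cast_zero, mul_zero]
    have hne : ∀ z ∈ Metric.closedBall (0 : ℂ) R, f z ≠ 0 := fun z hz h => by
      simpa using (h0 z hz).1 h
    have hd : ∀ z ∈ Metric.closedBall (0 : ℂ) R, DifferentiableAt ℂ (fun z => deriv f z / f z) z :=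
      fun z hz => (hf.deriv z).fun_div (hf z) (hne z hz)
    refine Complex.circleIntegral_eq_zero_of_differentiable_on_off_countable hR.le
      Set.countable_empty (fun z hz => (hd z hz).continuousAt.continuousWithinAt) (fun z hz => ?_)
    exact hd z (Metric.ball_subset_closedBall hz.1)
  | insert p s hp ih =>
    intro f hf h0 hs
    obtain ⟨hpb, hpd⟩ := hs p (Finset.mem_insert_self _ _)
    have hfp : f p = 0 := (h0 p (Metric.ball_subset_closedBall hpb)).2 (Finset.mem_insert_self _ _)
    set g := dslope f p with hg
    have hgd : Differentiable ℂ g := by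
      rw [← differentiableOn_univ]
      exact (Complex.differentiableOn_dslope univ_mem).2 hf.differentiableOn
    have hfg : ∀ z, f z = (z - p) * g z := fun z => by
      have := sub_smul_dslope f p z
      rw [hfp, sub_zero, smul_eq_mul] at this
      exact this.symm
    have hfg' : ∀ z, deriv f z = g z + (z - p) * deriv g z := fun z => by
      have h1 : HasDerivAt (fun z => (z - p) * g z) (1 * g z + (z - p) * deriv g z) z :=
        ((hasDerivAt_id z).sub_const p).fun_mul (hgd z).hasDerivAt
      have h2 : f = fun z => (z - p) * g z := funext hfg
      conv_lhs => rw [h2]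
      rw [h1.deriv, one_mul]
    have hgp : g p ≠ 0 := by
      have := hfg' p
      rw [sub_self, zero_mul, add_zero] at this
      rwa [← this]
    have hps : ∀ q ∈ s, q ≠ p := fun q hq h => hp (h ▸ hq)
    have ihg := ih g hgd (fun z hz => by
      constructor
      · intro hgz
        have : f z = 0 := by rw [hfg, hgz, mul_zero]
        rcases Finset.mem_insert.1 ((h0 z hz).1 this) with rfl | h
        · exact absurd hgz hgp
        · exact h
      · intro hzs
        have : f z = 0 := (h0 z hz).2 (Finset.mem_insert_of_mem hzs)
        rw [hfg] at this
        exact (mul_eq_zero.1 this).resolve_left (sub_ne_zero.2 (hps z hzs))) (fun q hq => by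
      obtain ⟨h1, h2⟩ := hs q (Finset.mem_insert_of_mem hq)
      refine ⟨h1, fun h3 => h2 ?_⟩
      have : f q = 0 := (h0 q (Metric.ball_subset_closedBall h1)).2 (Finset.mem_insert_of_mem hq)
      rw [hfg] at this
      have := (mul_eq_zero.1 this).resolve_left (sub_ne_zero.2 (hps q hq))
      rw [hfg', this, h3]; simp)
    have hfne : ∀ z ∈ Metric.sphere (0 : ℂ) R, f z ≠ 0 := fun z hz h => by
      have h1 := (h0 z (Metric.sphere_subset_closedBall hz)).1 h
      have := (hs z h1).1
      simp only [Metric.mem_ball, Metric.mem_sphere] at this hz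
      linarith
    have hsp : ∀ z ∈ Metric.sphere (0 : ℂ) R, z - p ≠ 0 ∧ g z ≠ 0 := fun z hz => by
      have := hfne z hz
      rw [hfg] at this
      exact ⟨left_ne_zero_of_mul this, right_ne_zero_of_mul this⟩
    have hcongr : (∮ z in C(0, R), deriv f z / f z) = ∮ z in C(0, R), ((z - p)⁻¹ + deriv g z / g z) := by
      refine circleIntegral.integral_congr hR.le fun z hz => ?_
      obtain ⟨h1, h2⟩ := hsp z hz
      simp only [hfg, hfg']
      field_simp
    rw [hcongr, circleIntegral.integral_add, circleIntegral.integral_sub_inv_of_mem_ball hpb, ihg,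
      Finset.card_insert_of_notMem hp]
    · push_cast; ring
    · refine ContinuousOn.circleIntegrable hR.le ?_
      exact ContinuousOn.inv₀ (by fun_prop) fun z hz => (hsp z hz).1
    · refine ContinuousOn.circleIntegrable hR.le ?_
      exact ContinuousOn.div hgd.deriv.continuous.continuousOn hgd.continuous.continuousOn
        fun z hz => (hsp z hz).2

theorem CubSol.isolated {a l : ℝ} {y : ℂ → ℂ} (h : CubSol a l y) (hy : y ≠ 0) (z : ℂ) :
    ∀ᶠ w in nhdsWithin z {z}ᶜ, y w ≠ 0 := by
  by_cases h0 : y z = 0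
  · exact (h.hd z).eventually_ne (h.simple hy h0)
  · exact (h.diff.continuous.continuousAt.eventually_ne h0).filter_mono nhdsWithin_le_nhds

theorem CubSol.finite_zeros {a l : ℝ} {y : ℂ → ℂ} (h : CubSol a l y) (hy : y ≠ 0) (R : ℝ) :
    {z | z ∈ Metric.closedBall (0 : ℂ) R ∧ y z = 0}.Finite := by
  by_contra hinf
  obtain ⟨z, _, hz⟩ := Set.Infinite.exists_accPt_of_subset_isCompact (s := {z | z ∈ Metric.closedBall (0 : ℂ) R ∧ y z = 0})
    hinf (isCompact_closedBall (0 : ℂ) R) (fun z hz => hz.1)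
  rw [accPt_iff_frequently_nhdsNE] at hz
  exact hz ((h.isolated hy z).mono fun w hw hw' => hw hw'.2)

/-- upper half circle integral -/
noncomputable def cJ (y : ℂ → ℂ) (R : ℝ) : ℂ :=
  ∫ θ in (0 : ℝ)..Real.pi, deriv (circleMap 0 R) θ * (deriv y (circleMap 0 R θ) / y (circleMap 0 R θ))

theorem cg_cont {a l R : ℝ} {y : ℂ → ℂ} (h : CubSol a l y)
    (hne : ∀ z ∈ Metric.sphere (0 : ℂ) |R|, y z ≠ 0) :
    Continuous fun θ => deriv (circleMap 0 R) θ * (deriv y (circleMap 0 R θ) / y (circleMap 0 R θ)) := by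
  have h1 : Continuous (fun θ => deriv y (circleMap 0 R θ)) := h.diff'.continuous.comp (continuous_circleMap 0 R)
  have h2 : Continuous (fun θ => y (circleMap 0 R θ)) := h.diff.continuous.comp (continuous_circleMap 0 R)
  have h3 : Continuous (deriv (circleMap 0 R)) := by
    have : deriv (circleMap 0 R) = fun θ => circleMap 0 R θ * I := by
      funext θ; exact deriv_circleMap 0 R θ
    rw [this]
    exact (continuous_circleMap 0 R).mul continuous_const
  exact h3.mul (h1.div h2 fun θ => hne _ (circleMap_mem_sphere' 0 R θ))

theorem circleMap_refl (R θ : ℝ) : circleMap 0 R (2 * Real.pi - θ) = (starRingEnd ℂ) (circleMap 0 R θ) := by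
  simp only [circleMap, zero_add, map_mul, conj_ofReal, ← exp_conj, conj_I]
  congr 1
  have : (((2 * Real.pi - θ : ℝ) : ℂ) * I) = θ * (-I) + 2 * Real.pi * I := by push_cast; ring
  rw [this, exp_periodic]

theorem cJ_im {a l R : ℝ} {y : ℂ → ℂ} (h : RealSol a l y) (hR : 0 < R)
    (hne : ∀ z ∈ Metric.sphere (0 : ℂ) R, y z ≠ 0) (s : Finset ℂ)
    (hs : ∀ z, z ∈ s ↔ z ∈ Metric.ball (0 : ℂ) R ∧ y z = 0) :
    (cJ y R).im = Real.pi * s.card := by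
  have hc := count_zeros hR s y h.sol.diff (fun z hz => by
    rw [hs]
    constructor
    · intro h0
      refine ⟨?_, h0⟩
      by_contra hb
      refine hne z ?_ h0
      simp only [Metric.mem_closedBall, Metric.mem_ball, Metric.mem_sphere] at *
      linarith
    · exact fun h => h.2) (fun z hz => by
      rw [hs] at hz
      exact ⟨hz.1, h.sol.simple h.ne hz.2⟩)
  set g := fun θ => deriv (circleMap 0 R) θ * (deriv y (circleMap 0 R θ) / y (circleMap 0 R θ)) with hg
  have hgc : Continuous g := cg_cont h.sol (by rwa [abs_of_pos hR])
  have hcircInt : (∮ z in C(0, R), deriv y z / y z) = ∫ θ in (0 : ℝ)..(2 * Real.pi), g θ := by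
    simp only [circleIntegral, smul_eq_mul, hg]
  have hsplit : (∫ θ in (0 : ℝ)..(2 * Real.pi), g θ) = cJ y R + ∫ θ in Real.pi..(2 * Real.pi), g θ :=
    (intervalIntegral.integral_add_adjacent_intervals (hgc.intervalIntegrable _ _)
      (hgc.intervalIntegrable _ _)).symm
  have hrefl : ∀ θ, g (2 * Real.pi - θ) = - (starRingEnd ℂ) (g θ) := by
    intro θ
    simp only [hg, deriv_circleMap, circleMap_refl, map_mul, map_div₀, conj_I]
    have e1 := h.real (circleMap 0 R θ)
    have e2 := h.real' (circleMap 0 R θ)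
    rw [← e1, ← e2, conj_conj, conj_conj]
    ring
  have hsecond : (∫ θ in Real.pi..(2 * Real.pi), g θ) = - (starRingEnd ℂ) (cJ y R) := by
    have h1 := intervalIntegral.integral_comp_sub_left (a := 0) (b := Real.pi) g (2 * Real.pi)
    rw [show 2 * Real.pi - Real.pi = Real.pi by ring, sub_zero] at h1
    rw [← h1]
    simp only [hrefl]
    rw [intervalIntegral.integral_neg]
    congr 1
    have := ContinuousLinearMap.intervalIntegral_comp_comm (conjCLE : ℂ →L[ℝ] ℂ) (hgc.intervalIntegrable 0 Real.pi (μ := MeasureTheory.volume))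
    exact this
  rw [hcircInt, hsplit, hsecond] at hc
  have := congrArg im hc
  simp at this
  linarith


noncomputable def cm (a : ℝ) (z : ℂ) : ℂ := cB a z + cr z - cB' a z / cB a z

noncomputable def cq (a l : ℝ) (z : ℂ) : ℂ := l - a ^ 2 / (4 * z) - 21 / (16 * z ^ 2) + a / csq z ^ 3

noncomputable def cG (a : ℝ) (y : ℂ → ℂ) (z : ℂ) : ℂ := log (1 + cY y z / cZ a y z)

theorem cG_alg (B Bp β γ r y y1 Y Z e Yp T : ℂ) (hy : y ≠ 0) (hB : B ≠ 0) (hT : T = Y / Z) (hT1 : 1 + T ≠ 0)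
    (hY : Y = y1 + r * y) (hZ : Z = B * y) (hZp : Bp * y + B * y1 = B * Y + β * Z)
    (hYp : Yp = B * Z + γ * Z + r * Y) :
    ((Yp * e) * Z - Y * ((Bp * y + B * y1) * e)) / Z ^ 2 / (1 + T)
      = e * (B + r - Bp / B - y1 / y + (γ + β - r) / (1 + T)) := by
  have hZ0 : Z ≠ 0 := by rw [hZ]; exact mul_ne_zero hB hy
  have hYT : Y = T * Z := by rw [hT]; field_simp
  have hy1 : y1 = (T * B - r) * y := by
    rw [hYT, hZ] at hY; linear_combination -hY
  have hBp : Bp = B * r + β * B := by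
    have : (Bp - (B * r + β * B)) * y = 0 := by
      rw [hY, hZ] at hZp; linear_combination hZp
    have := (mul_eq_zero.1 this).resolve_right hy
    linear_combination this
  rw [hZp, hYp, hYT, hBp, hy1]
  clear hT hYT hY hy1 hBp hZp hYp
  have e1 : (((B * Z + γ * Z + r * (T * Z)) * e * Z - T * Z * ((B * (T * Z) + β * Z) * e)) / Z ^ 2)
     = e * (B + γ + r * T - B * T ^ 2 - β * T) := by field_simp; ring
  have e2 : (B * r + β * B) / B = r + β := by field_simp
  have e3 : (T * B - r) * y / y = T * B - r := by field_simp
  rw [e1, e2, e3]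
  field_simp
  ring

theorem cE_re {a : ℝ} {y : ℂ → ℂ} {z : ℂ} (hZ : cZ a y z ≠ 0) :
    (cY y z / cZ a y z).re = cE a y z / ‖cZ a y z‖ ^ 2 := by
  rw [div_eq_mul_inv, Complex.inv_def, ← mul_assoc, re_mul_ofReal, normSq_eq_norm_sq]
  unfold cE
  rw [div_eq_mul_inv]
  congr 1
  simp; ring

theorem cT_re {a : ℝ} {y : ℂ → ℂ} {z : ℂ} (hZ : cZ a y z ≠ 0) (hE : 0 ≤ cE a y z) :
    1 ≤ (1 + cY y z / cZ a y z).re := by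
  rw [add_re, one_re, cE_re hZ]
  have : 0 ≤ cE a y z / ‖cZ a y z‖ ^ 2 := by positivity
  linarith

theorem cG_hasDerivAt {a l : ℝ} {y : ℂ → ℂ} (h : CubSol a l y) {z : ℝ → ℂ} {e : ℂ} {s : ℝ}
    (hz : HasDerivAt z e s) (him : 0 ≤ (z s).im) (hbig : 1 + |a| ≤ ‖csq (z s)‖) (h0 : z s ≠ 0)
    (hy : y (z s) ≠ 0) (hE : 0 ≤ cE a y (z s)) :
    ∃ q, HasDerivAt (fun s => cG a y (z s)) (e * (cm a (z s) - deriv y (z s) / y (z s) + q)) s ∧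
      ‖q‖ ≤ 2 * (|l| + a ^ 2 + 2 + |a|) / ‖csq (z s)‖ ^ 3 := by
  set w := csq (z s) with hw
  have hw0 : w ≠ 0 := csq_ne
  have hww : w ^ 2 = z s := csq_sq h0
  have ha := abs_nonneg a
  have hw1 : 1 ≤ ‖w‖ := by linarith
  obtain ⟨hB3, hB1⟩ := cB_norm_lower (a := a) (z := z s) hbig
  rw [← hw] at hB3 hB1
  have hBne : cB a (z s) ≠ 0 := by
    rw [← norm_pos_iff]; linarith
  have hz1 : 1 ≤ ‖z s‖ := by rw [← hww, norm_pow]; nlinarith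
  obtain ⟨alg1, alg2⟩ := cub_alg a l (z s) w (y (z s)) (deriv y (z s)) hw0 hww hBne
  have hBd := (cB_hasDerivAt a him h0)
  have hZd : HasDerivAt (fun s => cZ a y (z s))
      ((cB' a (z s) * y (z s) + cB a (z s) * deriv y (z s)) * e) s :=
    (hBd.fun_mul (h.hd (z s))).comp s hz
  have hYd : HasDerivAt (fun s => cY y (z s))
      ((((z s) ^ 3 - a * z s + l) * y (z s) +
        ((-3 / (4 * (z s) ^ 2)) * y (z s) + cr (z s) * deriv y (z s))) * e) s :=
    ((h.hd' (z s)).fun_add ((cr_hasDerivAt h0).fun_mul (h.hd (z s)))).comp s hz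
  have hZne : cZ a y (z s) ≠ 0 := mul_ne_zero hBne hy
  have hre := cT_re hZne hE
  have hslit : 1 + cY y (z s) / cZ a y (z s) ∈ slitPlane := by
    rw [mem_slitPlane_iff]; left; linarith
  have hG := ((hYd.fun_div hZd hZne).const_add 1).clog_real hslit
  have key := cG_alg (cB a (z s)) (cB' a (z s)) _ _ (cr (z s)) (y (z s)) (deriv y (z s)) (cY y (z s)) (cZ a y (z s)) e
    _ _ hy hBne rfl (slitPlane_ne_zero hslit) rfl rfl alg1 alg2
  refine ⟨_, hG.congr_deriv key, ?_⟩
  have hq : (((l : ℂ) - a ^ 2 / (4 * z s) - 21 / (16 * z s ^ 2)) / (w ^ 3 - a / (2 * w)) +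
      (3 / 4 * w + 5 * a / (8 * w ^ 3)) / (w ^ 3 - a / (2 * w)) - cr (z s)) = cq a l (z s) / cB a (z s) := by
    have hB' : cB a (z s) = w ^ 3 - a / (2 * w) := rfl
    rw [← hB']
    have : cr (z s) = (cr (z s) * cB a (z s)) / cB a (z s) := by field_simp
    rw [this, ← add_div, ← sub_div]
    congr 1
    rw [hB', cq, cr, ← hw, ← hww]
    field_simp
    ring
  rw [hq]
  have hqb : ‖cq a l (z s)‖ ≤ |l| + a ^ 2 + 2 + |a| := by
    have h5 : ‖(a : ℂ) ^ 2 / (4 * z s)‖ ≤ a ^ 2 := by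
      have := norm_div_le_of (x := (a : ℂ) ^ 2) (y := 4 * z s) (c := a ^ 2) (d := 1) (by norm_num)
        (by simp) (by rw [norm_mul]; simp; linarith)
      simpa using this
    have h6 : ‖21 / (16 * (z s) ^ 2)‖ ≤ 2 := by
      have := norm_div_le_of (x := 21) (y := 16 * (z s) ^ 2) (c := 21) (d := 16) (by norm_num)
        (by simp) (by rw [norm_mul, norm_pow]; simp; nlinarith)
      linarith
    have h8 : ‖(a : ℂ) / w ^ 3‖ ≤ |a| := by
      have := norm_div_le_of (x := (a : ℂ)) (y := w ^ 3) (c := |a|) (d := 1) (by norm_num)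
        (by simp) (by rw [norm_pow]; exact one_le_pow₀ hw1)
      simpa using this
    unfold cq
    refine (norm_add_le _ _).trans (add_le_add ?_ h8)
    refine (norm_sub_le _ _).trans (add_le_add ((norm_sub_le _ _).trans (add_le_add ?_ h5)) h6)
    simp
  have h1 : ‖cq a l (z s) / cB a (z s)‖ ≤ (|l| + a ^ 2 + 2 + |a|) / (‖w‖ ^ 3 / 2) :=
    norm_div_le_of (by positivity) hqb hB3
  have h2 : 1 ≤ ‖1 + cY y (z s) / cZ a y (z s)‖ := hre.trans (re_le_norm _)
  have h3 := norm_div_le_of one_pos h1 h2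
  have e3 : (|l| + a ^ 2 + 2 + |a|) / (‖w‖ ^ 3 / 2) / 1 = 2 * (|l| + a ^ 2 + 2 + |a|) / ‖w‖ ^ 3 := by
    field_simp
  rw [← e3]
  exact h3


theorem arg_le_quarter {z : ℂ} (h1 : 0 < z.re) (h2 : z.im ≤ z.re) : arg z ≤ Real.pi / 4 := by
  rw [arg_of_re_nonneg h1.le]
  have hs : z.im / ‖z‖ ≤ Real.sin (Real.pi / 4) := by
    rw [Real.sin_pi_div_four]
    have hz : 0 < ‖z‖ := norm_pos_iff.2 fun h => by simp [h] at h1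
    rw [div_le_iff₀ hz]
    by_cases h0 : z.im ≤ 0
    · have : 0 ≤ √2 / 2 * ‖z‖ := by positivity
      linarith
    · push Not at h0
      refine le_of_sq_le_sq ?_ (by positivity)
      rw [mul_pow, div_pow, Real.sq_sqrt (by norm_num), Complex.sq_norm, normSq_apply]
      nlinarith
  refine (Real.arcsin_le_arcsin hs).trans ?_
  rw [Real.arcsin_sin] <;> linarith [Real.pi_pos]

theorem RealSol.onCircle {a l R : ℝ} {y : ℂ → ℂ} (h : RealSol a l y) (hR : 0 < R)
    (hreg : ∀ z : ℂ, R ≤ ‖z‖ → 0 ≤ z.im → (0 < z.im ∨ 0 < z.re) → 0 < cE a y z)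
    (hne : y ((-R : ℝ) : ℂ) ≠ 0) (z : ℂ) (hz : ‖z‖ = R) (him : 0 ≤ z.im) : y z ≠ 0 ∧ 0 ≤ cE a y z := by
  by_cases hc : 0 < z.im ∨ 0 < z.re
  · have := hreg z hz.ge him hc
    refine ⟨fun h0 => ?_, this.le⟩
    simp [cE, cZ, h0] at this
  · push Not at hc
    have h0 : z.im = 0 := le_antisymm hc.1 him
    have e : z = ((-R : ℝ) : ℂ) := by
      have : z = (z.re : ℂ) := by apply Complex.ext <;> simp [h0]
      rw [this]
      rw [this, norm_real, Real.norm_eq_abs, abs_of_nonpos hc.2] at hz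
      congr 1; linarith
    rw [e]
    exact ⟨hne, (h.cE_neg (by linarith)).ge⟩

theorem RealSol.onSphere {a l R : ℝ} {y : ℂ → ℂ} (h : RealSol a l y) (hR : 0 < R)
    (hreg : ∀ z : ℂ, R ≤ ‖z‖ → 0 ≤ z.im → (0 < z.im ∨ 0 < z.re) → 0 < cE a y z)
    (hne : y ((-R : ℝ) : ℂ) ≠ 0) (z : ℂ) (hz : z ∈ Metric.sphere (0 : ℂ) R) : y z ≠ 0 := by
  rw [mem_sphere_zero_iff_norm] at hz
  rcases le_total 0 z.im with hi | hi
  · exact (h.onCircle hR hreg hne z hz hi).1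
  · have := (h.onCircle hR hreg hne ((starRingEnd ℂ) z) (by rwa [norm_conj]) (by simpa using hi)).1
    rw [← h.real z]
    simpa using this

theorem RealSol.cG_pos_im {a l R : ℝ} {y : ℂ → ℂ} (h : RealSol a l y) (hR : 0 < R)
    (hE : 0 ≤ cE a y (R : ℂ)) (hZ : cZ a y R ≠ 0) : (cG a y (R : ℂ)).im = 0 := by
  have h1 := h.cY_im R
  have h2 : (cZ a y R).im = 0 := by
    unfold cZ; simp [h.im_zero R, cB_pos hR]
  have h3 : (1 + cY y R / cZ a y R).im = 0 := by
    simp [div_im, h1, h2]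
  have h4 := cT_re hZ hE
  unfold cG
  rw [log_im, arg_eq_zero_iff]
  exact ⟨by linarith, h3⟩

theorem index_bound {a l1 l2 : ℝ} {y1 y2 : ℂ → ℂ} (h1 : RealSol a l1 y1) (h2 : RealSol a l2 y2) :
    ∃ R0 : ℝ, 0 < R0 ∧ ∀ R, R0 ≤ R → y1 ((-R : ℝ) : ℂ) ≠ 0 → y2 ((-R : ℝ) : ℂ) ≠ 0 →
      ‖cY y1 ((-R : ℝ) : ℂ)‖ ≤ ‖cZ a y1 ((-R : ℝ) : ℂ)‖ →
      ∀ s1 s2 : Finset ℂ, (∀ z, z ∈ s1 ↔ z ∈ Metric.ball (0 : ℂ) R ∧ y1 z = 0) →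
        (∀ z, z ∈ s2 ↔ z ∈ Metric.ball (0 : ℂ) R ∧ y2 z = 0) → s2.card < s1.card + 1 := by
  obtain ⟨R1, hR1, reg1⟩ := h1.region
  obtain ⟨R2, hR2, reg2⟩ := h2.region
  set K1 := 2 * (|l1| + a ^ 2 + 2 + |a|) with hK1
  set K2 := 2 * (|l2| + a ^ 2 + 2 + |a|) with hK2
  have hK1' : 0 ≤ K1 := by positivity
  have hK2' : 0 ≤ K2 := by positivity
  have h8 := cT_ge a l1
  have h8' := cT_ge a l2
  refine ⟨R1 + R2 + (8 * (K1 + K2)) ^ 2, by nlinarith [sq_nonneg (8 * (K1 + K2))], fun R hR hn1 hn2 hYZ s1 s2 hs1 hs2 => ?_⟩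
  have hR0 : 0 < R := by nlinarith
  have hRR1 : R1 ≤ R := by nlinarith
  have hRR2 : R2 ≤ R := by nlinarith
  have hRK : (8 * (K1 + K2)) ^ 2 ≤ R := by linarith
  have reg1' : ∀ z : ℂ, R ≤ ‖z‖ → 0 ≤ z.im → (0 < z.im ∨ 0 < z.re) → 0 < cE a y1 z :=
    fun z hz => reg1 z (hRR1.trans hz)
  have reg2' : ∀ z : ℂ, R ≤ ‖z‖ → 0 ≤ z.im → (0 < z.im ∨ 0 < z.re) → 0 < cE a y2 z :=
    fun z hz => reg2 z (hRR2.trans hz)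
  have sp1 := h1.onSphere hR0 reg1' hn1
  have sp2 := h2.onSphere hR0 reg2' hn2
  have j1 := cJ_im h1 hR0 sp1 s1 hs1
  have j2 := cJ_im h2 hR0 sp2 s2 hs2
  have big : ∀ z : ℂ, ‖z‖ = R → 1 + |a| ≤ ‖csq z‖ := fun z hz => by
    have hz0 : z ≠ 0 := fun h => by rw [h, norm_zero] at hz; linarith
    have := csq_big (a := a) (l := l1) hz0 (by linarith)
    linarith [cC_abs a l1]
  have Zne1 : ∀ z : ℂ, ‖z‖ = R → 0 ≤ z.im → cZ a y1 z ≠ 0 := fun z hz him => by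
    have := big z hz
    have := (cB_norm_lower (a := a) (big z hz)).2
    have hB : cB a z ≠ 0 := norm_pos_iff.1 (by linarith [abs_nonneg a])
    exact mul_ne_zero hB (h1.onCircle hR0 reg1' hn1 z hz him).1
  have Zne2 : ∀ z : ℂ, ‖z‖ = R → 0 ≤ z.im → cZ a y2 z ≠ 0 := fun z hz him => by
    have := big z hz
    have := (cB_norm_lower (a := a) (big z hz)).2
    have hB : cB a z ≠ 0 := norm_pos_iff.1 (by linarith [abs_nonneg a])
    exact mul_ne_zero hB (h2.onCircle hR0 reg2' hn2 z hz him).1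
  set g1 := fun θ => deriv (circleMap 0 R) θ * (deriv y1 (circleMap 0 R θ) / y1 (circleMap 0 R θ)) with hg1
  set g2 := fun θ => deriv (circleMap 0 R) θ * (deriv y2 (circleMap 0 R θ) / y2 (circleMap 0 R θ)) with hg2
  have g1c : Continuous g1 := cg_cont h1.sol (by rwa [abs_of_pos hR0])
  have g2c : Continuous g2 := cg_cont h2.sol (by rwa [abs_of_pos hR0])
  set F : ℝ → ℂ := fun θ => ((∫ t in (0 : ℝ)..θ, g2 t) - (∫ t in (0 : ℝ)..θ, g1 t)) +
    (cG a y2 (circleMap 0 R θ) - cG a y1 (circleMap 0 R θ)) with hF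
  have hder : ∀ θ ∈ Set.Icc 0 Real.pi, ∃ D, HasDerivAt F D θ ∧ ‖D‖ ≤ 1 / 8 := by
    intro θ hθ
    have hz := hasDerivAt_circleMap 0 R θ
    have hnorm : ‖circleMap 0 R θ‖ = R := by simp [abs_of_pos hR0]
    have hzne : circleMap 0 R θ ≠ 0 := fun h => by rw [h, norm_zero] at hnorm; linarith
    have him : 0 ≤ (circleMap 0 R θ).im := by
      have : (circleMap 0 R θ).im = R * Real.sin θ := by
        simp [circleMap, exp_ofReal_mul_I_im]
      rw [this]
      exact mul_nonneg hR0.le (Real.sin_nonneg_of_mem_Icc hθ)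
    obtain ⟨c1, E1⟩ := h1.onCircle hR0 reg1' hn1 _ hnorm him
    obtain ⟨c2, E2⟩ := h2.onCircle hR0 reg2' hn2 _ hnorm him
    obtain ⟨q1, d1, b1⟩ := cG_hasDerivAt h1.sol hz him (big _ hnorm) hzne c1 E1
    obtain ⟨q2, d2, b2⟩ := cG_hasDerivAt h2.sol hz him (big _ hnorm) hzne c2 E2
    have i1 := (g1c.integral_hasStrictDerivAt 0 θ).hasDerivAt
    have i2 := (g2c.integral_hasStrictDerivAt 0 θ).hasDerivAt
    refine ⟨circleMap 0 R θ * I * (q2 - q1), ((i2.fun_sub i1).fun_add (d2.fun_sub d1)).congr_deriv ?_, ?_⟩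
    · simp only [hg1, hg2, deriv_circleMap]; ring
    · have hw2 := csq_norm hzne
      rw [hnorm] at hw2
      set w := csq (circleMap 0 R θ)
      have hw1 : 1 ≤ ‖w‖ := by linarith [big _ hnorm, abs_nonneg a]
      have hwK : 8 * (K1 + K2) ≤ ‖w‖ := by
        refine le_of_sq_le_sq ?_ (norm_nonneg _)
        rw [hw2]; exact hRK
      rw [norm_mul, norm_mul, norm_I, mul_one, hnorm, ← hw2]
      have : ‖q2 - q1‖ ≤ (K2 + K1) / ‖w‖ ^ 3 := by
        rw [add_div]
        exact (norm_sub_le _ _).trans (add_le_add b2 b1)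
      calc ‖w‖ ^ 2 * ‖q2 - q1‖ ≤ ‖w‖ ^ 2 * ((K2 + K1) / ‖w‖ ^ 3) := by gcongr
        _ = (K2 + K1) / ‖w‖ := by field_simp
        _ ≤ 1 / 8 := by
          rw [div_le_div_iff₀ (by linarith) (by norm_num)]; linarith
  choose! D hD hDb using hder
  have hmv := norm_image_sub_le_of_norm_deriv_le_segment' (f := F) (f' := D) (C := 1 / 8) (a := 0) (b := Real.pi)
    (fun θ hθ => (hD θ hθ).hasDerivWithinAt) (fun θ hθ => hDb θ ⟨hθ.1, hθ.2.le⟩) Real.pi ⟨Real.pi_pos.le, le_rfl⟩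
  have z0 : circleMap 0 R 0 = (R : ℂ) := by simp [circleMap]
  have zp : circleMap 0 R Real.pi = ((-R : ℝ) : ℂ) := by simp [circleMap]
  have hF0 : F 0 = cG a y2 R - cG a y1 R := by simp [hF, z0]
  have hFp : F Real.pi = (cJ y2 R - cJ y1 R) + (cG a y2 ((-R : ℝ) : ℂ) - cG a y1 ((-R : ℝ) : ℂ)) := by
    simp only [hF, zp]; rfl
  have nR : ‖(R : ℂ)‖ = R := by simp [abs_of_pos hR0]
  have nR' : ‖((-R : ℝ) : ℂ)‖ = R := by simp [abs_of_pos hR0]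
  have im1 := h1.cG_pos_im hR0 (h1.onCircle hR0 reg1' hn1 _ nR (by simp)).2 (Zne1 _ nR (by simp))
  have im2 := h2.cG_pos_im hR0 (h2.onCircle hR0 reg2' hn2 _ nR (by simp)).2 (Zne2 _ nR (by simp))
  have him := (abs_le.1 ((abs_im_le_norm _).trans hmv)).2
  rw [hFp, hF0] at him
  simp only [sub_im, add_im, im1, im2, j1, j2] at him
  have a2 : -(Real.pi / 2) < (cG a y2 ((-R : ℝ) : ℂ)).im := by
    unfold cG
    rw [log_im]
    have := cT_re (Zne2 _ nR' (by simp)) (h2.onCircle hR0 reg2' hn2 _ nR' (by simp)).2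
    exact (abs_lt.1 (abs_arg_lt_pi_div_two_iff.2 (Or.inl (by linarith)))).1
  have a1 : (cG a y1 ((-R : ℝ) : ℂ)).im ≤ Real.pi / 4 := by
    unfold cG
    rw [log_im]
    have hre := cT_re (Zne1 _ nR' (by simp)) (h1.onCircle hR0 reg1' hn1 _ nR' (by simp)).2
    refine arg_le_quarter (by linarith) (le_trans ?_ hre)
    rw [add_im, one_im, zero_add]
    refine (im_le_norm _).trans ?_
    rw [norm_div]
    exact div_le_one_of_le₀ hYZ (norm_nonneg _)
  have hpi := Real.pi_pos
  have hfin : Real.pi * (s2.card : ℝ) < Real.pi * ((s1.card : ℝ) + 1) := by linarith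
  have := lt_of_mul_lt_mul_left hfin hpi.le
  exact_mod_cast this


theorem RealSol.re_hd {a l : ℝ} {y : ℂ → ℂ} (h : RealSol a l y) (x : ℝ) :
    HasDerivAt (fun x : ℝ => (y x).re) ((deriv y x).re) x := (h.sol.hd x).real_of_complex

theorem RealSol.re_hd' {a l : ℝ} {y : ℂ → ℂ} (h : RealSol a l y) (x : ℝ) :
    HasDerivAt (fun x : ℝ => (deriv y x).re) ((x ^ 3 - a * x + l) * (y x).re) x := by
  refine (h.sol.hd' x).real_of_complex.congr_deriv ?_
  have : ((x : ℂ) ^ 3 - a * x + l) = ((x ^ 3 - a * x + l : ℝ) : ℂ) := by push_cast; rfl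
  rw [this, re_ofReal_mul]

theorem sign_const {f : ℝ → ℝ} (hf : Continuous f) {s : Set ℝ} (hs : IsPreconnected s)
    (hne : ∀ x ∈ s, f x ≠ 0) : (∀ x ∈ s, 0 < f x) ∨ (∀ x ∈ s, f x < 0) := by
  by_contra! hcon
  obtain ⟨⟨x, hx, hx'⟩, ⟨z, hz, hz'⟩⟩ := hcon
  obtain ⟨w, hw, hw'⟩ := hs.intermediate_value hx hz hf.continuousOn ⟨hx', hz'⟩
  exact hne w hw hw'

theorem deriv_right_nonneg {f : ℝ → ℝ} {p q D : ℝ} (hpq : p < q) (hD : HasDerivAt f D p) (h0 : f p = 0)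
    (hpos : ∀ x ∈ Set.Ioo p q, 0 < f x) : 0 ≤ D := by
  have h1 := (hasDerivAt_iff_tendsto_slope.1 hD).mono_left (nhdsWithin_mono p (show Set.Ioi p ⊆ {p}ᶜ from fun x hx => ne_of_gt hx))
  refine ge_of_tendsto h1 ?_
  filter_upwards [Ioo_mem_nhdsGT hpq] with x hx
  rw [slope_def_field, h0, sub_zero]
  exact div_nonneg (hpos x hx).le (by linarith [hx.1])

theorem deriv_left_nonpos {f : ℝ → ℝ} {p q D : ℝ} (hpq : p < q) (hD : HasDerivAt f D q) (h0 : f q = 0)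
    (hpos : ∀ x ∈ Set.Ioo p q, 0 < f x) : D ≤ 0 := by
  have h1 := (hasDerivAt_iff_tendsto_slope.1 hD).mono_left (nhdsWithin_mono q (show Set.Iio q ⊆ {q}ᶜ from fun x hx => ne_of_lt hx))
  refine le_of_tendsto h1 ?_
  filter_upwards [Ioo_mem_nhdsLT hpq] with x hx
  rw [slope_def_field, h0, sub_zero]
  exact div_nonpos_of_nonneg_of_nonpos (hpos x hx).le (by linarith [hx.2])

theorem sturm_pos {a l1 l2 p q : ℝ} {f1 f1' f2 f2' : ℝ → ℝ} (hl : l2 < l1) (hpq : p < q)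
    (d1 : ∀ x, HasDerivAt f1 (f1' x) x) (d1' : ∀ x, HasDerivAt f1' ((x ^ 3 - a * x + l1) * f1 x) x)
    (d2 : ∀ x, HasDerivAt f2 (f2' x) x) (d2' : ∀ x, HasDerivAt f2' ((x ^ 3 - a * x + l2) * f2 x) x)
    (hp : f1 p = 0) (hq : f1 q = 0) (h1 : ∀ x ∈ Set.Ioo p q, 0 < f1 x)
    (h2 : ∀ x ∈ Set.Ioo p q, 0 < f2 x) : False := by
  have hW : ∀ x, HasDerivAt (fun x => f1 x * f2' x - f1' x * f2 x) ((l2 - l1) * (f1 x * f2 x)) x := fun x =>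
    (((d1 x).fun_mul (d2' x)).fun_sub ((d1' x).fun_mul (d2 x))).congr_deriv (by ring)
  have hcl : ∀ x ∈ Set.Icc p q, 0 ≤ f2 x := by
    have : Set.Icc p q ⊆ {x | 0 ≤ f2 x} := by
      rw [← closure_Ioo hpq.ne]
      refine closure_minimal (fun x hx => (h2 x hx).le) ?_
      exact isClosed_le continuous_const (continuous_iff_continuousAt.2 fun x => (d2 x).continuousAt)
    exact this
  have hanti := strictAntiOn_of_deriv_neg (convex_Icc p q)
    (fun x _ => (hW x).continuousAt.continuousWithinAt) (fun x hx => by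
      rw [interior_Icc] at hx
      rw [(hW x).deriv]
      have := mul_pos (h1 x hx) (h2 x hx)
      nlinarith)
  have hlt := hanti (Set.left_mem_Icc.2 hpq.le) (Set.right_mem_Icc.2 hpq.le) hpq
  simp only [hp, hq] at hlt
  have e1 := deriv_right_nonneg hpq (d1 p) hp h1
  have e2 := deriv_left_nonpos hpq (d1 q) hq h1
  have e3 := hcl p (Set.left_mem_Icc.2 hpq.le)
  have e4 := hcl q (Set.right_mem_Icc.2 hpq.le)
  nlinarith [mul_nonneg e1 e3, mul_nonneg (neg_nonneg.2 e2) e4]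

theorem sturm {a l1 l2 p q : ℝ} {f1 f1' f2 f2' : ℝ → ℝ} (hl : l2 < l1) (hpq : p < q)
    (d1 : ∀ x, HasDerivAt f1 (f1' x) x) (d1' : ∀ x, HasDerivAt f1' ((x ^ 3 - a * x + l1) * f1 x) x)
    (d2 : ∀ x, HasDerivAt f2 (f2' x) x) (d2' : ∀ x, HasDerivAt f2' ((x ^ 3 - a * x + l2) * f2 x) x)
    (hp : f1 p = 0) (hq : f1 q = 0) (h1 : ∀ x ∈ Set.Ioo p q, f1 x ≠ 0) :
    ∃ x ∈ Set.Ioo p q, f2 x = 0 := by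
  by_contra! hcon
  have c1 : Continuous f1 := continuous_iff_continuousAt.2 fun x => (d1 x).continuousAt
  have c2 : Continuous f2 := continuous_iff_continuousAt.2 fun x => (d2 x).continuousAt
  have n1 : ∀ x, HasDerivAt (fun x => - f1 x) (- f1' x) x := fun x => (d1 x).fun_neg
  have n1' : ∀ x, HasDerivAt (fun x => - f1' x) ((x ^ 3 - a * x + l1) * (- f1 x)) x :=
    fun x => (d1' x).fun_neg.congr_deriv (by ring)
  have n2 : ∀ x, HasDerivAt (fun x => - f2 x) (- f2' x) x := fun x => (d2 x).fun_neg
  have n2' : ∀ x, HasDerivAt (fun x => - f2' x) ((x ^ 3 - a * x + l2) * (- f2 x)) x :=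
    fun x => (d2' x).fun_neg.congr_deriv (by ring)
  rcases sign_const c1 isPreconnected_Ioo h1 with s1 | s1 <;>
  rcases sign_const c2 isPreconnected_Ioo hcon with s2 | s2
  · exact sturm_pos hl hpq d1 d1' d2 d2' hp hq s1 s2
  · exact sturm_pos hl hpq d1 d1' n2 n2' hp hq s1 (fun x hx => neg_pos.2 (s2 x hx))
  · exact sturm_pos hl hpq n1 n1' d2 d2' (by simp [hp]) (by simp [hq]) (fun x hx => neg_pos.2 (s1 x hx)) s2
  · exact sturm_pos hl hpq n1 n1' n2 n2' (by simp [hp]) (by simp [hq]) (fun x hx => neg_pos.2 (s1 x hx))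
      (fun x hx => neg_pos.2 (s2 x hx))

theorem cQ_le {a l x : ℝ} (hx : x ≤ -(2 + |a| + |l|)) : x ^ 3 - a * x + l ≤ -1 := by
  have ha := abs_nonneg a
  have hl := abs_nonneg l
  have ha' := neg_abs_le a
  have ha'' := le_abs_self a
  have hl' := le_abs_self l
  obtain ⟨t, rfl⟩ : ∃ t, x = -t := ⟨-x, by ring⟩
  have ht : 2 + |a| + |l| ≤ t := by linarith
  have h1 : t * (2 + |a| + |l|) ≤ t * t := mul_le_mul_of_nonneg_left ht (by linarith)
  have h2 : t * t * 1 ≤ t * t * t := mul_le_mul_of_nonneg_left (by linarith) (mul_self_nonneg t)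
  have h3 : a * t ≤ |a| * t := mul_le_mul_of_nonneg_right ha'' (by linarith)
  have h4 : |l| * 1 ≤ |l| * t := mul_le_mul_of_nonneg_left (by linarith) hl
  nlinarith

theorem osc_pos {a l X : ℝ} {f f' : ℝ → ℝ} (hX : 2 + |a| + |l| ≤ X)
    (d : ∀ x, HasDerivAt f (f' x) x) (d' : ∀ x, HasDerivAt f' ((x ^ 3 - a * x + l) * f x) x)
    (hpos : ∀ x ∈ Set.Iic (-X), 0 < f' x) : False := by
  by_cases hex : ∃ x1 ≤ -X, f x1 < 0
  · obtain ⟨x1, hx1, hf1⟩ := hex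
    have hle : ∀ x ≤ x1, f x ≤ f x1 := by
      intro x hx
      have := mvt_le (f := fun t => - f t) (c := 0) hx (fun s hs =>
        ⟨_, (d s).fun_neg, by linarith [hpos s (show s ≤ -X by linarith [hs.2])]⟩)
      linarith
    set c := - f x1 with hc
    have hc0 : 0 < c := by linarith
    set x := x1 - f' x1 / c with hxdef
    have hp1 := hpos x1 hx1
    have hxx : x ≤ x1 := by
      have : 0 ≤ f' x1 / c := by positivity
      linarith
    have := mvt_le (f := fun t => - f' t) (c := -c) hxx (fun s hs => by
      refine ⟨_, (d' s).fun_neg, ?_⟩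
      have h1 := cQ_le (a := a) (l := l) (x := s) (by linarith [hs.2])
      have h2 := hle s hs.2
      nlinarith)
    have e : -c * (x1 - x) = - f' x1 := by rw [hxdef]; field_simp; ring
    have := hpos x (show x ≤ -X by linarith)
    linarith
  · push Not at hex
    have hp1 := hpos (-X) (Set.mem_Iic.2 le_rfl)
    have hge : ∀ x ≤ -X, f' (-X) ≤ f' x := by
      intro x hx
      have := mvt_le (f := f') (c := 0) hx (fun s hs => by
        refine ⟨_, d' s, ?_⟩
        have h1 := cQ_le (a := a) (l := l) (x := s) (by linarith [hs.2])
        have h2 := hex s hs.2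
        nlinarith)
      linarith
    set m := f' (-X) with hm
    have hf0 := hex (-X) le_rfl
    set x := -X - (f (-X) + 1) / m with hxdef
    have hxx : x ≤ -X := by
      have : 0 ≤ (f (-X) + 1) / m := by positivity
      linarith
    have := mvt_le (f := fun t => - f t) (c := -m) hxx (fun s hs =>
      ⟨_, (d s).fun_neg, by linarith [hge s hs.2]⟩)
    have e : -m * (-X - x) = - (f (-X) + 1) := by rw [hxdef]; field_simp; ring
    have := hex x hxx
    linarith

theorem osc {a l X : ℝ} {f f' : ℝ → ℝ} (hX : 2 + |a| + |l| ≤ X)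
    (d : ∀ x, HasDerivAt f (f' x) x) (d' : ∀ x, HasDerivAt f' ((x ^ 3 - a * x + l) * f x) x) :
    ∃ x ≤ -X, f' x = 0 := by
  by_contra! hcon
  have c : Continuous f' := continuous_iff_continuousAt.2 fun x => (d' x).continuousAt
  rcases sign_const c isPreconnected_Iic hcon with s | s
  · exact osc_pos hX d d' s
  · exact osc_pos (f := fun x => - f x) (f' := fun x => - f' x) hX (fun x => (d x).fun_neg)
      (fun x => (d' x).fun_neg.congr_deriv (by ring)) (fun x hx => neg_pos.2 (s x hx))

theorem choose_R {a l1 l2 : ℝ} {y1 y2 : ℂ → ℂ} (h1 : RealSol a l1 y1) (h2 : RealSol a l2 y2) (M : ℝ) :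
    ∃ R, M ≤ R ∧ y1 ((-R : ℝ) : ℂ) ≠ 0 ∧ y2 ((-R : ℝ) : ℂ) ≠ 0 ∧
      ‖cY y1 ((-R : ℝ) : ℂ)‖ ≤ ‖cZ a y1 ((-R : ℝ) : ℂ)‖ := by
  have h8 := cT_ge a l1
  obtain ⟨x0, hx0, hcrit⟩ := osc (a := a) (l := l1) (X := 2 + |a| + |l1| + cT a l1 + |M| + 1)
    (by have := abs_nonneg M; linarith) h1.re_hd h1.re_hd'
  have ha := abs_nonneg a
  have hl := abs_nonneg l1
  have hM := le_abs_self M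
  have hM' := abs_nonneg M
  have hxneg : x0 < 0 := by linarith
  have hd0 : deriv y1 x0 = 0 := Complex.ext hcrit (h1.im_zero' x0)
  have hy0 : y1 x0 ≠ 0 := fun h => h1.sol.simple h1.ne h hd0
  have hne : (x0 : ℂ) ≠ 0 := by simp; linarith
  have hnorm : ‖(x0 : ℂ)‖ = -x0 := by simp [abs_of_neg hxneg]
  have hb := csq_big (a := a) (l := l1) hne (by rw [hnorm]; linarith)
  have hcp := cC_pos a l1
  have hca := cC_abs a l1
  have hB := (cB_norm_lower (a := a) (z := (x0 : ℂ)) (by linarith)).2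
  have hr : ‖cr (x0 : ℂ)‖ ≤ 3 / 4 := by
    unfold cr
    exact norm_div_le_of (by norm_num) (by simp) (by rw [norm_mul, hnorm]; simp; linarith)
  have hlt : ‖cY y1 x0‖ < ‖cZ a y1 x0‖ := by
    unfold cY cZ
    rw [hd0, zero_add, norm_mul, norm_mul]
    have : 0 < ‖y1 x0‖ := norm_pos_iff.2 hy0
    apply mul_lt_mul_of_pos_right _ this
    linarith
  have cc1 : ContinuousAt y1 (x0 : ℂ) := h1.sol.diff.continuous.continuousAt
  have cY' : ContinuousAt (cY y1) (x0 : ℂ) :=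
    h1.sol.diff'.continuous.continuousAt.add ((cr_hasDerivAt hne).continuousAt.mul cc1)
  have cZ' : ContinuousAt (cZ a y1) (x0 : ℂ) :=
    (cB_hasDerivAt a (z := (x0 : ℂ)) (by simp) hne).continuousAt.mul cc1
  have ev1 : ∀ᶠ z in nhds (x0 : ℂ), ‖cY y1 z‖ < ‖cZ a y1 z‖ := cY'.norm.eventually_lt cZ'.norm hlt
  have ev2 : ∀ᶠ z in nhds (x0 : ℂ), y1 z ≠ 0 := cc1.eventually_ne hy0
  have ev3 := h2.sol.isolated h2.ne (x0 : ℂ)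
  have ev := ((ev1.and ev2).filter_mono (nhdsWithin_le_nhds (s := {(x0 : ℂ)}ᶜ))).and ev3
  have ht : Tendsto (fun x : ℝ => (x : ℂ)) (nhdsWithin x0 {x0}ᶜ) (nhdsWithin (x0 : ℂ) {(x0 : ℂ)}ᶜ) := by
    rw [tendsto_nhdsWithin_iff]
    refine ⟨(continuous_ofReal.tendsto x0).mono_left nhdsWithin_le_nhds, ?_⟩
    filter_upwards [self_mem_nhdsWithin] with x hx
    simpa using hx
  have ev4 : ∀ᶠ x in nhdsWithin x0 {x0}ᶜ, x < -M :=
    (gt_mem_nhds (show x0 < -M by linarith)).filter_mono nhdsWithin_le_nhds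
  obtain ⟨x, ⟨⟨e1, e2⟩, e3⟩, e4⟩ := ((ht.eventually ev).and ev4).exists
  refine ⟨-x, by linarith, ?_, ?_, ?_⟩
  · rwa [neg_neg]
  · rwa [neg_neg]
  · rw [neg_neg]; exact e1.le

theorem count_split {a l R : ℝ} {y : ℂ → ℂ} (h : CubSol a l y) (hy : y ≠ 0)
    (hfin : (nonrealZeros y).Finite) (hR : nonrealZeros y ⊆ Metric.ball 0 R) :
    ∃ (t : Finset ℝ) (s : Finset ℂ), (∀ x : ℝ, x ∈ t ↔ |x| < R ∧ y x = 0) ∧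
      (∀ z, z ∈ s ↔ z ∈ Metric.ball (0 : ℂ) R ∧ y z = 0) ∧
      s.card = (nonrealZeros y).ncard + t.card := by
  classical
  have hf : {x : ℝ | |x| < R ∧ y x = 0}.Finite := by
    refine ((h.finite_zeros hy R).preimage (f := fun x : ℝ => (x : ℂ)) ofReal_injective.injOn).subset ?_
    intro x hx
    exact ⟨by simpa using hx.1.le, hx.2⟩
  refine ⟨hf.toFinset, hfin.toFinset ∪ hf.toFinset.image (fun x : ℝ => (x : ℂ)), ?_, ?_, ?_⟩
  · intro x; simp
  · intro z
    simp only [Finset.mem_union, Set.Finite.mem_toFinset, Finset.mem_image]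
    constructor
    · rintro (hz | ⟨x, hx, rfl⟩)
      · exact ⟨hR hz, hz.1⟩
      · exact ⟨by simpa using hx.1, hx.2⟩
    · rintro ⟨hz, h0⟩
      by_cases him : z.im = 0
      · right
        have e : ((z.re : ℝ) : ℂ) = z := by apply Complex.ext <;> simp [him]
        refine ⟨z.re, ⟨?_, by rw [e]; exact h0⟩, e⟩
        rw [← e] at hz
        simpa using hz
      · left; exact ⟨h0, him⟩
  · rw [Finset.card_union_of_disjoint, Finset.card_image_of_injective _ ofReal_injective,
      Set.ncard_eq_toFinset_card _ hfin]
    rw [Finset.disjoint_left]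
    intro z hz hz'
    obtain ⟨x, _, rfl⟩ := Finset.mem_image.1 hz'
    rw [Set.Finite.mem_toFinset] at hz
    exact hz.2 (ofReal_im x)

theorem cubic_gamma_interlacing (n : ℕ) (a lam mu : ℝ) (ha : 0 ≤ a)
    (hlam : (a, lam) ∈ cubicGamma n) (hmu : (a, mu) ∈ cubicGamma (n + 1)) :
    lam < mu := by
  obtain ⟨Y1, e1, f1, c1⟩ := hlam
  obtain ⟨Y2, e2, f2, c2⟩ := hmu
  obtain ⟨y1, h1, z1⟩ := exists_realSol e1
  obtain ⟨y2, h2, z2⟩ := exists_realSol e2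
  rw [← z1] at f1 c1
  rw [← z2] at f2 c2
  by_contra! hle
  rcases hle.eq_or_lt with heq | hlt
  · simp only at heq h1 h2
    rw [heq] at h2
    have := h1.unique_zeros h2
    rw [this, c1] at c2
    omega
  · simp only at h1 h2
    obtain ⟨R0, hR0, hidx⟩ := index_bound h1 h2
    obtain ⟨M1, hM1⟩ := f1.isBounded.subset_ball (0 : ℂ)
    obtain ⟨M2, hM2⟩ := f2.isBounded.subset_ball (0 : ℂ)
    obtain ⟨R, hR, r1, r2, r3⟩ := choose_R h1 h2 (max R0 (max M1 M2))
    have hRR0 : R0 ≤ R := (le_max_left _ _).trans hR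
    have hRM1 : M1 ≤ R := ((le_max_left _ _).trans (le_max_right _ _)).trans hR
    have hRM2 : M2 ≤ R := ((le_max_right _ _).trans (le_max_right _ _)).trans hR
    obtain ⟨t1, s1, ht1, hs1, k1⟩ := count_split h1.sol h1.ne f1 (hM1.trans (Metric.ball_subset_ball hRM1))
    obtain ⟨t2, s2, ht2, hs2, k2⟩ := count_split h2.sol h2.ne f2 (hM2.trans (Metric.ball_subset_ball hRM2))
    have hI := hidx R hRR0 r1 r2 r3 s1 s2 hs1 hs2
    have hcard : t1.card ≤ t2.card + 1 := by
      refine Finset.card_le_of_interleaved fun p hp q hq hpq hno => ?_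
      rw [ht1] at hp hq
      obtain ⟨x, hx, hx0⟩ := sturm hlt hpq h1.re_hd h1.re_hd' h2.re_hd h2.re_hd'
        (by simp [hp.2]) (by simp [hq.2]) (fun x hx h0 => by
          refine hno x ?_ hx
          rw [ht1]
          refine ⟨?_, Complex.ext h0 (h1.im_zero x)⟩
          rw [abs_lt]
          exact ⟨by linarith [(abs_lt.1 hp.1).1, hx.1], by linarith [(abs_lt.1 hq.1).2, hx.2]⟩)
      refine ⟨x, ?_, hx.1, hx.2⟩
      rw [ht2]
      refine ⟨?_, Complex.ext hx0 (h2.im_zero x)⟩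
      rw [abs_lt]
      exact ⟨by linarith [(abs_lt.1 hp.1).1, hx.1], by linarith [(abs_lt.1 hq.1).2, hx.2]⟩
    omega
end

section
/- For every (a,λ) in the real spectral locus Z(ℝ) of the PT-symmetric cubic oscillator, every eigenfunction has only finitely many nonreal zeros, and the number of its nonreal zeros is even. -/
open Complex Filter

/-- The cubic potential. -/
noncomputable def cubQ (a lam : ℝ) (z : ℂ) : ℂ := z ^ 3 - a * z + lam

lemma cubQ_re (a lam : ℝ) (z : ℂ) :
    (cubQ a lam z).re = z.re ^ 3 - 3 * z.re * z.im ^ 2 - a * z.re + lam := by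
  simp [cubQ, pow_succ]; ring

lemma cubQ_im (a lam : ℝ) (z : ℂ) :
    (cubQ a lam z).im = 3 * z.re ^ 2 * z.im - z.im ^ 3 - a * z.im := by
  simp [cubQ, pow_succ]; ring

/-- Nontrivial entire solutions decaying along the positive imaginary axis. -/
structure CubSol_s7 (a lam : ℝ) (y : ℂ → ℂ) : Prop where
  diff : Differentiable ℂ y
  ode : ∀ z, deriv (deriv y) z = cubQ a lam z * y z
  ne : y ≠ 0
  lim : Tendsto (fun t : ℝ => y (Complex.I * t)) atTop (nhds 0)

/-- The conjugate of y times its derivative. -/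
noncomputable def cubP (y : ℂ → ℂ) (z : ℂ) : ℂ := (starRingEnd ℂ) (y z) * deriv y z

lemma line_hasDerivAt (z e : ℂ) (s : ℝ) :
    HasDerivAt (fun s : ℝ => z + s * e) e s := by
  have h : HasDerivAt (fun s : ℝ => (s : ℂ)) 1 s := Complex.ofRealCLM.hasDerivAt
  simpa using (h.mul_const e).const_add z

lemma comp_line {f : ℂ → ℂ} {f' : ℂ} (z e : ℂ) (s : ℝ) (h : HasDerivAt f f' (z + s * e)) :
    HasDerivAt (fun s : ℝ => f (z + s * e)) (f' * e) s :=
  h.comp s (line_hasDerivAt z e s)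

namespace CubSol_s7

variable {a lam : ℝ} {y : ℂ → ℂ}

lemma d0 (h : CubSol_s7 a lam y) (z : ℂ) : HasDerivAt y (deriv y z) z :=
  (h.diff z).hasDerivAt

lemma d1 (h : CubSol_s7 a lam y) (z : ℂ) : HasDerivAt (deriv y) (cubQ a lam z * y z) z := by
  rw [← h.ode]
  exact (h.diff.deriv z).hasDerivAt

lemma hasDeriv_g (h : CubSol_s7 a lam y) (u z e : ℂ) (s : ℝ) :
    HasDerivAt (fun s : ℝ => (u * cubP y (z + s * e)).re)
      ((u * (starRingEnd ℂ) e).re * ‖deriv y (z + s * e)‖ ^ 2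
        + (u * e * cubQ a lam (z + s * e)).re * ‖y (z + s * e)‖ ^ 2) s := by
  have hw := comp_line z e s (h.d0 (z + s * e))
  have hv := comp_line z e s (h.d1 (z + s * e))
  have hp := ((hw.star).mul hv).const_mul u
  have hr := Complex.reCLM.hasFDerivAt.comp_hasDerivAt s hp
  refine (hr.congr_deriv ?_)
  simp only [Complex.reCLM_apply, Complex.sq_norm, Complex.normSq_apply]
  generalize cubQ a lam (z + s * e) = q
  generalize deriv y (z + s * e) = v
  generalize y (z + s * e) = w
  simp only [star_def, map_mul, Complex.mul_re, Complex.mul_im, Complex.add_re, Complex.add_im,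
    Complex.conj_re, Complex.conj_im]
  ring

lemma mono (h : CubSol_s7 a lam y) (u z e : ℂ) {S : Set ℝ} (hS : Convex ℝ S)
    (hc : 0 ≤ (u * (starRingEnd ℂ) e).re)
    (hq : ∀ s ∈ interior S, 0 ≤ (u * e * cubQ a lam (z + s * e)).re) :
    MonotoneOn (fun s : ℝ => (u * cubP y (z + s * e)).re) S := by
  refine monotoneOn_of_deriv_nonneg hS
    (fun s _ => (h.hasDeriv_g u z e s).continuousAt.continuousWithinAt)
    (fun s _ => (h.hasDeriv_g u z e s).differentiableAt.differentiableWithinAt) ?_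
  intro s hs
  rw [(h.hasDeriv_g u z e s).deriv]
  have := hq s hs
  positivity

/-- A solution and its derivative have no common zero. -/
lemma no_common (h : CubSol_s7 a lam y) (z : ℂ) (h0 : y z = 0) (h1 : deriv y z = 0) : False := by
  apply h.ne
  funext x
  set e := x - z with he
  have hcQ : Continuous fun s : ℝ => cubQ a lam (z + s * e) := by
    unfold cubQ; fun_prop
  obtain ⟨C, hC⟩ := (isCompact_Icc (a := (0:ℝ)) (b := 1)).exists_bound_of_continuousOn
    hcQ.continuousOn
  have key := eq_zero_of_abs_deriv_le_mul_abs_self_of_eq_zero_right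
    (f := fun s : ℝ => (y (z + s * e), deriv y (z + s * e)))
    (f' := fun s : ℝ => (deriv y (z + s * e) * e, cubQ a lam (z + s * e) * y (z + s * e) * e))
    (K := (|C| + 1) * ‖e‖) (a := 0) (b := 1)
    (fun s _ => ((comp_line z e s (h.d0 _)).prodMk
      (comp_line z e s (h.d1 _))).continuousAt.continuousWithinAt)
    (fun s _ => ((comp_line z e s (h.d0 _)).prodMk
      (comp_line z e s (h.d1 _))).hasDerivWithinAt)
    (by simp [h0, h1]) ?_ 1 (by simp)
  · have := congrArg Prod.fst key
    simpa [he] using this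
  · intro s hs
    have hCs := hC s ⟨hs.1, hs.2.le⟩
    have hCa := le_abs_self C
    simp only [Prod.norm_def, norm_mul]
    set A := ‖y (z + s * e)‖
    set B := ‖deriv y (z + s * e)‖
    have hA : 0 ≤ A := norm_nonneg _
    have hB : 0 ≤ B := norm_nonneg _
    have hm1 : A ≤ max A B := le_max_left _ _
    have hm2 : B ≤ max A B := le_max_right _ _
    have hCn := abs_nonneg C
    apply max_le
    · calc B * ‖e‖ ≤ max A B * ‖e‖ := by gcongr
        _ ≤ (|C| + 1) * ‖e‖ * max A B := by nlinarith [mul_nonneg (norm_nonneg e) (hA.trans hm1), mul_nonneg hCn (mul_nonneg (norm_nonneg e) (hA.trans hm1))]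
    · calc _ ≤ (|C| + 1) * max A B * ‖e‖ := by
            gcongr
            linarith
        _ = _ := by ring

lemma strictMono (h : CubSol_s7 a lam y) (u z e : ℂ) {S : Set ℝ} (hS : Convex ℝ S)
    (hc : 0 < (u * (starRingEnd ℂ) e).re)
    (hq : ∀ s ∈ interior S, 0 < (u * e * cubQ a lam (z + s * e)).re) :
    StrictMonoOn (fun s : ℝ => (u * cubP y (z + s * e)).re) S := by
  refine strictMonoOn_of_deriv_pos hS
    (fun s _ => (h.hasDeriv_g u z e s).continuousAt.continuousWithinAt) ?_
  intro s hs
  rw [(h.hasDeriv_g u z e s).deriv]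
  have := hq s hs
  by_cases hv : deriv y (z + s * e) = 0
  · have hw : y (z + s * e) ≠ 0 := fun hw => h.no_common _ hw hv
    have : 0 < ‖y (z + s * e)‖ := norm_pos_iff.2 hw
    positivity
  · have : 0 < ‖deriv y (z + s * e)‖ := norm_pos_iff.2 hv
    positivity

/-- The ray lemma: a solution bounded along a progressive ray. -/
lemma ray (h : CubSol_s7 a lam y) (u z e : ℂ) {S M : ℝ}
    (hb : ∀ s : ℝ, S ≤ s → ‖y (z + s * e)‖ ≤ M)
    (hc : 0 < (u * (starRingEnd ℂ) e).re)
    (hq : ∀ s : ℝ, 0 < s → 0 < (u * e * cubQ a lam (z + s * e)).re) :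
    (u * cubP y z).re < 0 := by
  by_contra hneg
  push Not at hneg
  have hsm := h.strictMono u z e (convex_Ici (0:ℝ)) hc (by simpa using hq)
  set g := fun s : ℝ => (u * cubP y (z + s * e)).re with hg
  have hg0 : 0 ≤ g 0 := by simpa [hg] using hneg
  have hpos : ∀ s, 0 < s → 0 < g s := fun s hs =>
    hg0.trans_lt (hsm (by simp) (by simpa using hs.le) hs)
  set c := (u * (starRingEnd ℂ) e).re
  set D := (‖u‖ * M) ^ 2 + 1 with hD
  have hDpos : 0 < D := by positivity
  set K := c / D with hK
  have hKpos : 0 < K := by positivity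
  set S' := max S 1 with hS'
  have hd := h.hasDeriv_g u z e
  have hric : ∀ s, S' ≤ s → K * g s ^ 2 ≤ deriv g s := by
    intro s hs
    have hs1 : 1 ≤ s := (le_max_right _ _).trans hs
    have hsS : S ≤ s := (le_max_left _ _).trans hs
    rw [(hd s).deriv]
    have hq' := hq s (by linarith)
    have hM := hb s hsS
    have hgl : g s ≤ (‖u‖ * M) * ‖deriv y (z + s * e)‖ := by
      calc g s ≤ ‖u * cubP y (z + s * e)‖ := Complex.re_le_norm _
        _ = ‖u‖ * ‖y (z + s * e)‖ * ‖deriv y (z + s * e)‖ := by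
            simp [cubP, mul_assoc]
        _ ≤ _ := by gcongr
    have hgp := hpos s (by linarith)
    have h2 : g s ^ 2 ≤ D * ‖deriv y (z + s * e)‖ ^ 2 := by
      calc g s ^ 2 ≤ ((‖u‖ * M) * ‖deriv y (z + s * e)‖) ^ 2 := by gcongr
        _ ≤ _ := by rw [mul_pow, hD]; nlinarith [sq_nonneg ‖deriv y (z + s * e)‖]
    have h3 : K * g s ^ 2 ≤ c * ‖deriv y (z + s * e)‖ ^ 2 := by
      calc K * g s ^ 2 ≤ K * (D * ‖deriv y (z + s * e)‖ ^ 2) := by gcongr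
        _ = _ := by rw [hK]; field_simp
    have : 0 ≤ (u * e * cubQ a lam (z + s * e)).re * ‖y (z + s * e)‖ ^ 2 := by positivity
    linarith
  have hS'pos : 0 < S' := lt_of_lt_of_le one_pos (le_max_right _ _)
  have hdk : ∀ s, S' ≤ s → HasDerivAt (fun s => (g s)⁻¹ + K * s) (-(deriv g s) / g s ^ 2 + K) s := by
    intro s hs
    have hgs := hpos s (by linarith)
    have h1 := (hd s).differentiableAt.hasDerivAt
    have h2 := (h1.inv hgs.ne').add ((hasDerivAt_id s).const_mul K)
    rw [mul_one] at h2
    exact h2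
  have hanti : AntitoneOn (fun s => (g s)⁻¹ + K * s) (Set.Ici S') := by
    refine antitoneOn_of_deriv_nonpos (convex_Ici _)
      (fun s hs => (hdk s hs).continuousAt.continuousWithinAt)
      (fun s hs => (hdk s (interior_subset hs)).differentiableAt.differentiableWithinAt) ?_
    intro s hs
    have hs' := interior_subset hs
    rw [(hdk s hs').deriv]
    have hgs := hpos s (by have : S' ≤ s := hs'; linarith)
    have := hric s hs'
    have h4 : K ≤ deriv g s / g s ^ 2 := by
      rw [le_div_iff₀ (by positivity)]; exact this
    rw [neg_div]; linarith
  set A := (g S')⁻¹ + K * S'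
  have hA : 0 < A := by have := hpos S' hS'pos; positivity
  have hge : S' ≤ S' + A / K := by have : 0 < A / K := by positivity
                                   linarith
  have h5 := hanti (by simp) (by simpa using hge) hge
  have h6 := hpos (S' + A / K) (by linarith)
  have h7 : 0 < (g (S' + A / K))⁻¹ := by positivity
  have h8 : K * (S' + A / K) = K * S' + A := by field_simp
  simp only [h8] at h5
  have : 0 < K * S' := by positivity
  have : (g (S' + A / K))⁻¹ + (K * S' + A) ≤ A := h5
  linarith

end CubSol_s7

namespace CubSol_s7

variable {a lam : ℝ} {y : ℂ → ℂ}

lemma bdd_imag (h : CubSol_s7 a lam y) : ∃ S : ℝ, ∀ s : ℝ, S ≤ s → ‖y (Complex.I * s)‖ ≤ 1 := by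
  have := h.lim.norm
  rw [norm_zero] at this
  exact eventually_atTop.1 (this.eventually_le_const one_pos)

lemma reg_imag (h : CubSol_s7 a lam y) {t : ℝ} (ht : 10 + |a| + |lam| ≤ t) :
    ((1 + Complex.I) * cubP y (Complex.I * t)).re < 0 := by
  obtain ⟨S, hS⟩ := h.bdd_imag
  refine h.ray (1 + Complex.I) (Complex.I * t) Complex.I (S := S - t) (M := 1) ?_ (by simp) ?_
  · intro s hs
    have := hS (t + s) (by linarith)
    convert this using 3
    push_cast; ring
  · intro s hs
    simp only [Complex.mul_re, Complex.add_re, Complex.add_im, Complex.mul_im, cubQ_re, cubQ_im]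
    simp
    have ha := neg_abs_le a
    have hl := le_abs_self lam
    have ha0 := abs_nonneg a
    have hl0 := abs_nonneg lam
    set r := t + s
    have hr : 10 + |a| + |lam| ≤ r := by linarith
    nlinarith [mul_nonneg (by linarith : (0:ℝ) ≤ r) (by linarith : (0:ℝ) ≤ a + r),
      mul_nonneg (by linarith : (0:ℝ) ≤ r) (by linarith : (0:ℝ) ≤ r - 10),
      mul_nonneg (by nlinarith : (0:ℝ) ≤ r * r) (by linarith : (0:ℝ) ≤ r - 10)]

lemma reg_upper (h : CubSol_s7 a lam y) {z : ℂ} (hz0 : 0 ≤ z.re) (hz1 : z.re ≤ z.im)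
    (ht : 10 + |a| + |lam| ≤ z.im) :
    ((1 + Complex.I) * cubP y z).re < 0 := by
  have hm := h.mono (1 + Complex.I) z (-1 + 2 * Complex.I) (convex_Icc (0:ℝ) z.re)
    (by norm_num) ?_
  · have h1 := hm (Set.left_mem_Icc.2 hz0) (Set.right_mem_Icc.2 hz0) hz0
    have h2 := h.reg_imag (t := z.im + 2 * z.re) (by linarith)
    have e1 : z + (z.re : ℂ) * (-1 + 2 * Complex.I) = Complex.I * (z.im + 2 * z.re : ℝ) := by
      apply Complex.ext <;> simp
      ring
    simp only [e1] at h1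
    simp only [Complex.ofReal_zero, zero_mul, add_zero] at h1
    linarith
  · intro s hs
    rw [interior_Icc] at hs
    obtain ⟨hs0, hs1⟩ := hs
    simp only [Complex.mul_re, Complex.add_re, Complex.add_im, Complex.mul_im, cubQ_re, cubQ_im]
    simp
    ring_nf
    have ha := neg_abs_le a
    have hl := le_abs_self lam
    have ha0 := abs_nonneg a
    have hl0 := abs_nonneg lam
    obtain ⟨X, hX⟩ : ∃ X, X = z.re - s := ⟨_, rfl⟩
    obtain ⟨r, hr⟩ : ∃ r, r = z.im + 2 * s := ⟨_, rfl⟩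
    have hr1 : 10 + |a| + |lam| ≤ r := by linarith
    have hX0 : 0 ≤ X := by linarith
    have hXr : X ≤ r := by linarith
    have hr0 : 0 ≤ r := by linarith
    have key : 0 ≤ -3 * (X ^ 3 - 3 * X * r ^ 2 - a * X + lam) - (3 * X ^ 2 * r - r ^ 3 - a * r) := by
      have k1 : 0 ≤ X * ((r - X) * (r + X)) := by
        have : 0 ≤ r - X := by linarith
        positivity
      have k2 : 0 ≤ X * r * (r - X) := by
        have : 0 ≤ r - X := by linarith
        positivity
      have k3 : 0 ≤ X * (a + r) := mul_nonneg hX0 (by linarith)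
      have k4 : 0 ≤ r * (a + r) := mul_nonneg hr0 (by linarith)
      have k5 : 0 ≤ r * r * (r - 10) := mul_nonneg (by positivity) (by linarith)
      have k6 : 0 ≤ r * (r - X) := mul_nonneg hr0 (by linarith)
      have k7 : 0 ≤ r * (r - 10) := mul_nonneg hr0 (by linarith)
      have k8 : 0 ≤ X * r * r := by positivity
      nlinarith
    rw [hX, hr] at key
    ring_nf at key
    linarith

lemma bdd_upper (h : CubSol_s7 a lam y) : ∃ S : ℝ, ∀ z : ℂ, 0 ≤ z.re → S ≤ z.im - z.re →
    ‖y z‖ ≤ 1 := by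
  obtain ⟨S, hS⟩ := h.bdd_imag
  refine ⟨max S (10 + |a| + |lam|), fun z hz hzS => ?_⟩
  have h1 : S ≤ z.im - z.re := (le_max_left _ _).trans hzS
  have h2 : 10 + |a| + |lam| ≤ z.im - z.re := (le_max_right _ _).trans hzS
  have h3 := hS _ h1
  set w : ℂ := Complex.I * (z.im - z.re : ℝ) with hw
  have hd : ∀ s : ℝ, HasDerivAt (fun s : ℝ => ‖y (w + s * (1 + Complex.I))‖ ^ 2)
      (2 * ((1 + Complex.I) * cubP y (w + s * (1 + Complex.I))).re) s := by
    intro s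
    have hw' := comp_line w (1 + Complex.I) s (h.d0 _)
    have hr := hw'.norm_sq
    refine hr.congr_deriv ?_
    rw [Complex.inner]
    simp only [cubP]
    congr 2
    ring
  have hanti : AntitoneOn (fun s : ℝ => ‖y (w + s * (1 + Complex.I))‖ ^ 2) (Set.Icc 0 z.re) := by
    refine antitoneOn_of_deriv_nonpos (convex_Icc _ _)
      (fun s hs => (hd s).continuousAt.continuousWithinAt)
      (fun s hs => (hd s).differentiableAt.differentiableWithinAt) ?_
    intro s hs
    rw [interior_Icc] at hs
    rw [(hd s).deriv]
    have := h.reg_upper (z := w + s * (1 + Complex.I)) (by simp [hw]; linarith [hs.1])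
      (by simp [hw]; linarith [abs_nonneg a, abs_nonneg lam]) (by simp [hw]; linarith [hs.1])
    linarith
  have h4 := hanti (Set.left_mem_Icc.2 hz) (Set.right_mem_Icc.2 hz) hz
  have e1 : w + (z.re : ℂ) * (1 + Complex.I) = z := by
    apply Complex.ext <;> simp [hw]
  simp only [e1, Complex.ofReal_zero, zero_mul, add_zero] at h4
  have h5 : ‖y z‖ ^ 2 ≤ 1 ^ 2 := h4.trans (by gcongr)
  exact (abs_le_of_sq_le_sq' h5 zero_le_one).2

/-- Zero-free region near the positive real axis. -/
lemma reg_right (h : CubSol_s7 a lam y) {z : ℂ} (hz0 : 0 ≤ z.im) (hz1 : z.im ≤ z.re)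
    (ht : 2 * (10 + |a| + |lam|) ≤ z.re) :
    ((-1 + Complex.I) * cubP y z).re < 0 := by
  have ha := neg_abs_le a
  have ha' := le_abs_self a
  have hl := le_abs_self lam
  have ha0 := abs_nonneg a
  have hl0 := abs_nonneg lam
  set L := (z.re - z.im) / 2 with hL
  have hL0 : 0 ≤ L := by rw [hL]; linarith
  have hm := h.mono (-1 + Complex.I) z (-1 + Complex.I) (convex_Icc (0:ℝ) L)
    (by simp) ?_
  · have h1 := hm (Set.left_mem_Icc.2 hL0) (Set.right_mem_Icc.2 hL0) hL0
    obtain ⟨S, hS⟩ := h.bdd_upper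
    set r := (z.re + z.im) / 2 with hr
    have hrB : 10 + |a| + |lam| ≤ r := by linarith
    have h2 := h.ray (-1 + Complex.I) (r + r * Complex.I) (1 + 2 * Complex.I) (S := max S 0) (M := 1)
      ?_ (by norm_num) ?_
    · have e1 : z + (L : ℂ) * (-1 + Complex.I) = r + r * Complex.I := by
        apply Complex.ext <;> simp [hL, hr] <;> ring
      simp only [e1] at h1
      simp only [Complex.ofReal_zero, zero_mul, add_zero] at h1
      linarith
    · intro s hs
      have hs1 : S ≤ s := (le_max_left _ _).trans hs
      have hs0 : 0 ≤ s := (le_max_right _ _).trans hs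
      apply hS
      · simp; linarith
      · simp; linarith
    · intro s hs
      simp only [Complex.mul_re, Complex.add_re, Complex.add_im, Complex.mul_im, cubQ_re, cubQ_im]
      simp
      ring_nf
      obtain ⟨X, hX⟩ : ∃ X, X = r + s := ⟨_, rfl⟩
      obtain ⟨t, ht⟩ : ∃ t, t = r + 2 * s := ⟨_, rfl⟩
      have hX1 : 10 + |a| + |lam| ≤ X := by linarith
      have hX0 : 0 ≤ X := by linarith
      have hXt : X ≤ t := by linarith
      have htX : t ≤ 2 * X := by linarith
      have ht0 : 0 ≤ t := by linarith
      have key : 0 < -3 * (X ^ 3 - 3 * X * t ^ 2 - a * X + lam)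
          + (3 * X ^ 2 * t - t ^ 3 - a * t) := by
        have k1 : 0 ≤ X * X * (t - X) := mul_nonneg (by positivity) (by linarith)
        have k2 : 0 ≤ t * t * (2 * X - t) := mul_nonneg (by positivity) (by linarith)
        have k3 : 0 ≤ X * (a + X) := mul_nonneg hX0 (by linarith)
        have k4 : 0 ≤ t * (X - a) := mul_nonneg ht0 (by linarith)
        have k5 : 0 ≤ t * X * (t - 10) := mul_nonneg (by positivity) (by linarith)
        have k6 : 0 ≤ X * (t - X) := mul_nonneg hX0 (by linarith)
        have k7 : 0 ≤ X * (X - 10) := mul_nonneg hX0 (by linarith)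
        nlinarith
      rw [hX, ht] at key
      ring_nf at key
      linarith
  · intro s hs
    rw [interior_Icc] at hs
    obtain ⟨hs0, hs1⟩ := hs
    simp only [Complex.mul_re, Complex.add_re, Complex.add_im, Complex.mul_im, cubQ_re, cubQ_im]
    simp
    ring_nf
    obtain ⟨X, hX⟩ : ∃ X, X = z.re - s := ⟨_, rfl⟩
    obtain ⟨t, ht⟩ : ∃ t, t = z.im + s := ⟨_, rfl⟩
    have hX1 : 10 + |a| + |lam| ≤ X := by linarith
    have htX : t ≤ X := by linarith
    have ht0 : 0 ≤ t := by linarith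
    have key : 0 ≤ 2 * (3 * X ^ 2 * t - t ^ 3 - a * t) := by
      have k1 : 0 ≤ t * ((X - t) * (X + t)) :=
        mul_nonneg ht0 (mul_nonneg (by linarith) (by linarith))
      have k2 : 0 ≤ t * (X - a) := mul_nonneg ht0 (by linarith)
      have k3 : 0 ≤ t * X * (X - 10) := mul_nonneg (mul_nonneg ht0 (by linarith)) (by linarith)
      have k4 : 0 ≤ t * X := mul_nonneg ht0 (by linarith)
      nlinarith
    rw [hX, ht] at key
    ring_nf at key
    linarith

/-- Zero-free strip left of the imaginary axis. -/
lemma reg_strip (h : CubSol_s7 a lam y) {z : ℂ} (hz0 : -1 ≤ z.re) (hz1 : z.re ≤ 0)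
    (ht : 10 + |a| + |lam| ≤ z.im) : (1 * cubP y z).re < 0 := by
  have ha := neg_abs_le a
  have ha' := le_abs_self a
  have hl := neg_abs_le lam
  have ha0 := abs_nonneg a
  have hl0 := abs_nonneg lam
  obtain ⟨S, hS⟩ := h.bdd_upper
  refine h.ray 1 z (1 + 3 * Complex.I) (S := max S 1) (M := 1) ?_ (by simp) ?_
  · intro s hs
    have hs1 : S ≤ s := (le_max_left _ _).trans hs
    have hs0 : 1 ≤ s := (le_max_right _ _).trans hs
    apply hS
    · simp; linarith
    · simp; linarith
  · intro s hs
    simp only [Complex.mul_re, Complex.add_re, Complex.add_im, Complex.mul_im, cubQ_re, cubQ_im]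
    simp
    ring_nf
    obtain ⟨X, hX⟩ : ∃ X, X = z.re + s := ⟨_, rfl⟩
    obtain ⟨t, ht⟩ : ∃ t, t = z.im + 3 * s := ⟨_, rfl⟩
    have ht1 : 10 + |a| + |lam| ≤ t := by linarith
    have hX0 : -1 ≤ X := by linarith
    have hXt : 3 * X ≤ t := by linarith
    have ht0 : 0 ≤ t := by linarith
    have key : 0 < (X ^ 3 - 3 * X * t ^ 2 - a * X + lam)
        - 3 * (3 * X ^ 2 * t - t ^ 3 - a * t) := by
      have k4 : 0 ≤ t * (a + t - 10) := mul_nonneg ht0 (by linarith)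
      have k5 : 0 ≤ t * t * (t - 10) := mul_nonneg (by positivity) (by linarith)
      have k7 : 0 ≤ t * (t - 10) := mul_nonneg ht0 (by linarith)
      rcases le_total 0 X with hX' | hX'
      · have k1 : 0 ≤ t * t * (t - 3 * X) := mul_nonneg (by positivity) (by linarith)
        have k2 : 0 ≤ t * ((t - 3 * X) * (t + 3 * X)) :=
          mul_nonneg ht0 (mul_nonneg (by linarith) (by linarith))
        have k3 : 0 ≤ X * (t - a) := mul_nonneg hX' (by linarith)
        have k6 : 0 ≤ t * (t - 3 * X) := mul_nonneg ht0 (by linarith)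
        have k8 : 0 ≤ X ^ 3 := by positivity
        nlinarith
      · have k1 : 0 ≤ t * t * (-X) := mul_nonneg (by positivity) (by linarith)
        have k2 : 0 ≤ (1 - X) * (1 + X) := mul_nonneg (by linarith) (by linarith)
        have k2' : 0 ≤ t * ((1 - X) * (1 + X)) := mul_nonneg ht0 k2
        have k3 : 0 ≤ (-X) * (t + a) := mul_nonneg (by linarith) (by linarith)
        have k6 : 0 ≤ t * (1 + X) := mul_nonneg ht0 (by linarith)
        have k8 : 0 ≤ (-X) * ((1 - X) * (1 + X)) := mul_nonneg (by linarith) k2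
        nlinarith
    rw [hX, ht] at key
    ring_nf at key
    linarith

/-- Zero-free region in the left half plane where `Re Q ≥ 0`. -/
lemma reg_left (h : CubSol_s7 a lam y) {z : ℂ} (hz1 : z.re ≤ -1)
    (ht : 10 + |a| + |lam| ≤ z.im) (hQ : 0 ≤ (cubQ a lam z).re) : (1 * cubP y z).re < 0 := by
  have ha := neg_abs_le a
  have hl := neg_abs_le lam
  have ha0 := abs_nonneg a
  have hl0 := abs_nonneg lam
  set L := -1 - z.re with hL
  have hL0 : 0 ≤ L := by linarith
  have hm := h.mono 1 z 1 (convex_Icc (0:ℝ) L) (by simp) ?_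
  · have h1 := hm (Set.left_mem_Icc.2 hL0) (Set.right_mem_Icc.2 hL0) hL0
    have h2 := h.reg_strip (z := z + L * 1) (by simp [hL]) (by simp [hL]) (by simpa using ht)
    simp only [Complex.ofReal_zero, zero_mul, add_zero] at h1
    linarith
  · intro s hs
    rw [interior_Icc] at hs
    obtain ⟨hs0, hs1⟩ := hs
    rw [cubQ_re] at hQ
    simp only [one_mul, cubQ_re]
    simp
    set x0 := z.re
    set t := z.im
    obtain ⟨x, hx⟩ : ∃ x, x = x0 + s := ⟨_, rfl⟩
    rw [← hx]
    have hx0 : 0 < x - x0 := by linarith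
    have hx1 : 0 < -1 - x := by linarith
    have hf1 : 0 ≤ -1 + 3 * t ^ 2 + a + lam := by nlinarith
    by_contra hneg
    push Not at hneg
    have k1 := mul_nonneg hx1.le hQ
    have k2 := mul_nonneg hx0.le hf1
    have k3 : 0 ≤ (x - x0) * ((-1 - x) * ((-1 - x0) * (1 - x - x0))) := by
      apply mul_nonneg hx0.le; apply mul_nonneg hx1.le; apply mul_nonneg <;> linarith
    have k4 := mul_pos_of_neg_of_neg hneg (by linarith : -(-1 - x0) < 0)
    nlinarith

end CubSol_s7

lemma cubP_ne {y : ℂ → ℂ} {u z : ℂ} (h : (u * cubP y z).re < 0) : y z ≠ 0 := by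
  intro h0
  simp [cubP, h0] at h

lemma cubQ_conj (a lam : ℝ) (z : ℂ) :
    (starRingEnd ℂ) (cubQ a lam ((starRingEnd ℂ) z)) = cubQ a lam z := by
  simp [cubQ]

/-- The reflected function. -/
noncomputable def cubStar (y : ℂ → ℂ) (z : ℂ) : ℂ := (starRingEnd ℂ) (y ((starRingEnd ℂ) z))

lemma cubStar_hasDerivAt {y : ℂ → ℂ} {y' z : ℂ} (h : HasDerivAt y y' ((starRingEnd ℂ) z)) :
    HasDerivAt (cubStar y) ((starRingEnd ℂ) y') z := by
  have := h.conj_conj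
  rw [Complex.conj_conj] at this
  exact this

lemma cub_refl {a lam : ℝ} {y : ℂ → ℂ} (hy : IsCubicEigenfunction (a : ℂ) (lam : ℂ) y) :
    CubSol_s7 a lam y ∧ ∃ c : ℂ, c ≠ 0 ∧ ∀ z, cubStar y z = c * y z := by
  obtain ⟨hd, hne, hode, ht, hb⟩ := hy
  have hs : CubSol_s7 a lam y := by
    refine ⟨hd, fun z => ?_, hne, ht⟩
    have := hode z
    simp only [cubQ]
    linear_combination -this
  refine ⟨hs, ?_⟩
  have hdS : ∀ z, HasDerivAt (cubStar y) (cubStar (deriv y) z) z := fun z =>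
    cubStar_hasDerivAt (hs.d0 _)
  have hderS : deriv (cubStar y) = cubStar (deriv y) := funext fun z => (hdS z).deriv
  have hdS2 : ∀ z, HasDerivAt (cubStar (deriv y)) (cubQ a lam z * cubStar y z) z := fun z => by
    have := cubStar_hasDerivAt (z := z) (hs.d1 _)
    rw [map_mul, cubQ_conj] at this
    exact this
  have hlimS : Tendsto (fun t : ℝ => cubStar y (Complex.I * t)) atTop (nhds 0) := by
    have h1 := (Complex.continuous_conj.tendsto 0).comp (hb.comp tendsto_neg_atTop_atBot)
    rw [map_zero] at h1
    refine h1.congr fun t => ?_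
    simp [cubStar]
  have hSne : cubStar y ≠ 0 := by
    intro h0
    apply hne
    funext z
    have := congrFun h0 ((starRingEnd ℂ) z)
    simpa [cubStar] using this
  have hSs : CubSol_s7 a lam (cubStar y) := by
    refine ⟨fun z => (hdS z).differentiableAt, fun z => ?_, hSne, hlimS⟩
    rw [hderS]; exact (hdS2 z).deriv
  set z0 : ℂ := Complex.I * (10 + |a| + |lam| : ℝ) with hz0
  have n1 : y z0 ≠ 0 := cubP_ne (hs.reg_imag le_rfl)
  have n2 : cubStar y z0 ≠ 0 := cubP_ne (hSs.reg_imag le_rfl)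
  set f : ℂ → ℂ := fun z => cubStar y z0 * y z - y z0 * cubStar y z with hf
  have hf0 : f = 0 := by
    by_contra hfne
    have hdf : ∀ z, HasDerivAt f (cubStar y z0 * deriv y z - y z0 * cubStar (deriv y) z) z :=
      fun z => ((hs.d0 z).const_mul _).sub ((hdS z).const_mul _)
    have hderf : deriv f = fun z => cubStar y z0 * deriv y z - y z0 * cubStar (deriv y) z :=
      funext fun z => (hdf z).deriv
    have hfs : CubSol_s7 a lam f := by
      refine ⟨fun z => (hdf z).differentiableAt, fun z => ?_, hfne, ?_⟩
      · rw [hderf]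
        refine (((hs.d1 z).const_mul _).sub ((hdS2 z).const_mul _)).deriv.trans ?_
        simp only [hf]; ring
      · simpa using (ht.const_mul (cubStar y z0)).sub (hlimS.const_mul (y z0))
    refine cubP_ne (hfs.reg_imag le_rfl) ?_
    change f z0 = 0
    simp only [hf]; ring
  refine ⟨cubStar y z0 / y z0, div_ne_zero n2 n1, fun z => ?_⟩
  have : cubStar y z0 * y z - y z0 * cubStar y z = 0 := congrFun hf0 z
  field_simp
  linear_combination -this

/-- Zero-free region in the left half plane where `Re Q < 0`. -/
lemma reg_vert {a lam : ℝ} {y : ℂ → ℂ} (hs : CubSol_s7 a lam y)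
    {c : ℂ} (hc : ∀ z, cubStar y z = c * y z) {z : ℂ} (hx : z.re < 0) (ht : 0 < z.im)
    (hQ : (cubQ a lam z).re < 0) : y z ≠ 0 := by
  intro h0
  have hder : (starRingEnd ℂ) (deriv y z.re) = c * deriv y z.re := by
    have h1 : HasDerivAt (cubStar y) ((starRingEnd ℂ) (deriv y z.re)) (z.re : ℂ) :=
      cubStar_hasDerivAt (by simpa using hs.d0 _)
    have h2 : HasDerivAt (cubStar y) (c * deriv y z.re) (z.re : ℂ) := by
      have : cubStar y = fun z => c * y z := funext hc
      rw [this]; exact (hs.d0 _).const_mul c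
    exact h1.unique h2
  have hval : (starRingEnd ℂ) (y z.re) = c * y z.re := by
    have := hc z.re
    simpa [cubStar] using this
  have hp : (cubP y z.re).im = 0 := by
    rw [← Complex.conj_eq_iff_im]
    simp only [cubP]
    rw [map_mul, Complex.conj_conj, hder, hval]
    ring
  have hm := hs.strictMono Complex.I (z.re : ℂ) Complex.I (convex_Icc (0:ℝ) z.im) (by simp) ?_
  · have h1 := hm (Set.left_mem_Icc.2 ht.le) (Set.right_mem_Icc.2 ht.le) ht
    simp only [Complex.re_add_im] at h1
    have hpz : cubP y z = 0 := by simp [cubP, h0]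
    simp [hp, hpz] at h1
  · intro s hs'
    rw [interior_Icc] at hs'
    rw [cubQ_re] at hQ
    simp only [Complex.I_mul_I, neg_one_mul, Complex.neg_re, cubQ_re]
    simp
    nlinarith [mul_nonneg (neg_nonneg.2 hx.le)
      (mul_nonneg (by linarith [hs'.2] : 0 ≤ z.im - s) (by linarith [hs'.1] : 0 ≤ z.im + s))]

lemma upper_bound {a lam : ℝ} {y : ℂ → ℂ} (hs : CubSol_s7 a lam y)
    {c : ℂ} (hc : ∀ z, cubStar y z = c * y z) {z : ℂ} (ht : 0 < z.im) (h0 : y z = 0) :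
    |z.re| ≤ 3 * (10 + |a| + |lam|) ∧ |z.im| ≤ 3 * (10 + |a| + |lam|) := by
  have ha := le_abs_self a
  have hl := le_abs_self lam
  have ha0 := abs_nonneg a
  have hl0 := abs_nonneg lam
  obtain ⟨B, hB⟩ : ∃ B, B = 10 + |a| + |lam| := ⟨_, rfl⟩
  rw [← hB, abs_of_pos ht, abs_le]
  rcases le_total 0 z.re with hx | hx
  · rcases le_total z.re z.im with hxt | hxt
    · have : z.im < B := by
        by_contra hcon
        exact cubP_ne (hs.reg_upper hx hxt (by linarith)) h0
      refine ⟨⟨?_, ?_⟩, ?_⟩ <;> linarith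
    · have : z.re < 2 * B := by
        by_contra hcon
        exact cubP_ne (hs.reg_right ht.le hxt (by linarith)) h0
      refine ⟨⟨?_, ?_⟩, ?_⟩ <;> linarith
  · rcases le_total (-1) z.re with hx1 | hx1
    · have : z.im < B := by
        by_contra hcon
        exact cubP_ne (hs.reg_strip hx1 hx (by linarith)) h0
      refine ⟨⟨?_, ?_⟩, ?_⟩ <;> linarith
    · have hQ : 0 ≤ (cubQ a lam z).re := by
        by_contra hcon
        exact reg_vert hs hc (by linarith) ht (not_le.1 hcon) h0
      have him : z.im < B := by
        by_contra hcon
        exact cubP_ne (hs.reg_left hx1 (by linarith) hQ) h0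
      refine ⟨⟨?_, ?_⟩, ?_⟩
      · rw [cubQ_re] at hQ
        by_contra hcon
        push Not at hcon
        obtain ⟨x, hx'⟩ : ∃ x, x = -z.re := ⟨_, rfl⟩
        have e : z.re = -x := by linarith
        rw [e] at hQ hcon hx1
        have k1 : 0 ≤ x * ((B - z.im) * (B + z.im)) :=
          mul_nonneg (by linarith) (mul_nonneg (by linarith) (by linarith))
        have k2 : 0 ≤ x * (B - a) := mul_nonneg (by linarith) (by linarith)
        have k3 : 0 ≤ (x - 1) * B := mul_nonneg (by linarith) (by linarith)
        have k4 : 0 < x * ((x - 3 * B) * (x + 3 * B)) :=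
          mul_pos (by linarith) (mul_pos (by linarith) (by linarith))
        have k5 : 0 ≤ x * (B * (B - 10)) :=
          mul_nonneg (by linarith) (mul_nonneg (by linarith) (by linarith))
        nlinarith
      · linarith
      · linarith

theorem cubic_eigenfunction_nonreal_zeros_finite_even (a lam : ℝ)
    (h : (a, lam) ∈ cubicRealLocus) (y : ℂ → ℂ)
    (hy : IsCubicEigenfunction (a : ℂ) (lam : ℂ) y) :
    (nonrealZeros y).Finite ∧ Even (nonrealZeros y).ncard := by

  obtain ⟨hs, c, hc0, hc⟩ := cub_refl hy
  set U : Set ℂ := {z | y z = 0 ∧ 0 < z.im} with hU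
  have hconj : ∀ z, y ((starRingEnd ℂ) z) = 0 ↔ y z = 0 := by
    intro z
    have h1 := hc z
    constructor
    · intro h2
      have h3 : c * y z = 0 := by rw [← h1]; simp [cubStar, h2]
      exact (mul_eq_zero.1 h3).resolve_left hc0
    · intro h2
      rw [h2, mul_zero] at h1
      simpa [cubStar] using h1
  have hUfin : U.Finite := by
    set R := 3 * (10 + |a| + |lam|) with hR
    have hRp : 0 ≤ R := by positivity
    set K := Metric.closedBall (0:ℂ) (R + R) with hK
    have han : AnalyticOnNhd ℂ y K := fun z _ => hs.diff.analyticAt z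
    have hpre : IsPreconnected K := (convex_closedBall _ _).isPreconnected
    have hUK : U ⊆ K := by
      rintro z ⟨hz, him⟩
      have := upper_bound hs hc him hz
      rw [hK, mem_closedBall_zero_iff]
      exact (Complex.norm_le_abs_re_add_abs_im z).trans (add_le_add this.1 this.2)
    rcases han.eqOn_zero_or_eventually_ne_zero_of_preconnected hpre with h1 | h1
    · exfalso
      have h00 : (0:ℂ) ∈ K := by rw [hK]; simp; linarith
      have han' : AnalyticOnNhd ℂ y Set.univ := fun z _ => hs.diff.analyticAt z
      have hev : y =ᶠ[nhds 0] 0 := by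
        filter_upwards [Metric.closedBall_mem_nhds (0:ℂ) (by positivity : 0 < R + R)] with z hz
        exact h1 hz
      apply hs.ne
      funext z
      exact han'.eqOn_zero_of_preconnected_of_eventuallyEq_zero isPreconnected_univ
        (Set.mem_univ 0) hev (Set.mem_univ z)
    · have h2 := (isCompact_closedBall (0:ℂ) (R + R)).finite_sdiff_of_mem_codiscreteWithin h1
      refine h2.subset fun z hz => ⟨hUK hz, fun hne => hne hz.1⟩
  have hinj : Function.Injective (starRingEnd ℂ) := (starRingEnd ℂ).injective
  have hsplit : nonrealZeros y = U ∪ (starRingEnd ℂ) '' U := by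
    ext z
    simp only [nonrealZeros, Set.mem_ofPred_eq, hU, Set.mem_union, Set.mem_image]
    constructor
    · rintro ⟨h1, h2⟩
      rcases lt_or_gt_of_ne h2 with h3 | h3
      · exact Or.inr ⟨(starRingEnd ℂ) z, ⟨(hconj z).2 h1, by simpa using h3⟩, by simp⟩
      · exact Or.inl ⟨h1, h3⟩
    · rintro (⟨h1, h2⟩ | ⟨w, ⟨h1, h2⟩, rfl⟩)
      · exact ⟨h1, h2.ne'⟩
      · exact ⟨(hconj w).2 h1, by simpa using h2.ne'⟩
  have hdisj : Disjoint U ((starRingEnd ℂ) '' U) := by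
    rw [Set.disjoint_left]
    rintro z ⟨_, h1⟩ ⟨w, ⟨_, h2⟩, rfl⟩
    simp at h1
    linarith
  rw [hsplit]
  refine ⟨hUfin.union (hUfin.image _), ?_⟩
  rw [Set.ncard_union_eq hdisj hUfin (hUfin.image _), Set.ncard_image_of_injective _ hinj]
  exact ⟨_, rfl⟩
end
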